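/- Let X be a compact connected analytic subset of ℝⁿ. Then there exist a positive integer ν and a constant C > 0 such that any two points x, y ∈ X can be joined by a continuous path γ : [0,1] → ℝⁿ with γ(0) = x, γ(1) = y, γ([0,1]) ⊆ X, and whose length satisfies ℓ(γ) ≤ C·‖x − y‖^{1/ν}. -/

import Mathlib

/-- A set `X ⊆ ℝⁿ` is an analytic subset if each point of `ℝⁿ` has an open
neighborhood `U` on which `X ∩ U` is the common zero set of finitely many
real-analytic functions. -/
def IsAnalyticSubset {n : ℕ} (X : Set (EuclideanSpace ℝ (Fin n))) : Prop :=
  ∀ p : EuclideanSpace ℝ (Fin n),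
    ∃ U : Set (EuclideanSpace ℝ (Fin n)), IsOpen U ∧ p ∈ U ∧
      ∃ (k : ℕ) (f : Fin k → EuclideanSpace ℝ (Fin n) → ℝ),
        (∀ i, AnalyticOn ℝ (f i) U) ∧
        X ∩ U = {q ∈ U | ∀ i, f i q = 0}

namespace WR

section Residue

variable {κ B K : Type*} [Field κ] [CommRing B] [Algebra κ B] [Field K] [Algebra B K]
  [Algebra κ K] [IsScalarTower κ B K]

/-- the `κ`-subspace `g ^ m B` -/
def Nn (κ : Type*) {B : Type*} [Field κ] [CommRing B] [Algebra κ B] (g : B) (m : ℕ) :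
    Submodule κ B := LinearMap.range (LinearMap.mulLeft κ (g ^ m))

lemma mem_Nn {g : B} {m : ℕ} {x : B} : x ∈ Nn κ g m ↔ ∃ b, g ^ m * b = x := by
  simp [Nn]

lemma Nn_anti (g : B) {m m' : ℕ} (h : m ≤ m') : Nn κ g m' ≤ Nn κ g m := by
  intro x hx
  obtain ⟨b, rfl⟩ := mem_Nn.1 hx
  exact mem_Nn.2 ⟨g ^ (m' - m) * b, by rw [← mul_assoc, ← pow_add]; congr 2; omega⟩

/-- trace at level `m` -/
noncomputable def trm (g : B) (m : ℕ) (T : B →ₗ[κ] B) (h : Nn κ g m ≤ LinearMap.ker T) : κ :=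
  LinearMap.trace κ (B ⧸ Nn κ g m) ((Nn κ g m).mkQ ∘ₗ (Nn κ g m).liftQ T h)

lemma trm_eq (g : B) (hfin : ∀ m, FiniteDimensional κ (B ⧸ Nn κ g m)) {m m' : ℕ} (hm : m ≤ m')
    (T : B →ₗ[κ] B) (h : Nn κ g m ≤ LinearMap.ker T) (h' : Nn κ g m' ≤ LinearMap.ker T) :
    trm g m' T h' = trm g m T h := by
  have := hfin m
  have := hfin m'
  have hle : Nn κ g m' ≤ (Nn κ g m).comap LinearMap.id := by
    simpa using Nn_anti g hm
  have hh := LinearMap.trace_comp_comm' (R := κ)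
    ((Nn κ g m').mkQ ∘ₗ (Nn κ g m).liftQ T h)
    ((Nn κ g m').mapQ (Nn κ g m) LinearMap.id hle)
  unfold trm
  have e1 : ((Nn κ g m').mkQ ∘ₗ (Nn κ g m).liftQ T h) ∘ₗ
      ((Nn κ g m').mapQ (Nn κ g m) LinearMap.id hle) =
      (Nn κ g m').mkQ ∘ₗ (Nn κ g m').liftQ T h' := by
    ext x; simp
  have e2 : ((Nn κ g m').mapQ (Nn κ g m) LinearMap.id hle) ∘ₗ
      ((Nn κ g m').mkQ ∘ₗ (Nn κ g m).liftQ T h) = (Nn κ g m).mkQ ∘ₗ (Nn κ g m).liftQ T h := by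
    ext x; simp
  rw [e1, e2] at hh
  exact hh.symm

open Classical in
/-- trace of an operator killing some `g ^ m B` -/
noncomputable def Trg (g : B) (T : B →ₗ[κ] B) : κ :=
  if h : ∃ m, Nn κ g m ≤ LinearMap.ker T then trm g h.choose T h.choose_spec else 0

lemma Trg_eq (g : B) (hfin : ∀ m, FiniteDimensional κ (B ⧸ Nn κ g m)) {m : ℕ}
    (T : B →ₗ[κ] B) (h : Nn κ g m ≤ LinearMap.ker T) : Trg g T = trm g m T h := by
  have hex : ∃ m, Nn κ g m ≤ LinearMap.ker T := ⟨m, h⟩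
  rw [Trg, dif_pos hex]
  rcases le_total m hex.choose with h1 | h1
  · exact trm_eq g hfin h1 T h _
  · exact (trm_eq g hfin h1 T _ h).symm

lemma Trg_add (g : B) (hfin : ∀ m, FiniteDimensional κ (B ⧸ Nn κ g m)) {m m' : ℕ}
    (T T' : B →ₗ[κ] B) (h : Nn κ g m ≤ LinearMap.ker T) (h' : Nn κ g m' ≤ LinearMap.ker T') :
    Trg g (T + T') = Trg g T + Trg g T' := by
  have h1 := (Nn_anti (κ := κ) g (le_max_left m m')).trans h
  have h2 := (Nn_anti (κ := κ) g (le_max_right m m')).trans h'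
  have h3 : Nn κ g (max m m') ≤ LinearMap.ker (T + T') := by
    intro x hx
    have a := h1 hx
    have b := h2 hx
    simp only [LinearMap.mem_ker] at *
    simp [a, b]
  rw [Trg_eq g hfin _ h1, Trg_eq g hfin _ h2, Trg_eq g hfin _ h3]
  unfold trm
  rw [← map_add]
  congr 1
  ext x; simp

lemma Trg_comm (g : B) (hfin : ∀ m, FiniteDimensional κ (B ⧸ Nn κ g m)) {m : ℕ}
    (T : B →ₗ[κ] B) (h : Nn κ g m ≤ LinearMap.ker T) (a : B) :
    Trg g (LinearMap.mulLeft κ a ∘ₗ T) = Trg g (T ∘ₗ LinearMap.mulLeft κ a) := by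
  have h1 : Nn κ g m ≤ LinearMap.ker (LinearMap.mulLeft κ a ∘ₗ T) := by
    intro x hx
    have := h hx
    simp only [LinearMap.mem_ker] at *
    simp [this]
  have hle : Nn κ g m ≤ (Nn κ g m).comap (LinearMap.mulLeft κ a) := by
    intro x hx
    obtain ⟨b, rfl⟩ := mem_Nn.1 hx
    exact mem_Nn.2 ⟨a * b, by simp; ring⟩
  have h2 : Nn κ g m ≤ LinearMap.ker (T ∘ₗ LinearMap.mulLeft κ a) := by
    intro x hx
    have := h (hle hx)
    simpa using this
  have := hfin m
  rw [Trg_eq g hfin _ h1, Trg_eq g hfin _ h2]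
  unfold trm
  have hh := LinearMap.trace_comp_comm' (R := κ)
    ((Nn κ g m).mapQ (Nn κ g m) (LinearMap.mulLeft κ a) hle)
    ((Nn κ g m).mkQ ∘ₗ (Nn κ g m).liftQ T h)
  convert hh.symm using 2
  · ext x; simp
  · ext x; simp

lemma Trg_zero (g : B) (hfin : ∀ m, FiniteDimensional κ (B ⧸ Nn κ g m)) :
    Trg g (0 : B →ₗ[κ] B) = 0 := by
  have h0 : Nn κ g 0 ≤ LinearMap.ker (0 : B →ₗ[κ] B) := fun x _ => rfl
  have := Trg_add g hfin 0 0 h0 h0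
  rw [add_zero] at this
  exact left_eq_add.1 this

/-- commutator of the projection with multiplication -/
noncomputable def phi (π : K →ₗ[κ] B) (h : B) : K →ₗ[κ] B :=
  π ∘ₗ LinearMap.mulLeft κ (algebraMap B K h) - LinearMap.mulLeft κ h ∘ₗ π

noncomputable def Top (π : K →ₗ[κ] B) (h : B) (f : K) : B →ₗ[κ] B :=
  phi π h ∘ₗ LinearMap.mulLeft κ f ∘ₗ (IsScalarTower.toAlgHom κ B K).toLinearMap

lemma Top_apply (π : K →ₗ[κ] B) (h : B) (f : K) (b : B) :
    Top π h f b = π (algebraMap B K h * (f * algebraMap B K b)) -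
      h * π (f * algebraMap B K b) := by
  simp [Top, phi]

lemma Top_ker (π : K →ₗ[κ] B) (hπ : ∀ b, π (algebraMap B K b) = b) (g h : B) (f : K) (m : ℕ)
    (c : B) (hf : algebraMap B K (g ^ m) * f = algebraMap B K c) :
    Nn κ g m ≤ LinearMap.ker (Top π h f) := by
  intro x hx
  obtain ⟨b, rfl⟩ := mem_Nn.1 hx
  rw [LinearMap.mem_ker, Top_apply]
  have : f * algebraMap B K (g ^ m * b) = algebraMap B K (c * b) := by
    rw [map_mul, map_mul, ← hf]; ring
  rw [this, ← map_mul, hπ, hπ]; ring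

/-- Tate-style residue: a `κ`-derivation on `B` with values in the dual of `K`, vanishing
on `B` and nontrivial on `dg / g`. -/
theorem tateResidue (hinj : Function.Injective (algebraMap B K)) (g : B) (hg : g ≠ 0)
    (hfin : ∀ m, FiniteDimensional κ (B ⧸ Nn κ g m))
    (hK : ∀ f : K, ∃ (m : ℕ) (b : B), algebraMap B K (g ^ m) * f = algebraMap B K b)
    (hdim : (Module.finrank κ (B ⧸ Nn κ g 1) : κ) ≠ 0) :
    ∃ d : B → K → κ,
      (∀ h h' f, d (h + h') f = d h f + d h' f) ∧
      (∀ h h' f, d (h * h') f = d h (algebraMap B K h' * f) + d h' (algebraMap B K h * f)) ∧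
      (∀ h f f', d h (f + f') = d h f + d h f') ∧
      (∀ (c : κ) f, d (algebraMap κ B c) f = 0) ∧
      (∀ h b, d h (algebraMap B K b) = 0) ∧
      d g (algebraMap B K g)⁻¹ ≠ 0 := by
  obtain ⟨π, hπ'⟩ := LinearMap.exists_leftInverse_of_injective
    (IsScalarTower.toAlgHom κ B K).toLinearMap
    (LinearMap.ker_eq_bot.2 (by intro a b hab; exact hinj (by simpa using hab)))
  have hπ : ∀ b, π (algebraMap B K b) = b := fun b => by
    have := LinearMap.congr_fun hπ' b
    simpa using this
  have hker : ∀ h f, ∃ m, Nn κ g m ≤ LinearMap.ker (Top π h f) := fun h f => by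
    obtain ⟨m, c, hc⟩ := hK f
    exact ⟨m, Top_ker π hπ g h f m c hc⟩
  refine ⟨fun h f => Trg g (Top π h f), ?_, ?_, ?_, ?_, ?_, ?_⟩
  · intro h h' f
    obtain ⟨m, hm⟩ := hker h f
    obtain ⟨m', hm'⟩ := hker h' f
    show Trg g _ = Trg g _ + Trg g _
    rw [← Trg_add g hfin _ _ hm hm']
    congr 1
    ext b
    simp only [LinearMap.add_apply, Top_apply, map_add, add_mul]; ring
  · intro h h' f
    obtain ⟨m, hm⟩ := hker h (algebraMap B K h' * f)
    obtain ⟨m', hm'⟩ := hker h' f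
    obtain ⟨m2, hm2⟩ := hker h' (algebraMap B K h * f)
    have e : Top π h' (algebraMap B K h * f) = Top π h' f ∘ₗ LinearMap.mulLeft κ h := by
      ext b
      simp only [LinearMap.comp_apply, LinearMap.mulLeft_apply, Top_apply, map_mul]
      have : algebraMap B K h * f * algebraMap B K b = f * (algebraMap B K h * algebraMap B K b) := by
        ring
      rw [this]
    show Trg g _ = Trg g _ + Trg g _
    rw [e, ← Trg_comm g hfin _ hm']
    have hk : Nn κ g m' ≤ LinearMap.ker (LinearMap.mulLeft κ h ∘ₗ Top π h' f) := by
      intro x hx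
      have := hm' hx
      simp only [LinearMap.mem_ker] at *
      simp [this]
    rw [← Trg_add g hfin _ _ hm hk]
    congr 1
    ext b
    simp only [LinearMap.add_apply, LinearMap.comp_apply, LinearMap.mulLeft_apply, Top_apply,
      map_mul, mul_sub]
    have e1 : algebraMap B K h * algebraMap B K h' * (f * algebraMap B K b) =
      algebraMap B K h * (algebraMap B K h' * f * algebraMap B K b) := by ring
    have e2 : algebraMap B K h' * (f * algebraMap B K b) =
      (algebraMap B K h' * f * algebraMap B K b) := by ring
    rw [e1, e2]; ring
  · intro h f f'
    obtain ⟨m, hm⟩ := hker h f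
    obtain ⟨m', hm'⟩ := hker h f'
    show Trg g _ = Trg g _ + Trg g _
    rw [← Trg_add g hfin _ _ hm hm']
    congr 1
    ext b
    simp only [LinearMap.add_apply, Top_apply, map_add, add_mul, mul_add]; ring
  · intro c f
    have : Top π (algebraMap κ B c) f = 0 := by
      ext b
      rw [Top_apply, ← IsScalarTower.algebraMap_apply, ← Algebra.smul_def, ← Algebra.smul_def, π.map_smul]
      exact sub_self _
    show Trg g _ = 0
    rw [this]; exact Trg_zero g hfin
  · intro h b
    have : Top π h (algebraMap B K b) = 0 := by
      ext c
      rw [Top_apply, ← map_mul, ← map_mul, hπ, hπ]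
      exact sub_self _
    show Trg g _ = 0
    rw [this]; exact Trg_zero g hfin
  · have hgK : algebraMap B K g ≠ 0 := by
      rw [Ne, map_eq_zero_iff _ hinj]; exact hg
    have hk := Top_ker π hπ g g (algebraMap B K g)⁻¹ 1 1 (by simp [hgK])
    show Trg g (Top π g (algebraMap B K g)⁻¹) ≠ 0
    rw [Trg_eq g hfin _ hk]
    unfold trm
    have : ((Nn κ g 1).mkQ ∘ₗ (Nn κ g 1).liftQ (Top π g (algebraMap B K g)⁻¹) hk) =
        LinearMap.id := by
      ext b
      simp only [LinearMap.comp_apply, Submodule.mkQ_apply, Submodule.liftQ_apply,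
        LinearMap.id_apply, Top_apply]
      rw [mul_inv_cancel_left₀ hgK, hπ, Submodule.Quotient.eq, mem_Nn]
      exact ⟨- π ((algebraMap B K g)⁻¹ * algebraMap B K b), by ring⟩
    rw [this, LinearMap.trace_id]
    exact hdim

end Residue

end WR

namespace WR

/-- Noether normalization data for a prime `Q` in a ring with derivations. -/
def NNProp {R : Type*} [CommRing R] [Algebra ℝ R] {n : ℕ} (D : Fin n → Derivation ℝ R R)
    (x : Fin n → R) (Q : Ideal R) : Prop :=
  ∃ T0 : Subalgebra ℝ R, (∀ t ∈ T0, t ∈ Q → t = 0) ∧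
    (∀ t ∈ T0, ∃ (r : ℕ) (a : Fin r → R) (c : Fin r → Fin n → ℝ),
      (∀ l, ∑ i, c l i • x i ∈ T0) ∧ ∀ i, D i t = ∑ l, c l i • a l) ∧
    ∀ r : R, ∃ t ∈ Algebra.adjoin ℝ ((T0 : Set R) ∪ Set.range x),
      r - t ∈ Ideal.span ((Q : Set R) ∩ (Algebra.adjoin ℝ ((T0 : Set R) ∪ Set.range x) : Set R))

section MaxField

variable {K : Type*} [Field K]

/-- maximal subfields in a local subring -/
lemma exists_max_subfield (B : Subring K) (F0 : Subfield K) (h0 : (F0 : Set K) ⊆ B) :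
    ∃ F : Subfield K, F0 ≤ F ∧ (F : Set K) ⊆ B ∧
      ∀ F' : Subfield K, F ≤ F' → (F' : Set K) ⊆ B → F' = F := by
  obtain ⟨F, hF, hmax⟩ := zorn_le_nonempty₀ {F : Subfield K | (F : Set K) ⊆ B} (by
    intro c hc hchain y hy
    refine ⟨sSup c, ?_, fun z hz => le_sSup hz⟩
    intro x hx
    obtain ⟨F, hF, hx'⟩ := (Subfield.mem_sSup_of_directedOn ⟨y, hy⟩ hchain.directedOn).1 hx
    exact hc hF hx') F0 h0
  exact ⟨F, hF, hmax.prop, fun F' h1 h2 => (hmax.eq_of_le h2 h1).symm⟩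

end MaxField

section core

variable {B : Type*} [CommRing B] [IsLocalRing B] [IsNoetherianRing B]
  {κ : Type*} [Field κ] [Algebra κ B]

open IsLocalRing

lemma exists_fg_add_pow (W : Submodule κ B) (hW : W.FG)
    (h1 : ∀ b : B, ∃ w ∈ W, b - w ∈ maximalIdeal B) (j : ℕ) :
    ∃ V : Submodule κ B, V.FG ∧ ∀ b : B, ∃ w ∈ V, b - w ∈ maximalIdeal B ^ j := by
  induction j with
  | zero => exact ⟨⊥, Submodule.fg_bot, fun b => ⟨0, by simp, by simp⟩⟩
  | succ j ih =>
    obtain ⟨V, hV, hV'⟩ := ih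
    obtain ⟨s, hs⟩ := IsNoetherian.noetherian (maximalIdeal B)
    refine ⟨W ⊔ ⨆ p : s, V.map (LinearMap.mulLeft κ (p : B)), ?_, ?_⟩
    · exact hW.sup (Submodule.fg_iSup _ fun p => hV.map _)
    · intro b
      obtain ⟨w, hw, hb⟩ := h1 b
      have key : ∀ c ∈ Submodule.span B (s : Set B),
          ∃ v ∈ ⨆ p : s, V.map (LinearMap.mulLeft κ (p : B)), c - v ∈ maximalIdeal B ^ (j + 1) := by
        intro c hc
        rw [Submodule.mem_span_finset] at hc
        obtain ⟨f, -, rfl⟩ := hc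
        choose w hw hw' using fun p : B => hV' (f p)
        refine ⟨∑ p ∈ s, p * w p, ?_, ?_⟩
        · refine Submodule.sum_mem _ fun p hp => ?_
          exact Submodule.mem_iSup_of_mem (⟨p, hp⟩ : s) ⟨w p, hw p, by simp⟩
        · rw [← Finset.sum_sub_distrib]
          refine Submodule.sum_mem _ fun p hp => ?_
          have : f p • p - p * w p = p * (f p - w p) := by rw [smul_eq_mul]; ring
          rw [this, pow_succ']
          refine Ideal.mul_mem_mul ?_ (hw' p)
          rw [← hs]; exact Submodule.subset_span hp
      rw [← hs] at hb
      obtain ⟨v, hv, hv'⟩ := key _ hb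
      exact ⟨w + v, Submodule.add_mem_sup hw hv, by rwa [← sub_sub]⟩

lemma finite_quot (W : Submodule κ B) (hW : W.FG)
    (h1 : ∀ b : B, ∃ w ∈ W, b - w ∈ maximalIdeal B) (g : B) (s : ℕ)
    (hs : maximalIdeal B ^ s ≤ Ideal.span {g}) (m : ℕ) :
    FiniteDimensional κ (B ⧸ Nn κ g m) := by
  obtain ⟨V, hV, hV'⟩ := exists_fg_add_pow W hW h1 (s * m)
  have : FiniteDimensional κ V := Module.Finite.iff_fg.2 hV
  refine Module.Finite.of_surjective ((Nn κ g m).mkQ ∘ₗ V.subtype) ?_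
  intro y
  obtain ⟨b, rfl⟩ := Submodule.mkQ_surjective _ y
  obtain ⟨w, hw, hb⟩ := hV' b
  refine ⟨⟨w, hw⟩, ?_⟩
  simp only [LinearMap.comp_apply, Submodule.subtype_apply, Submodule.mkQ_apply]
  symm
  rw [Submodule.Quotient.eq, mem_Nn]
  have h2 : maximalIdeal B ^ (s * m) ≤ Ideal.span {g ^ m} := by
    rw [pow_mul, ← Ideal.span_singleton_pow]
    exact Ideal.pow_right_mono hs m
  obtain ⟨c, hc⟩ := Ideal.mem_span_singleton.1 (h2 hb)
  exact ⟨c, hc.symm⟩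

/-- residue field finite generation -/
lemma exists_W (halg : ∀ b : B, IsIntegral κ (residue B b)) (s : Set B) (hs : s.Finite)
    (hgen : ∀ b : B, ∃ p q : B, q * b = p ∧ q ∉ maximalIdeal B ∧
      residue B p ∈ Algebra.adjoin κ (residue B '' s) ∧
      residue B q ∈ Algebra.adjoin κ (residue B '' s)) :
    ∃ W : Submodule κ B, W.FG ∧ ∀ b : B, ∃ w ∈ W, b - w ∈ maximalIdeal B := by
  have hfin : (Subalgebra.toSubmodule (Algebra.adjoin κ (residue B '' s))).FG := by
    refine fg_adjoin_of_finite (hs.image _) ?_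
    rintro _ ⟨b, -, rfl⟩
    exact halg b
  have htop : ∀ b : B, residue B b ∈ Algebra.adjoin κ (residue B '' s) := by
    intro b
    obtain ⟨p, q, h, hq, h1, h2⟩ := hgen b
    have hq0 : residue B q ≠ 0 := by rwa [Ne, residue_eq_zero_iff]
    have : Algebra.IsAlgebraic κ (ResidueField B) := ⟨fun z => by
      obtain ⟨b, rfl⟩ := residue_surjective (R := B) z
      exact (halg b).isAlgebraic⟩
    have hinv : (residue B q)⁻¹ ∈ Algebra.adjoin κ (residue B '' s) := by
      have := (Subalgebra.isField_of_algebraic (Algebra.adjoin κ (residue B '' s)))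
      obtain ⟨y, hy⟩ := this.mul_inv_cancel (a := ⟨_, h2⟩) (by
        intro h; exact hq0 (congrArg Subtype.val h))
      have hy' : residue B q * (y : ResidueField B) = 1 := congrArg Subtype.val hy
      rw [inv_eq_of_mul_eq_one_right hy']
      exact y.2
    have : residue B b = (residue B q)⁻¹ * residue B p := by
      rw [← h, map_mul, inv_mul_cancel_left₀ hq0]
    rw [this]
    exact mul_mem hinv h1
  obtain ⟨t, ht⟩ := hfin
  choose l hl using residue_surjective (R := B)
  refine ⟨Submodule.span κ (l '' t), ?_, ?_⟩
  · exact Submodule.fg_span (t.finite_toSet.image _)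
  · intro b
    have hb : residue B b ∈ Submodule.span κ (t : Set (ResidueField B)) := by
      rw [ht]; exact htop b
    have key : ∀ z ∈ Submodule.span κ (t : Set (ResidueField B)),
        ∃ w ∈ Submodule.span κ (l '' t), residue B w = z := by
      intro z hz
      induction hz using Submodule.span_induction with
      | mem z hz => exact ⟨l z, Submodule.subset_span ⟨z, hz, rfl⟩, hl z⟩
      | zero => exact ⟨0, zero_mem _, map_zero _⟩
      | add a b _ _ ha hb =>
        obtain ⟨w, hw, h⟩ := ha
        obtain ⟨w', hw', h'⟩ := hb
        exact ⟨w + w', add_mem hw hw', by rw [map_add, h, h']⟩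
      | smul c a _ ha =>
        obtain ⟨w, hw, h⟩ := ha
        refine ⟨c • w, Submodule.smul_mem _ _ hw, ?_⟩
        rw [← h, Algebra.smul_def, Algebra.smul_def, map_mul]; rfl
    obtain ⟨w, hw, h⟩ := key _ hb
    refine ⟨w, hw, ?_⟩
    rw [← residue_eq_zero_iff, map_sub, h, sub_self]

end core

section main

open IsLocalRing

lemma E_vanish {R K κ : Type*} [CommRing R] [Algebra ℝ R] [Field K] [Algebra R K] [AddCommGroup κ]
    {n : ℕ} (D : Fin n → Derivation ℝ R R) (x : Fin n → R)
    (hx : ∀ i j, D i (x j) = if i = j then 1 else 0)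
    (T0 : Subalgebra ℝ R) (Q : Ideal R)
    (hchain : ∀ t ∈ T0, ∃ (r : ℕ) (a : Fin r → R) (c : Fin r → Fin n → ℝ),
      (∀ l, ∑ i, c l i • x i ∈ T0) ∧ ∀ i, D i t = ∑ l, c l i • a l)
    (hT : ∀ r : R, ∃ t ∈ Algebra.adjoin ℝ ((T0 : Set R) ∪ Set.range x),
      r - t ∈ Ideal.span ((Q : Set R) ∩ (Algebra.adjoin ℝ ((T0 : Set R) ∪ Set.range x) : Set R)))
    (d : R → K → κ)
    (d1 : ∀ h h' f, d (h + h') f = d h f + d h' f)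
    (d2 : ∀ h h' f, d (h * h') f = d h (algebraMap R K h' * f) + d h' (algebraMap R K h * f))
    (d3 : ∀ h f f', d h (f + f') = d h f + d h f')
    (d4 : ∀ t ∈ T0, ∀ f, d t f = 0)
    (reg : ℕ → K → Prop) (hreg0 : ∀ r f, reg 0 f → d r f = 0)
    (hreg1 : ∀ m f, ∀ r : R, reg m f → reg m (algebraMap R K r * f))
    (hreg2 : ∀ m f, ∀ p ∈ Q, reg (m + 1) f → reg m (algebraMap R K p * f))
    (m : ℕ) (r : R) (f : K) (hf : reg m f) :
    d r f = ∑ i, d (x i) (algebraMap R K (D i r) * f) := by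
  have d30 : ∀ h, d h 0 = 0 := fun h => by simpa using d3 h 0 0
  have d10 : ∀ f, d 0 f = 0 := fun f => by simpa using d1 0 0 f
  let E : R → K →+ κ := fun r =>
    { toFun := fun f => d r f - ∑ i, d (x i) (algebraMap R K (D i r) * f)
      map_zero' := by simp [d30]
      map_add' := by
        intro a b
        simp only [mul_add, d3, Finset.sum_add_distrib]; abel }
  have hE : ∀ r f, E r f = d r f - ∑ i, d (x i) (algebraMap R K (D i r) * f) := fun _ _ => rfl
  have Eadd : ∀ a b f, E (a + b) f = E a f + E b f := by
    intro a b f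
    simp only [hE, map_add, add_mul, d1, d3, Finset.sum_add_distrib]; abel
  have Emul : ∀ a b f, E (a * b) f = E a (algebraMap R K b * f) + E b (algebraMap R K a * f) := by
    intro a b f
    have : ∀ i, d (x i) (algebraMap R K (D i (a * b)) * f) =
        d (x i) (algebraMap R K (D i a) * (algebraMap R K b * f)) +
        d (x i) (algebraMap R K (D i b) * (algebraMap R K a * f)) := by
      intro i
      rw [← d3]
      congr 1
      rw [Derivation.leibniz, smul_eq_mul, smul_eq_mul, map_add, map_mul, map_mul]; ring
    simp only [hE, this, d2, Finset.sum_add_distrib]; abel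
  have ET0 : ∀ t ∈ T0, ∀ f, E t f = 0 := by
    intro t ht f
    obtain ⟨l, a, c, hy, hc⟩ := hchain t ht
    rw [hE, d4 t ht, zero_sub, neg_eq_zero]
    have hsum : ∀ (i : Fin n) (s : Finset (Fin l)), d (x i) (algebraMap R K (∑ l ∈ s, c l i • a l) * f)
        = ∑ l ∈ s, d (c l i • x i) (algebraMap R K (a l) * f) := by
      intro i s
      induction s using Finset.cons_induction with
      | empty => simp [d30]
      | cons j s hj ih =>
        rw [Finset.sum_cons, Finset.sum_cons, map_add, add_mul, d3, ih]
        congr 1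
        rw [Algebra.smul_def, Algebra.smul_def, d2, d4 _ (T0.algebraMap_mem _), zero_add, map_mul,
          mul_assoc]
    have hsum2 : ∀ (y : Fin n → R) (s : Finset (Fin n)) f, d (∑ i ∈ s, y i) f = ∑ i ∈ s, d (y i) f := by
      intro y s f
      induction s using Finset.cons_induction with
      | empty => simp [d10]
      | cons j s hj ih => rw [Finset.sum_cons, Finset.sum_cons, d1, ih]
    simp only [hc, hsum]
    rw [Finset.sum_comm]
    refine Finset.sum_eq_zero fun l _ => ?_
    rw [← hsum2, d4 _ (hy l)]
  have Ex : ∀ j f, E (x j) f = 0 := by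
    intro j f
    rw [hE, Finset.sum_eq_single j]
    · simp [hx]
    · intro i _ hij; simp [hx, hij, d30]
    · simp
  have ET : ∀ t ∈ Algebra.adjoin ℝ ((T0 : Set R) ∪ Set.range x), ∀ f, E t f = 0 := by
    intro t ht
    induction ht using Algebra.adjoin_induction with
    | mem t ht =>
      rcases ht with ht | ⟨i, rfl⟩
      · exact ET0 t ht
      · exact Ex i
    | algebraMap r => exact ET0 _ (T0.algebraMap_mem r)
    | add a b _ _ ha hb => intro f; rw [Eadd, ha, hb, add_zero]
    | mul a b _ _ ha hb => intro f; rw [Emul, ha, hb, add_zero]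
  have main : ∀ m r f, reg m f → E r f = 0 := by
    intro m
    induction m with
    | zero =>
      intro r f hf
      rw [hE, hreg0 r f hf, Finset.sum_eq_zero, sub_zero]
      intro i _
      exact hreg0 _ _ (hreg1 _ _ _ hf)
    | succ m ih =>
      intro r f hf
      obtain ⟨t, ht, hj⟩ := hT r
      have key : ∀ j ∈ Ideal.span ((Q : Set R) ∩
          (Algebra.adjoin ℝ ((T0 : Set R) ∪ Set.range x) : Set R)), j ∈ Q ∧
          ∀ f, reg (m + 1) f → E j f = 0 := by
        intro j hj
        induction hj using Submodule.span_induction with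
        | mem j hj => exact ⟨hj.1, fun f _ => ET j hj.2 f⟩
        | zero => exact ⟨zero_mem _, fun f _ => by
            have := Eadd 0 0 f
            simpa using this⟩
        | add a b _ _ ha hb =>
          exact ⟨add_mem ha.1 hb.1, fun f hf => by rw [Eadd, ha.2 f hf, hb.2 f hf, add_zero]⟩
        | smul a j _ hj =>
          refine ⟨Q.mul_mem_left a hj.1, fun f hf => ?_⟩
          rw [smul_eq_mul, Emul, ih a _ (hreg2 m f j hj.1 hf), hj.2 _ (hreg1 _ _ a hf), add_zero]
      have : r = t + (r - t) := by ring
      rw [this, Eadd, ET t ht, (key _ hj).2 f hf, add_zero]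
  have := main m r f hf
  rwa [hE, sub_eq_zero] at this

theorem core {R K : Type*} [CommRing R] [Algebra ℝ R] [Field K] [CharZero K] [Algebra R K] {n : ℕ}
    (D : Fin n → Derivation ℝ R R) (x : Fin n → R)
    (hx : ∀ i j, D i (x j) = if i = j then 1 else 0)
    (B : Subring K) [IsLocalRing B] [IsNoetherianRing B] (hRB : ∀ r, algebraMap R K r ∈ B)
    (Q : Ideal R) (hQ : ∀ r, r ∈ Q ↔ (⟨algebraMap R K r, hRB r⟩ : B) ∈ maximalIdeal B)
    (hNN : NNProp D x Q) (g δ : R) (hg : algebraMap R K g ≠ 0) (hδ : algebraMap R K δ ≠ 0)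
    (hgQ : g ∈ Q) (s : ℕ)
    (hs : maximalIdeal B ^ s ≤ Ideal.span {(⟨algebraMap R K g, hRB g⟩ : B)})
    (hK : ∀ f : K, ∃ m : ℕ, algebraMap R K g ^ m * f ∈ B)
    (S : Set K) (hS : S.Finite) (hSB : S ⊆ B)
    (hgen : ∀ b ∈ B, ∃ p ∈ Algebra.adjoin R S, ∃ q ∈ Algebra.adjoin R S,
      q ≠ 0 ∧ q * b = p ∧ q⁻¹ ∈ B)
    (u : Fin n → R) (k : ℕ) (F c : Fin k → R) (hF : ∀ j, algebraMap R K (F j) = 0)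
    (hu : ∀ i, u i = δ * D i g - ∑ j, c j * D i (F j))
    (huB : ∀ i, algebraMap R K (u i) / algebraMap R K (δ * g) ∈ B) : False := by
  obtain ⟨T0, hT0, hchain, hT⟩ := hNN
  set ψ : R →+* B := (algebraMap R K).codRestrict B hRB with hψ
  have hψK : ∀ r, algebraMap B K (ψ r) = algebraMap R K r := fun r => rfl
  have hunit : ∀ b : B, b ∉ maximalIdeal B → (b : K)⁻¹ ∈ B := by
    intro b hb
    rw [IsLocalRing.notMem_maximalIdeal] at hb
    obtain ⟨b', hb'⟩ := hb.exists_right_inv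
    have : (b : K) * b' = 1 := congrArg Subtype.val hb'
    rw [inv_eq_of_mul_eq_one_right this]
    exact b'.2
  -- the initial subfield
  have hF0 : (Subfield.closure ((algebraMap R K) '' T0) : Set K) ⊆ B := by
    intro y hy
    obtain ⟨a, ha, b, hb, rfl⟩ := Subfield.mem_closure_iff.1 hy
    have hcl : Subring.closure ((algebraMap R K) '' T0) ≤ T0.toSubring.map (algebraMap R K) := by
      rw [Subring.closure_le]; rintro _ ⟨t, ht, rfl⟩; exact ⟨t, ht, rfl⟩
    obtain ⟨a, ha, rfl⟩ := hcl ha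
    obtain ⟨b, hb', rfl⟩ := hcl hb
    rw [div_eq_mul_inv]
    refine B.mul_mem (hRB a) ?_
    by_cases hb0 : b = 0
    · rw [hb0, map_zero, inv_zero]; exact B.zero_mem
    · refine hunit (ψ b) fun h => hb0 (hT0 b hb' ((hQ b).2 h))
  obtain ⟨κ, hκ0, hκB, hκmax⟩ := exists_max_subfield B _ hF0
  have hT0κ : ∀ t ∈ T0, algebraMap R K t ∈ κ := fun t ht =>
    hκ0 (Subfield.subset_closure ⟨t, ht, rfl⟩)
  let algκ : Algebra κ B := (Subring.inclusion (S := κ.toSubring) (T := B) hκB).toAlgebra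
  have : IsScalarTower κ B K := IsScalarTower.of_algebraMap_eq fun _ => rfl
  have halg : ∀ b : B, IsIntegral κ (residue B b) := by
    intro b
    rw [← isAlgebraic_iff_isIntegral]
    by_contra htr
    have hle : ((IntermediateField.adjoin κ {(b : K)}).toSubfield : Set K) ⊆ B := by
      intro y hy
      obtain ⟨r, q, rfl⟩ := (IntermediateField.mem_adjoin_simple_iff κ y).1 hy
      have h1 : ∀ r : Polynomial κ, Polynomial.aeval (b : K) r = (Polynomial.aeval b r : B) :=
        fun r => Polynomial.aeval_algebraMap_apply K b r
      rw [h1, h1, div_eq_mul_inv]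
      refine B.mul_mem (Subtype.prop _) ?_
      by_cases hq : q = 0
      · rw [hq]; simp
      · refine hunit _ fun hmem => ?_
        rw [← residue_eq_zero_iff] at hmem
        have h2 : Polynomial.aeval (residue B b) q = residue B (Polynomial.aeval b q) :=
          Polynomial.aeval_algebraMap_apply (ResidueField B) b q
        exact htr ⟨q, hq, by rw [h2, hmem]⟩
    have heq := hκmax (IntermediateField.adjoin κ {(b : K)}).toSubfield (by
      intro y hy
      exact (IntermediateField.adjoin κ {(b : K)}).algebraMap_mem ⟨y, hy⟩) hle
    have hb : (b : K) ∈ κ := by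
      rw [← heq]; exact IntermediateField.mem_adjoin_simple_self κ (b : K)
    apply htr
    have : residue B b = algebraMap κ (ResidueField B) ⟨b, hb⟩ := rfl
    rw [this]
    exact isAlgebraic_algebraMap _
  set s' : Set B := {b | (b : K) ∈ S ∪ Set.range fun i => algebraMap R K (x i)} with hs'
  have hs'fin : s'.Finite :=
    (hS.union (Set.finite_range _)).preimage Subtype.val_injective.injOn
  have hTres : ∀ t ∈ Algebra.adjoin ℝ ((T0 : Set R) ∪ Set.range x),
      residue B (ψ t) ∈ Algebra.adjoin κ (residue B '' s') := by
    have hT0' : ∀ t ∈ T0, residue B (ψ t) ∈ Algebra.adjoin κ (residue B '' s') := by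
      intro t ht
      exact (Algebra.adjoin κ (residue B '' s')).algebraMap_mem ⟨algebraMap R K t, hT0κ t ht⟩
    intro t ht
    induction ht using Algebra.adjoin_induction with
    | mem t ht =>
      rcases ht with ht | ⟨i, rfl⟩
      · exact hT0' t ht
      · exact Algebra.subset_adjoin ⟨ψ (x i), Or.inr ⟨i, rfl⟩, rfl⟩
    | algebraMap r => exact hT0' _ (T0.algebraMap_mem r)
    | add a b _ _ ha hb => rw [map_add, map_add]; exact add_mem ha hb
    | mul a b _ _ ha hb => rw [map_mul, map_mul]; exact mul_mem ha hb
  have hRres : ∀ r, residue B (ψ r) ∈ Algebra.adjoin κ (residue B '' s') := by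
    intro r
    obtain ⟨t, ht, hj⟩ := hT r
    have hj' : r - t ∈ Q := (Ideal.span_le.2 Set.inter_subset_left) hj
    have h0 : residue B (ψ (r - t)) = 0 := (residue_eq_zero_iff _).2 ((hQ _).1 hj')
    rw [map_sub, map_sub, sub_eq_zero] at h0
    rw [h0]
    exact hTres t ht
  have hSres : ∀ y ∈ Algebra.adjoin R S, ∃ hy : y ∈ B,
      residue B ⟨y, hy⟩ ∈ Algebra.adjoin κ (residue B '' s') := by
    intro y hy
    induction hy using Algebra.adjoin_induction with
    | mem y hy => exact ⟨hSB hy, Algebra.subset_adjoin ⟨⟨y, hSB hy⟩, Or.inl hy, rfl⟩⟩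
    | algebraMap r => exact ⟨hRB r, hRres r⟩
    | add a b _ _ ha hb =>
      obtain ⟨ha, ha'⟩ := ha
      obtain ⟨hb, hb'⟩ := hb
      exact ⟨B.add_mem ha hb, add_mem ha' hb'⟩
    | mul a b _ _ ha hb =>
      obtain ⟨ha, ha'⟩ := ha
      obtain ⟨hb, hb'⟩ := hb
      exact ⟨B.mul_mem ha hb, mul_mem ha' hb'⟩
  obtain ⟨W, hW, hW'⟩ := exists_W (κ := κ) halg s' hs'fin (by
    intro b
    obtain ⟨p, hp, q, hq, hq0, hqb, hqinv⟩ := hgen b b.2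
    obtain ⟨hp, hp'⟩ := hSres p hp
    obtain ⟨hq, hq'⟩ := hSres q hq
    refine ⟨⟨p, hp⟩, ⟨q, hq⟩, Subtype.ext hqb, ?_, hp', hq'⟩
    rw [IsLocalRing.notMem_maximalIdeal]
    exact IsUnit.of_mul_eq_one ⟨q⁻¹, hqinv⟩ (Subtype.ext (mul_inv_cancel₀ hq0)))
  have hfin := finite_quot (κ := κ) W hW hW' (ψ g) s hs
  have hgB : ψ g ≠ 0 := fun h => hg (congrArg Subtype.val h)
  have hcz : CharZero κ := (algebraMap κ K).charZero
  have hgm : ψ g ∈ maximalIdeal B := (hQ g).1 hgQ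
  obtain ⟨d, d1, d2, d3, d4, d5, d6⟩ := tateResidue (κ := κ) (B := B) (K := K)
    Subtype.val_injective (ψ g) hgB hfin (by
      intro f
      obtain ⟨m, hm⟩ := hK f
      exact ⟨m, ⟨_, hm⟩, by rw [map_pow]; rfl⟩) (by
      rw [Nat.cast_ne_zero]
      have := hfin 1
      have hnt : Nontrivial (B ⧸ Nn κ (ψ g) 1) := by
        rw [Submodule.Quotient.nontrivial_iff]
        intro h
        have h1 : (1 : B) ∈ Nn κ (ψ g) 1 := by rw [h]; trivial
        obtain ⟨b, hb⟩ := mem_Nn.1 h1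
        rw [pow_one] at hb
        have := (maximalIdeal B).mul_mem_right b hgm
        rw [hb] at this
        exact (Ideal.ne_top_iff_one _).1 (Ideal.IsPrime.ne_top') this
      exact Module.finrank_pos.ne')
  have hEv := E_vanish D x hx T0 Q hchain hT (fun r f => d (ψ r) f)
    (fun h h' f => by simp only [map_add, d1])
    (fun h h' f => by simp only [map_mul, d2]; rfl)
    (fun h f f' => d3 _ f f')
    (fun t ht f => d4 ⟨algebraMap R K t, hT0κ t ht⟩ f)
    (fun m f => ∀ b ∈ maximalIdeal B ^ m, (b : K) * f ∈ B)
    (fun r f hf => by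
      have : f ∈ B := by simpa using hf 1 (by simp)
      exact d5 (ψ r) ⟨f, this⟩)
    (fun m f r hf b hb => by
      have := B.mul_mem (hRB r) (hf b hb)
      rwa [mul_left_comm] at this)
    (fun m f p hp hf b hb => by
      have := hf (b * ψ p) (by rw [pow_succ]; exact Ideal.mul_mem_mul hb ((hQ p).1 hp))
      rw [← mul_assoc]
      exact this)
  have hEv' : ∀ r f, d (ψ r) f = ∑ i, d (ψ (x i)) (algebraMap R K (D i r) * f) := by
    intro r f
    obtain ⟨m, hm⟩ := hK f
    refine hEv (s * m) r f ?_
    intro b hb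
    have h2 : maximalIdeal B ^ (s * m) ≤ Ideal.span {ψ g ^ m} := by
      rw [pow_mul, ← Ideal.span_singleton_pow]
      exact Ideal.pow_right_mono hs m
    obtain ⟨c, hc⟩ := Ideal.mem_span_singleton.1 (h2 hb)
    have hc' : (b : K) = algebraMap R K g ^ m * c := by rw [hc]; rfl
    rw [hc', mul_right_comm]
    exact B.mul_mem hm c.2
  apply d6
  rw [hψK]
  set h := (algebraMap R K (δ * g))⁻¹ with hh
  have e1 : (algebraMap R K g)⁻¹ = algebraMap R K δ * h := by
    rw [hh, map_mul, mul_inv, mul_inv_cancel_left₀ hδ]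
  have d30 : ∀ h, d h 0 = 0 := fun h => by simpa using d3 h 0 0
  have e2 : ∀ i, algebraMap R K (D i g) * (algebraMap R K δ * h) =
      algebraMap R K (u i) / algebraMap R K (δ * g) +
      ∑ j, algebraMap R K (D i (F j)) * (algebraMap R K (c j) * h) := by
    intro i
    rw [hu, div_eq_mul_inv, ← hh, map_sub, map_sum, map_mul, sub_mul, Finset.sum_mul]
    have : ∀ j, algebraMap R K (D i (F j)) * (algebraMap R K (c j) * h) =
      algebraMap R K (c j * D i (F j)) * h := by intro j; rw [map_mul]; ring
    simp only [this]; ring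
  let dd : B → K →+ κ := fun b => ⟨⟨d b, d30 b⟩, d3 b⟩
  have hdd : ∀ b f, d b f = dd b f := fun _ _ => rfl
  rw [e1, hEv' g]
  simp only [e2, hdd, map_add, map_sum]
  rw [Finset.sum_add_distrib, Finset.sum_comm, Finset.sum_eq_zero, Finset.sum_eq_zero, add_zero]
  · intro j _
    simp only [← hdd]
    rw [← hEv' (F j)]
    have : ψ (F j) = 0 := Subtype.ext (hF j)
    rw [this]
    have := d4 0 (algebraMap R K (c j) * h)
    rwa [map_zero] at this
  · intro i _
    exact d5 (ψ (x i)) ⟨_, huB i⟩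

end main

end WR

namespace WR

open IsLocalRing

lemma loc_pow {B : Type*} [CommRing B] [IsLocalRing B] [IsNoetherianRing B] (γ : B)
    (h : maximalIdeal B ∈ (Ideal.span {γ}).minimalPrimes) :
    ∃ s : ℕ, maximalIdeal B ^ s ≤ Ideal.span {γ} := by
  have h1 : maximalIdeal B ≤ (Ideal.span {γ}).radical := by
    rw [Ideal.radical_eq_sInf]
    refine le_sInf fun p hp => h.2 ⟨hp.2, hp.1⟩ (le_maximalIdeal hp.2.ne_top)
  obtain ⟨s, hs⟩ := (Ideal.span {γ}).exists_radical_pow_le_of_fg (IsNoetherian.noetherian _)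
  exact ⟨s, (Ideal.pow_right_mono h1 s).trans hs⟩

lemma loc_frac {B : Type*} [CommRing B] [IsLocalRing B] [IsNoetherianRing B] [IsDomain B] (γ : B)
    (h : maximalIdeal B ∈ (Ideal.span {γ}).minimalPrimes) (b : B) (hb : b ≠ 0) :
    ∃ (m : ℕ) (c : B), γ ^ m = b * c := by
  have hγ : γ ∈ maximalIdeal B := h.1.2 (Ideal.subset_span rfl)
  have hh := Ideal.height_le_one_of_isPrincipal_of_mem_minimalPrimes _ _ h
  have h1 : γ ∈ (Ideal.span {b}).radical := by
    rw [Ideal.radical_eq_sInf, Submodule.mem_sInf]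
    intro p ⟨hp, hp'⟩
    rcases (le_maximalIdeal hp'.ne_top).eq_or_lt with h2 | h2
    · rw [h2]; exact hγ
    · exfalso
      have hbp : b ∈ p := hp (Ideal.subset_span rfl)
      have h3 : (⊥ : Ideal B) < p := by
        rw [bot_lt_iff_ne_bot]; rintro rfl; exact hb (by simpa using hbp)
      have h4 := Ideal.height_add_one_le_of_lt_of_isPrime h3
      have h5 := Ideal.height_add_one_le_of_lt_of_isPrime h2
      rw [Ideal.height_bot] at h4
      have : (1 : ℕ∞) + 1 ≤ 1 := by
        calc (1 : ℕ∞) + 1 ≤ Ideal.height p + 1 := by gcongr; simpa using h4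
          _ ≤ _ := h5
          _ ≤ 1 := hh
      exact absurd this (by decide)
  obtain ⟨m, hm⟩ := h1
  obtain ⟨c, hc⟩ := Ideal.mem_span_singleton.1 hm
  exact ⟨m, c, hc⟩

theorem inv_mem_adjoin {R K : Type*} [CommRing R] [Algebra ℝ R] [IsNoetherianRing R] [Field K]
    [CharZero K] [Algebra R K] {n : ℕ}
    (D : Fin n → Derivation ℝ R R) (x : Fin n → R)
    (hx : ∀ i j, D i (x j) = if i = j then 1 else 0)
    (hNN : ∀ Q : Ideal R, Q.IsPrime → NNProp D x Q)
    (hfrac : ∀ z : K, ∃ a b : R, z = algebraMap R K a / algebraMap R K b)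
    (g δ : R) (hg : algebraMap R K g ≠ 0) (hδ : algebraMap R K δ ≠ 0)
    (u : Fin n → R) (k : ℕ) (F c : Fin k → R) (hF : ∀ j, algebraMap R K (F j) = 0)
    (hu : ∀ i, u i = δ * D i g - ∑ j, c j * D i (F j)) :
    (algebraMap R K g)⁻¹ ∈ Algebra.adjoin R
      (Set.range fun i => algebraMap R K (u i) / algebraMap R K (δ * g)) := by
  by_contra hcon
  set s : Set K := Set.range fun i => algebraMap R K (u i) / algebraMap R K (δ * g) with hs
  have hsfin : s.Finite := Set.finite_range _
  set S := Algebra.adjoin R s with hS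
  have hSn : IsNoetherianRing S := by
    have : Algebra.FiniteType R S := (Subalgebra.fg_iff_finiteType S).1
      (Subalgebra.fg_def.2 ⟨s, hsfin, rfl⟩)
    exact Algebra.FiniteType.isNoetherianRing R S
  have hfr : IsFractionRing S K := IsFractionRing.of_field S K fun z => by
    obtain ⟨a, b, h⟩ := hfrac z
    exact ⟨algebraMap R S a, algebraMap R S b, h⟩
  set g' : S := algebraMap R S g with hg'
  have hne : Ideal.span {g'} ≠ ⊤ := by
    intro h
    rw [Ideal.span_singleton_eq_top] at h
    obtain ⟨y, hy⟩ := h.exists_right_inv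
    have : algebraMap R K g * (y : K) = 1 := congrArg Subtype.val hy
    rw [inv_eq_of_mul_eq_one_right this] at hcon
    exact hcon y.2
  obtain ⟨q, hq⟩ := Ideal.nonempty_minimalPrimes hne
  have hqp : q.IsPrime := hq.1.1
  have hle : q.primeCompl ≤ nonZeroDivisors S := Ideal.primeCompl_le_nonZeroDivisors q
  let B0 := Localization.subalgebra.ofField K q.primeCompl hle
  have hloc : IsLocalization.AtPrime B0 q := Localization.subalgebra.isLocalization_ofField K _ hle
  have i1 : IsLocalRing B0 := IsLocalization.AtPrime.isLocalRing B0 q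
  have i2 : IsNoetherianRing B0 := IsLocalization.isNoetherianRing q.primeCompl B0 hSn
  have hmin : maximalIdeal B0 ∈ (Ideal.span {algebraMap S B0 g'}).minimalPrimes := by
    have := IsLocalization.minimalPrimes_map q.primeCompl B0 (Ideal.span {g'})
    rw [Ideal.map_span, Set.image_singleton] at this
    rw [this, Set.mem_preimage]
    rwa [IsLocalization.AtPrime.under_maximalIdeal B0 q]
  obtain ⟨N, hN⟩ := loc_pow _ hmin
  have hK := loc_frac _ hmin
  let B : Subring K := B0.toSubring
  have i1' : IsLocalRing B := i1
  have i2' : IsNoetherianRing B := i2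
  have hSB : ∀ y ∈ S, y ∈ B := fun y hy => B0.algebraMap_mem ⟨y, hy⟩
  have hRB : ∀ r, algebraMap R K r ∈ B := fun r => hSB _ (S.algebraMap_mem r)
  let φ : R →+* B := (algebraMap R K).codRestrict B hRB
  refine core D x hx B hRB ((maximalIdeal B).comap φ) (fun r => Iff.rfl)
    (hNN _ (Ideal.comap_isPrime _ _)) g δ hg hδ ?_ N hN ?_ s hsfin ?_ ?_ u k F c hF hu ?_
  · exact hmin.1.2 (Ideal.subset_span rfl)
  · intro f
    obtain ⟨a, b, rfl⟩ := hfrac f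
    by_cases hb : algebraMap R K b = 0
    · exact ⟨0, by simp [hb, B.zero_mem]⟩
    · obtain ⟨m, c, hc⟩ := hK (φ b) (fun h => hb (congrArg Subtype.val h))
      refine ⟨m, ?_⟩
      have hc' : algebraMap R K g ^ m = algebraMap R K b * (c : K) := congrArg Subtype.val hc
      rw [hc']
      have : algebraMap R K b * (c : K) * (algebraMap R K a / algebraMap R K b) =
        c * algebraMap R K a := by field_simp
      rw [this]
      exact B.mul_mem c.2 (hRB a)
  · intro y hy
    exact hSB y (Algebra.subset_adjoin hy)
  · rintro b ⟨a, t, ht, rfl⟩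
    have ht0 : (t : K) ≠ 0 := by
      intro h
      have : t = 0 := Subtype.ext h
      rw [this] at ht
      exact ht (zero_mem _)
    refine ⟨a, a.2, t, t.2, ht0, ?_, ?_⟩
    · show (t : K) * (a * (t : K)⁻¹) = a
      field_simp
    · exact ⟨1, t, ht, by show (t : K)⁻¹ = ((1 : S) : K) * (t : K)⁻¹; simp⟩
  · intro i
    exact hSB _ (Algebra.subset_adjoin ⟨i, rfl⟩)

/-- The algebraic core of the Łojasiewicz gradient inequality. -/
theorem loj_alg {R : Type*} [CommRing R] [Algebra ℝ R] [IsNoetherianRing R] {n : ℕ}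
    (D : Fin n → Derivation ℝ R R) (x : Fin n → R)
    (hx : ∀ i j, D i (x j) = if i = j then 1 else 0)
    (hNN : ∀ Q : Ideal R, Q.IsPrime → NNProp D x Q)
    (P : Ideal R) (hP : P.IsPrime)
    (g δ : R) (hg : g ∉ P) (hδ : δ ∉ P)
    (u : Fin n → R) (k : ℕ) (F c : Fin k → R) (hF : ∀ j, F j ∈ P)
    (hu : ∀ i, u i = δ * D i g - ∑ j, c j * D i (F j)) :
    ∃ N : ℕ, 1 ≤ N ∧ ∃ j ∈ Ideal.span (insert (δ * g) (Set.range u)) ^ N,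
      (δ * g) ^ N - g * j ∈ P := by
  let K := FractionRing (R ⧸ P)
  have hmap : ∀ r : R, algebraMap R K r = algebraMap (R ⧸ P) K (Ideal.Quotient.mk P r) :=
    fun r => rfl
  have hker : ∀ r : R, algebraMap R K r = 0 ↔ r ∈ P := by
    intro r
    rw [hmap, map_eq_zero_iff _ (IsFractionRing.injective (R ⧸ P) K), Ideal.Quotient.eq_zero_iff_mem]
  have hcz : CharZero K := charZero_of_injective_ringHom
    ((algebraMap R K).comp (algebraMap ℝ R)).injective
  have hgK : algebraMap R K g ≠ 0 := by rwa [Ne, hker]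
  have hδK : algebraMap R K δ ≠ 0 := by rwa [Ne, hker]
  have hdgK : algebraMap R K (δ * g) ≠ 0 := by rw [map_mul]; exact mul_ne_zero hδK hgK
  have h := inv_mem_adjoin (K := K) D x hx hNN (fun z => by
    obtain ⟨a, b, -, h⟩ := IsFractionRing.div_surjective (R ⧸ P) z
    obtain ⟨a, rfl⟩ := Ideal.Quotient.mk_surjective a
    obtain ⟨b, rfl⟩ := Ideal.Quotient.mk_surjective b
    exact ⟨a, b, h.symm⟩) g δ hgK hδK u k F c (fun j => (hker _).2 (hF j)) hu
  set J := Ideal.span (insert (δ * g) (Set.range u)) with hJ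
  have hdJ : δ * g ∈ J := Ideal.subset_span (Set.mem_insert _ _)
  have key : ∀ y ∈ Algebra.adjoin R
      (Set.range fun i => algebraMap R K (u i) / algebraMap R K (δ * g)),
      ∃ N : ℕ, ∃ j ∈ J ^ N, algebraMap R K (δ * g) ^ N * y = algebraMap R K j := by
    intro y hy
    induction hy using Algebra.adjoin_induction with
    | mem y hy =>
      obtain ⟨i, rfl⟩ := hy
      exact ⟨1, u i, by rw [pow_one]; exact Ideal.subset_span (Set.mem_insert_of_mem _ ⟨i, rfl⟩),
        by rw [pow_one]; exact mul_div_cancel₀ _ hdgK⟩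
    | algebraMap r => exact ⟨0, r, by simp, by simp⟩
    | add a b _ _ ha hb =>
      obtain ⟨N, j, hj, h⟩ := ha
      obtain ⟨N', j', hj', h'⟩ := hb
      refine ⟨N + N', j * (δ * g) ^ N' + (δ * g) ^ N * j', ?_, ?_⟩
      · rw [pow_add]
        exact add_mem (Ideal.mul_mem_mul hj (Ideal.pow_mem_pow hdJ _))
          (Ideal.mul_mem_mul (Ideal.pow_mem_pow hdJ _) hj')
      · rw [map_add, map_mul _ j, map_mul _ _ j', ← h, ← h', map_pow, map_pow]; ring
    | mul a b _ _ ha hb =>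
      obtain ⟨N, j, hj, h⟩ := ha
      obtain ⟨N', j', hj', h'⟩ := hb
      refine ⟨N + N', j * j', ?_, ?_⟩
      · rw [pow_add]
        exact Ideal.mul_mem_mul hj hj'
      · rw [map_mul _ j, ← h, ← h']; ring
  obtain ⟨N, j, hj, h⟩ := key _ h
  refine ⟨N + 1, by omega, j * (δ * g), ?_, ?_⟩
  · rw [pow_succ]; exact Ideal.mul_mem_mul hj hdJ
  · rw [← hker, map_sub, map_pow, pow_succ, map_mul _ g, map_mul _ j, ← h]
    have : algebraMap R K g * (algebraMap R K (δ * g) ^ N * (algebraMap R K g)⁻¹ *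
        algebraMap R K (δ * g)) = algebraMap R K (δ * g) ^ N * algebraMap R K (δ * g) *
        (algebraMap R K g * (algebraMap R K g)⁻¹) := by ring
    rw [this, mul_inv_cancel₀ hgK, mul_one, sub_self]

end WR

namespace WR

set_option linter.unusedSectionVars false

section fcalc

open ContinuousMultilinearMap

section gen

variable {m : ℕ} {A : Type*} [NormedRing A] [NormedAlgebra ℝ A]

/-- extension of scalars of a power series to operators -/
noncomputable def extS (p : FormalMultilinearSeries ℝ (Fin m → ℝ) ℝ) :
    FormalMultilinearSeries ℝ (Fin m → A) A := fun k =>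
  ∑ c : Fin k → Fin m, p k (fun i => Pi.single (c i) 1) •
    (ContinuousMultilinearMap.mkPiAlgebraFin ℝ k A).compContinuousLinearMap
      (fun i => ContinuousLinearMap.proj (c i))

lemma extS_apply' (p : FormalMultilinearSeries ℝ (Fin m → ℝ) ℝ) (k : ℕ)
    (v : Fin k → Fin m → A) :
    extS p k v = ∑ c : Fin k → Fin m, p k (fun i => Pi.single (c i) 1) •
      (List.ofFn fun i => v i (c i)).prod := by
  simp [extS]

lemma extS_apply (p : FormalMultilinearSeries ℝ (Fin m → ℝ) ℝ) (k : ℕ)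
    (a : Fin m → A) :
    extS p k (fun _ => a) = ∑ c : Fin k → Fin m, p k (fun i => Pi.single (c i) 1) •
      (List.ofFn fun i => a (c i)).prod := extS_apply' p k _

lemma extS_norm [NormOneClass A] (p : FormalMultilinearSeries ℝ (Fin m → ℝ) ℝ) (k : ℕ) :
    ‖extS (A := A) p k‖ ≤ m ^ k * ‖p k‖ := by
  refine ContinuousMultilinearMap.opNorm_le_bound (by positivity) fun v => ?_
  rw [extS_apply']
  refine (norm_sum_le _ _).trans ?_
  have : ∀ c ∈ (Finset.univ : Finset (Fin k → Fin m)), ‖p k (fun i => Pi.single (c i) 1) •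
      (List.ofFn fun i => v i (c i)).prod‖ ≤ ‖p k‖ * ∏ i, ‖v i‖ := by
    intro c _
    rw [norm_smul]
    have h1 : ‖p k (fun i => Pi.single (c i) 1)‖ ≤ ‖p k‖ := by
      refine ((p k).le_opNorm _).trans ?_
      refine mul_le_of_le_one_right (norm_nonneg _) ?_
      refine Finset.prod_le_one (fun _ _ => norm_nonneg _) fun i _ => ?_
      rw [pi_norm_le_iff_of_nonneg zero_le_one]
      intro j
      by_cases h : j = c i
      · subst h; simp
      · simp [h]
    have h2 : ‖(List.ofFn fun i => v i (c i)).prod‖ ≤ ∏ i, ‖v i‖ := by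
      refine (List.norm_prod_le _).trans ?_
      rw [List.map_ofFn, List.prod_ofFn]
      exact Finset.prod_le_prod (fun _ _ => norm_nonneg _) fun i _ => norm_le_pi_norm (v i) (c i)
    exact mul_le_mul h1 h2 (norm_nonneg _) (norm_nonneg _)
  refine (Finset.sum_le_sum this).trans (le_of_eq ?_)
  simp [mul_assoc]

lemma extS_radius [NormOneClass A] (p : FormalMultilinearSeries ℝ (Fin m → ℝ) ℝ)
    (hp : 0 < p.radius) : 0 < (extS (A := A) p).radius := by
  obtain ⟨r, hr0, hr⟩ := ENNReal.lt_iff_exists_nnreal_btwn.1 hp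
  have hr0' : 0 < r := by exact_mod_cast hr0
  obtain ⟨C, hC, h⟩ := p.norm_le_div_pow_of_pos_of_lt_radius hr0' hr
  obtain ⟨t, e⟩ : ∃ t : NNReal, (t : ℝ) = (r : ℝ) / (m + 1) :=
    ⟨⟨(r : ℝ) / (m + 1), by positivity⟩, rfl⟩
  have hrr : (0 : ℝ) < r := hr0'
  have hpos : (0 : NNReal) < t := by
    rw [← NNReal.coe_pos, e]; positivity
  suffices hb : ∀ k, ‖extS (A := A) p k‖ * (t : ℝ) ^ k ≤ C from
    lt_of_lt_of_le (ENNReal.coe_pos.2 hpos) ((extS (A := A) p).le_radius_of_bound C hb)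
  intro k
  rw [e]
  have h3 : ‖extS (A := A) p k‖ ≤ m ^ k * (C / r ^ k) :=
    (extS_norm p k).trans (mul_le_mul_of_nonneg_left (h k) (by positivity))
  refine (mul_le_mul_of_nonneg_right h3 (by positivity)).trans ?_
  have e2 : (m : ℝ) ^ k * (C / r ^ k) * ((r : ℝ) / (m + 1)) ^ k = C * ((m : ℝ) / (m + 1)) ^ k := by
    rw [div_pow, div_pow]
    field_simp
  rw [e2]
  refine mul_le_of_le_one_right hC.le (pow_le_one₀ (by positivity) ?_)
  rw [div_le_one (by positivity)]; linarith

end gen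

section op

variable {m : ℕ} {V : Type*} [NormedAddCommGroup V] [NormedSpace ℝ V]

lemma prod_eigen (ev : V →L[ℝ] ℝ) (l : List ((V →L[ℝ] V) × ℝ))
    (h : ∀ z ∈ l, ∀ v, ev (z.1 v) = z.2 * ev v) (v : V) :
    ev ((l.map Prod.fst).prod v) = (l.map Prod.snd).prod * ev v := by
  induction l generalizing v with
  | nil => simp
  | cons a l ih =>
    simp only [List.map_cons, List.prod_cons]
    have : ((a.1 * (l.map Prod.fst).prod) v) = a.1 ((l.map Prod.fst).prod v) := rfl
    rw [this, h a (by simp), ih (fun z hz => h z (by simp [hz]))]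
    ring

lemma extS_eigen (p : FormalMultilinearSeries ℝ (Fin m → ℝ) ℝ) (k : ℕ)
    (a : Fin m → (V →L[ℝ] V)) (w : Fin m → ℝ) (ev : V →L[ℝ] ℝ)
    (h : ∀ i v, ev (a i v) = w i * ev v) (v : V) :
    ev (extS p k (fun _ => a) v) = p k (fun _ => w) * ev v := by
  rw [extS_apply]
  have hw : (fun _ : Fin k => w) = fun _ => ∑ j, w j • (Pi.single j 1 : Fin m → ℝ) := by
    ext i j
    simp [Finset.sum_apply, Pi.single_apply]
  rw [hw, (p k).map_sum]
  rw [sum_apply, _root_.map_sum, Finset.sum_mul]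
  refine Finset.sum_congr rfl fun c _ => ?_
  rw [(p k).map_smul_univ, _root_.smul_apply, map_smul]
  have := prod_eigen ev (List.ofFn fun i => (a (c i), w (c i))) (by
    intro z hz v
    rw [List.mem_ofFn'] at hz
    obtain ⟨i, rfl⟩ := hz
    exact h _ v) v
  rw [List.map_ofFn, List.map_ofFn] at this
  simp only [Function.comp_def] at this
  rw [this, List.prod_ofFn]
  simp only [smul_eq_mul]; ring

lemma extS_single {n : ℕ} (p : FormalMultilinearSeries ℝ (Fin (n + 1) → ℝ) ℝ) (k : ℕ)
    (X : V →L[ℝ] V) :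
    extS p k (fun _ => Pi.single 0 X) = p k (fun _ => Pi.single 0 1) • X ^ k := by
  rw [extS_apply, Finset.sum_eq_single (fun _ => 0)]
  · simp
  · intro c _ hc
    obtain ⟨i, hi⟩ : ∃ i, c i ≠ 0 := by
      by_contra hcon
      push Not at hcon
      exact hc (funext hcon)
    have : (List.ofFn fun i => (Pi.single 0 X : Fin (n + 1) → (V →L[ℝ] V)) (c i)).prod = 0 := by
      refine List.prod_eq_zero ?_
      rw [List.mem_ofFn']
      exact ⟨i, by simp [hi]⟩
    rw [this, smul_zero]
  · simp

end op

end fcalc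

end WR

namespace WR

open Topology Filter

abbrev Vs := BoundedContinuousFunction ℕ ℝ

lemma exists_shift : ∃ (S T : Vs →L[ℝ] Vs) (ε : Vs →L[ℝ] ℝ) (e : Vs), ‖S‖ ≤ 1 ∧ ‖T‖ ≤ 1 ∧
    (∀ v, T (S v) = v) ∧ (∀ v, ε (S v) = 0) ∧ ε e = 1 ∧ T e = 0 ∧ ∀ v, v = ε v • e + S (T v) := by
  let sf : Vs → ℕ → ℝ := fun v n => Nat.casesOn n 0 fun k => v k
  have hsf : ∀ v n, ‖sf v n‖ ≤ ‖v‖ := by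
    intro v n
    cases n with
    | zero => simp [sf]
    | succ k => exact v.norm_coe_le_norm k
  let S : Vs →L[ℝ] Vs := LinearMap.mkContinuous
    { toFun := fun v => BoundedContinuousFunction.ofNormedAddCommGroupDiscrete (sf v) ‖v‖ (hsf v)
      map_add' := by
        intro a b; ext n
        cases n <;> simp [sf]
      map_smul' := by
        intro c a; ext n
        cases n <;> simp [sf] } 1 (by
      intro v
      rw [one_mul]
      exact (BoundedContinuousFunction.norm_le (norm_nonneg _)).2 (hsf v))
  let T : Vs →L[ℝ] Vs := LinearMap.mkContinuous
    { toFun := fun v => BoundedContinuousFunction.ofNormedAddCommGroupDiscrete (fun n => v (n + 1)) ‖v‖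
        (fun n => v.norm_coe_le_norm _)
      map_add' := by intro a b; ext n; simp
      map_smul' := by intro c a; ext n; simp } 1 (by
      intro v
      rw [one_mul]
      exact (BoundedContinuousFunction.norm_le (norm_nonneg _)).2 (fun n => v.norm_coe_le_norm _))
  let ε : Vs →L[ℝ] ℝ := LinearMap.mkContinuous
    { toFun := fun v => v 0
      map_add' := by intro a b; simp
      map_smul' := by intro c a; simp } 1 (by
      intro v
      rw [one_mul]
      exact v.norm_coe_le_norm _)
  let e : Vs := BoundedContinuousFunction.ofNormedAddCommGroupDiscrete
    (fun n => if n = 0 then 1 else 0) 1 (by intro n; split_ifs <;> simp)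
  have hS : ∀ v n, S v n = sf v n := fun _ _ => rfl
  have hT : ∀ v n, T v n = v (n + 1) := fun _ _ => rfl
  have hε : ∀ v, ε v = v 0 := fun _ => rfl
  have he : ∀ n, e n = if n = 0 then 1 else 0 := fun _ => rfl
  refine ⟨S, T, ε, e, LinearMap.mkContinuous_norm_le _ zero_le_one _,
    LinearMap.mkContinuous_norm_le _ zero_le_one _, ?_, ?_, ?_, ?_, ?_⟩
  · intro v; ext n; rw [hT, hS]
  · intro v; rw [hε, hS]
    try simp [sf]
  · rw [hε, he]; simp
  · ext n; rw [hT, he]; simp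
  · intro v; ext n
    rw [BoundedContinuousFunction.add_apply, BoundedContinuousFunction.smul_apply, hS, hε, he]
    cases n with
    | zero => simp [sf]
    | succ k => simp [sf, hT]

/-- evaluation functional -/
lemma ev_props {V : Type*} [NormedAddCommGroup V] [NormedSpace ℝ V] [CompleteSpace V]
    (X T : V →L[ℝ] V) (ε : V →L[ℝ] ℝ) (e : V)
    (h1 : ∀ v, T (X v) = v) (h2 : ∀ v, ε (X v) = 0) (h3 : ε e = 1) (h4 : T e = 0)
    (x : ℝ) (hx : IsUnit (1 - x • T)) :
    (ε ∘L Ring.inverse (1 - x • T)) e = 1 ∧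
      ∀ v, (ε ∘L Ring.inverse (1 - x • T)) (X v) = x * (ε ∘L Ring.inverse (1 - x • T)) v := by
  have hinv : ∀ v, Ring.inverse (1 - x • T) ((1 - x • T) v) = v := by
    intro v
    have := Ring.inverse_mul_cancel _ hx
    have := congrArg (fun A : V →L[ℝ] V => A v) this
    simpa using this
  constructor
  · have : (1 - x • T) e = e := by simp [h4]
    have h := hinv e
    rw [this] at h
    simp [h, h3]
  · intro v
    have h := hinv (X v)
    have h' : (1 - x • T) (X v) = X v - x • v := by simp [h1]
    rw [h', map_sub, map_smul] at h
    have := congrArg ε h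
    rw [map_sub, map_smul, h2] at this
    simp only [ContinuousLinearMap.comp_apply, smul_eq_mul] at this ⊢
    linarith

lemma shift_decomp {V : Type*} [NormedAddCommGroup V] [NormedSpace ℝ V]
    (X T : V →L[ℝ] V) (ε : V →L[ℝ] ℝ) (e : V)
    (h5 : ∀ v, v = ε v • e + X (T v)) (d : ℕ) :
    X ^ d * T ^ d + ∑ j ∈ Finset.range d, (ε ∘L T ^ j).smulRight ((X ^ j) e) = 1 := by
  induction d with
  | zero => simp
  | succ d ih =>
    rw [← ih, Finset.sum_range_succ, ← add_assoc, add_right_comm]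
    congr 1
    ext v
    have := congrArg (X ^ d) (h5 ((T ^ d) v))
    rw [map_add, map_smul] at this
    change (X ^ (d+1)) ((T ^ (d+1)) v) + ε ((T ^ d) v) • (X ^ d) e = (X ^ d) ((T ^ d) v)
    refine Eq.trans ?_ this.symm
    rw [pow_succ, pow_succ', add_comm]
    rfl

lemma tail_bound (a : ℕ → ℝ) (M r : ℝ) (hr : 0 < r) (hM : 0 < M) (ha : ∀ k, |a k| ≤ M / r ^ k)
    (d : ℕ) (hd : ∀ k < d, a k = 0) {A : Type*} [NormedRing A] [NormedAlgebra ℝ A] [CompleteSpace A]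
    [NormOneClass A] (X F : A) (ρ : ℝ) (hρ : 0 < ρ) (hρr : ρ ≤ r / 2) (hX : ‖X‖ ≤ ρ)
    (hF : HasSum (fun k => a k • X ^ k) F) :
    ‖F - a d • X ^ d‖ ≤ 2 * M * (ρ / r) ^ (d + 1) := by
  have hq : ρ / r ≤ 1 / 2 := by rw [div_le_iff₀ hr]; linarith
  have hq0 : 0 ≤ ρ / r := by positivity
  have h1 : HasSum (fun k => a (k + (d + 1)) • X ^ (k + (d + 1))) (F - a d • X ^ d) := by
    have := (hasSum_nat_add_iff' (d + 1)).2 hF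
    rw [Finset.sum_range_succ, Finset.sum_eq_zero, zero_add] at this
    · exact this
    · intro k hk; rw [hd k (Finset.mem_range.1 hk), zero_smul]
  have hg : HasSum (fun k : ℕ => M * (ρ / r) ^ (d + 1) * (1 / 2 : ℝ) ^ k)
      (M * (ρ / r) ^ (d + 1) * 2) := by
    exact hasSum_geometric_two.mul_left _
  have := h1.norm_le_of_bounded hg (fun k => by
    rw [norm_smul]
    have hXk : ‖X ^ (k + (d + 1))‖ ≤ ρ ^ (k + (d + 1)) :=
      (norm_pow_le _ _).trans (pow_le_pow_left₀ (norm_nonneg _) hX _)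
    calc _ ≤ (M / r ^ (k + (d + 1))) * ρ ^ (k + (d + 1)) :=
          mul_le_mul (ha _) hXk (norm_nonneg _) (by positivity)
      _ = M * (ρ / r) ^ (d + 1) * (ρ / r) ^ k := by
          rw [pow_add, pow_add, div_pow, div_pow]; field_simp
          try ring
      _ ≤ _ := by gcongr)
  linarith

end WR

namespace WR

open Topology Filter

lemma AnalyticAt_clm_apply {E V W : Type*} [NormedAddCommGroup E] [NormedSpace ℝ E]
    [NormedAddCommGroup V] [NormedSpace ℝ V] [NormedAddCommGroup W] [NormedSpace ℝ W]
    {f : E → V →L[ℝ] W} {g : E → V} {x : E} (hf : AnalyticAt ℝ f x) (hg : AnalyticAt ℝ g x) :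
    AnalyticAt ℝ (fun y => f y (g y)) x := by
  have h := (ContinuousLinearMap.id ℝ (V →L[ℝ] W)).analyticAt_bilinear (f x, g x)
  exact h.comp₂ hf hg

lemma exists_shift_V : ∃ (V : Type) (_ : NormedAddCommGroup V) (_ : NormedSpace ℝ V)
    (_ : CompleteSpace V) (S T : V →L[ℝ] V) (ε : V →L[ℝ] ℝ) (e : V), ‖S‖ ≤ 1 ∧ ‖T‖ ≤ 1 ∧
    (∀ v, T (S v) = v) ∧ (∀ v, ε (S v) = 0) ∧ ε e = 1 ∧ T e = 0 ∧ ∀ v, v = ε v • e + S (T v) :=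
  ⟨Vs, inferInstance, inferInstance, inferInstance, exists_shift⟩

lemma order_data {n : ℕ} {f : (Fin (n + 1) → ℝ) → ℝ}
    {p : FormalMultilinearSeries ℝ (Fin (n + 1) → ℝ) ℝ} (hp : HasFPowerSeriesAt f p 0)
    (hne : ¬ ∀ᶠ t : ℝ in 𝓝 0, f (Pi.single 0 t) = 0) :
    ∃ d, (p d (fun _ => Pi.single 0 1) ≠ 0) ∧ (∀ k < d, p k (fun _ => Pi.single 0 1) = 0) ∧
      ∃ M r : ℝ, 0 < M ∧ 0 < r ∧ ∀ k, |p k (fun _ => Pi.single 0 1)| ≤ M / r ^ k := by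
  have hex : ∃ d, p d (fun _ => Pi.single 0 1) ≠ 0 := by
    by_contra hcon
    push Not at hcon
    refine hne ?_
    have hc : Tendsto (fun t : ℝ => (Pi.single 0 t : Fin (n + 1) → ℝ)) (𝓝 0) (𝓝 0) := by
      have : Continuous (fun t : ℝ => (Pi.single 0 t : Fin (n + 1) → ℝ)) :=
        continuous_single (A := fun _ : Fin (n + 1) => ℝ) 0
      simpa using this.tendsto 0
    filter_upwards [hc.eventually hp.eventually_hasSum] with t ht
    rw [zero_add] at ht
    refine ht.unique ?_
    have : ∀ k, p k (fun _ => (Pi.single 0 t : Fin (n + 1) → ℝ)) = 0 := by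
      intro k
      have : (fun _ : Fin k => (Pi.single 0 t : Fin (n + 1) → ℝ)) =
        fun _ => t • Pi.single 0 1 := by
        ext i j; refine Fin.cases ?_ (fun j => ?_) j <;> simp
      rw [this, (p k).map_smul_univ, hcon, smul_zero]
    simp only [this]
    exact hasSum_zero
  classical
  refine ⟨Nat.find hex, Nat.find_spec hex, fun k hk => not_not.1 (Nat.find_min hex hk), ?_⟩
  obtain ⟨r, hr0, hr⟩ := ENNReal.lt_iff_exists_nnreal_btwn.1 hp.radius_pos
  obtain ⟨C, hC, hb⟩ := p.norm_le_div_pow_of_pos_of_lt_radius (ENNReal.coe_pos.1 hr0) hr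
  refine ⟨C, r, hC, ENNReal.coe_pos.1 hr0, fun k => ?_⟩
  refine le_trans ?_ (hb k)
  refine ((p k).le_opNorm _).trans ?_
  refine mul_le_of_le_one_right (norm_nonneg _) ?_
  refine Finset.prod_le_one (fun _ _ => norm_nonneg _) fun i _ => ?_
  rw [pi_norm_le_iff_of_nonneg zero_le_one]
  intro j
  refine Fin.cases ?_ (fun j => ?_) j <;> simp


set_option maxHeartbeats 1000000 in
theorem wd_core {n : ℕ} {f h : (Fin (n + 1) → ℝ) → ℝ}
    {p ph : FormalMultilinearSeries ℝ (Fin (n + 1) → ℝ) ℝ}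
    (hp : HasFPowerSeriesAt f p 0) (hph : HasFPowerSeriesAt h ph 0)
    {V : Type*} [NormedAddCommGroup V] [NormedSpace ℝ V] [CompleteSpace V] [Nontrivial V]
    (X T : V →L[ℝ] V) (ε : V →L[ℝ] ℝ) (e : V)
    (h1 : ∀ v, T (X v) = v) (h2 : ∀ v, ε (X v) = 0) (hεe : ε e = 1) (h4 : T e = 0)
    (h5 : ∀ v, v = ε v • e + X (T v)) (a : ℕ → ℝ) (ha : a = fun k => p k (fun _ => Pi.single 0 1))
    (d : ℕ) (had : a d ≠ 0) (hak : ∀ k < d, a k = 0) (M r : ℝ) (hM : 0 < M) (hr : 0 < r)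
    (hb : ∀ k, |a k| ≤ M / r ^ k) (ρ : ℝ) (hρ0 : 0 < ρ) (hρr : ρ ≤ r / 2)
    (P Ph : FormalMultilinearSeries ℝ (Fin (n + 1) → (V →L[ℝ] V)) (V →L[ℝ] V))
    (hPdef : P = extS (A := V →L[ℝ] V) p) (hPhdef : Ph = extS (A := V →L[ℝ] V) ph)
    (hP : 0 < P.radius) (hPh : 0 < Ph.radius)
    (R1 R2 : NNReal) (hR1 : (R1 : ENNReal) < P.radius) (hR2 : (R2 : ENNReal) < Ph.radius)
    (hρ1 : ρ ≤ R1) (hρ2 : ρ ≤ R2) (hρ3 : 2 * M * ρ / (r ^ (d + 1) * |a d|) < 1)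
    (hXn : ‖X‖ ≤ ρ) (hTn : ‖T‖ ≤ ρ⁻¹) :
    ∃ (q : (Fin (n + 1) → ℝ) → ℝ) (r : Fin d → (Fin n → ℝ) → ℝ), AnalyticAt ℝ q 0 ∧
        (∀ j, AnalyticAt ℝ (r j) 0) ∧
        ∀ᶠ w in 𝓝 0, h w = q w * f w + ∑ j, r j (Fin.tail w) * w 0 ^ (j : ℕ) := by
  have hPb := P.hasFPowerSeriesOnBall hP
  have hPhb := Ph.hasFPowerSeriesOnBall hPh
  let B : (Fin n → ℝ) → Fin (n + 1) → (V →L[ℝ] V) := fun y => Fin.cons X (fun j => y j • (1 : V →L[ℝ] V))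
  have hB0 : B 0 = Pi.single 0 X := by
    ext1 i; refine Fin.cases ?_ (fun j => ?_) i <;> simp [B]
  have hBan : AnalyticAt ℝ B 0 := by
    rw [analyticAt_pi_iff]
    intro i
    refine Fin.cases ?_ (fun j => ?_) i
    · simpa [B] using analyticAt_const
    · simp only [B, Fin.cons_succ]
      have : AnalyticAt ℝ (fun y : Fin n → ℝ => y j) 0 :=
        (ContinuousLinearMap.proj (R := ℝ) (φ := fun _ : Fin n => ℝ) j).analyticAt 0
      exact this.smul analyticAt_const
  have hBn : ‖B 0‖ ≤ ρ := by
    rw [hB0, pi_norm_le_iff_of_nonneg hρ0.le]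
    intro i; refine Fin.cases ?_ (fun j => ?_) i
    · simpa using hXn
    · simpa using hρ0.le
  have hmem1 : B 0 ∈ Metric.eball (0 : Fin (n + 1) → (V →L[ℝ] V)) P.radius := by
    rw [Metric.mem_eball, edist_zero_right]
    refine lt_of_le_of_lt ?_ hR1
    rw [← ofReal_norm]
    exact ENNReal.ofReal_le_of_le_toReal (by simpa using hBn.trans hρ1)
  have hmem2 : B 0 ∈ Metric.eball (0 : Fin (n + 1) → (V →L[ℝ] V)) Ph.radius := by
    rw [Metric.mem_eball, edist_zero_right]
    refine lt_of_le_of_lt ?_ hR2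
    rw [← ofReal_norm]
    exact ENNReal.ofReal_le_of_le_toReal (by simpa using hBn.trans hρ2)
  have hFan : AnalyticAt ℝ (fun y => P.sum (B y)) 0 :=
    AnalyticAt.comp (g := P.sum) (f := B) (hPb.analyticAt_of_mem hmem1) hBan
  have hHan : AnalyticAt ℝ (fun y => Ph.sum (B y)) 0 :=
    AnalyticAt.comp (g := Ph.sum) (f := B) (hPhb.analyticAt_of_mem hmem2) hBan
  let G : (Fin n → ℝ) → (V →L[ℝ] V) := fun y => P.sum (B y) * ((a d)⁻¹ • T ^ d) +
    ∑ j ∈ Finset.range d, (ε ∘L T ^ j).smulRight ((X ^ j) e)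
  have hGan : AnalyticAt ℝ G 0 := (hFan.mul analyticAt_const).add analyticAt_const
  have hG0 : IsUnit (G 0) := by
    have hF0 : HasSum (fun k => a k • X ^ k) (P.sum (B 0)) := by
      have := hPb.hasSum hmem1
      rw [zero_add] at this
      rw [hB0] at this ⊢
      subst ha
      rw [hPdef] at this ⊢
      simpa only [extS_single] using this
    have hb' := tail_bound a M r hr hM hb d hak X _ ρ hρ0 hρr hXn hF0
    have : G 0 = 1 - (-((P.sum (B 0) - a d • X ^ d) * ((a d)⁻¹ • T ^ d))) := by
      rw [← shift_decomp X T ε e h5 d]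
      simp only [G, sub_mul, smul_mul_smul_comm, mul_inv_cancel₀ had, one_smul]
      abel
    rw [this]
    refine isUnit_one_sub_of_norm_lt_one ?_
    rw [norm_neg]
    refine lt_of_le_of_lt ?_ hρ3
    calc _ ≤ ‖P.sum (B 0) - a d • X ^ d‖ * ‖(a d)⁻¹ • T ^ d‖ := norm_mul_le _ _
      _ ≤ (2 * M * (ρ / r) ^ (d + 1)) * (|a d|⁻¹ * ρ⁻¹ ^ d) := by
          gcongr
          rw [norm_smul, norm_inv, Real.norm_eq_abs]
          gcongr
          exact (norm_pow_le _ _).trans (pow_le_pow_left₀ (norm_nonneg _) hTn _)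
      _ = _ := by
          have : |a d| ≠ 0 := abs_ne_zero.2 had
          rw [div_pow, inv_pow, pow_succ ρ]
          field_simp
  let v : (Fin n → ℝ) → V := fun y => Ring.inverse (G y) (Ph.sum (B y) e)
  have hvan : AnalyticAt ℝ v 0 := by
    refine AnalyticAt_clm_apply ?_ (AnalyticAt_clm_apply hHan analyticAt_const)
    refine AnalyticAt.comp (g := Ring.inverse) (f := G) ?_ hGan
    obtain ⟨u, hu⟩ := hG0
    rw [← hu]
    exact analyticAt_inverse u
  let ev : ℝ → V →L[ℝ] ℝ := fun x => ε ∘L Ring.inverse (1 - x • T)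
  have h1xT : AnalyticAt ℝ (fun x : ℝ => (1 : V →L[ℝ] V) - x • T) 0 :=
    analyticAt_const.sub (analyticAt_id.smul analyticAt_const)
  have htail : AnalyticAt ℝ (fun w : Fin (n + 1) → ℝ => Fin.tail w) 0 := by
    rw [analyticAt_pi_iff]
    intro i
    exact (ContinuousLinearMap.proj (R := ℝ) (φ := fun _ : Fin (n + 1) => ℝ) i.succ).analyticAt 0
  have htail0 : Fin.tail (0 : Fin (n + 1) → ℝ) = 0 := rfl
  have hw0 : AnalyticAt ℝ (fun w : Fin (n + 1) → ℝ => w 0) 0 :=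
    (ContinuousLinearMap.proj (R := ℝ) (φ := fun _ : Fin (n + 1) => ℝ) 0).analyticAt 0
  have hevan : AnalyticAt ℝ (fun x : ℝ => Ring.inverse ((1 : V →L[ℝ] V) - x • T)) 0 := by
    refine AnalyticAt.comp (g := Ring.inverse) (f := fun x : ℝ => (1 : V →L[ℝ] V) - x • T) ?_ h1xT
    have := analyticAt_inverse (𝕜 := ℝ) (1 : (V →L[ℝ] V)ˣ)
    simpa using this
  refine ⟨fun w => ev (w 0) ((a d)⁻¹ • (T ^ d) (v (Fin.tail w))),
    fun j y => ε ((T ^ (j : ℕ)) (v y)), ?_, ?_, ?_⟩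
  · have hvt : AnalyticAt ℝ (fun w : Fin (n + 1) → ℝ => v (Fin.tail w)) 0 :=
      AnalyticAt.comp (g := v) (f := fun w : Fin (n + 1) → ℝ => Fin.tail w) hvan htail
    have hit : AnalyticAt ℝ (fun w : Fin (n + 1) → ℝ => Ring.inverse ((1 : V →L[ℝ] V) - w 0 • T)) 0 :=
      AnalyticAt.comp (g := fun x : ℝ => Ring.inverse ((1 : V →L[ℝ] V) - x • T))
        (f := fun w : Fin (n + 1) → ℝ => w 0) hevan hw0
    have h3 : AnalyticAt ℝ (fun w : Fin (n + 1) → ℝ => (a d)⁻¹ • (T ^ d) (v (Fin.tail w))) 0 :=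
      (analyticAt_const (v := (a d)⁻¹)).smul (AnalyticAt_clm_apply (analyticAt_const) hvt)
    have h7 := AnalyticAt_clm_apply (analyticAt_const (v := ε)) (AnalyticAt_clm_apply hit h3)
    exact h7
  · intro j
    exact AnalyticAt_clm_apply (analyticAt_const (v := ε))
      (AnalyticAt_clm_apply (analyticAt_const) hvan)
  · have hc1 : Tendsto (fun w : Fin (n + 1) → ℝ => Fin.tail w) (𝓝 0) (𝓝 0) :=
      htail.continuousAt
    have hc2 : Tendsto (fun w : Fin (n + 1) → ℝ => w 0) (𝓝 0) (𝓝 0) := hw0.continuousAt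
    have E1 : ∀ᶠ y in 𝓝 0, IsUnit (G y) :=
      hGan.continuousAt.eventually (Units.isOpen.mem_nhds hG0)
    have E2 : ∀ᶠ y in 𝓝 0, B y ∈ Metric.eball (0 : Fin (n + 1) → (V →L[ℝ] V)) P.radius :=
      hBan.continuousAt.eventually (Metric.isOpen_eball.mem_nhds hmem1)
    have E3 : ∀ᶠ y in 𝓝 0, B y ∈ Metric.eball (0 : Fin (n + 1) → (V →L[ℝ] V)) Ph.radius :=
      hBan.continuousAt.eventually (Metric.isOpen_eball.mem_nhds hmem2)
    have E4 : ∀ᶠ x : ℝ in 𝓝 0, IsUnit ((1 : V →L[ℝ] V) - x • T) :=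
      h1xT.continuousAt.eventually (Units.isOpen.mem_nhds (by simp))
    filter_upwards [hc1.eventually E1, hc1.eventually E2, hc1.eventually E3, hc2.eventually E4,
      hp.eventually_hasSum, hph.eventually_hasSum] with w u1 u2 u3 u4 u5 u6
    rw [zero_add] at u5 u6
    obtain ⟨eve, evX⟩ := ev_props X T ε e h1 h2 hεe h4 (w 0) u4
    have heig : ∀ i v, ev (w 0) (B (Fin.tail w) i v) = w i * ev (w 0) v := by
      intro i v
      refine Fin.cases ?_ (fun j => ?_) i
      · exact evX v
      · simp only [B, Fin.cons_succ]
        rw [_root_.smul_apply, map_smul]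
        rfl
    have key : ∀ (pp : FormalMultilinearSeries ℝ (Fin (n + 1) → ℝ) ℝ) (s : V →L[ℝ] V) (t : ℝ) (v : V),
        HasSum (fun k => extS (A := V →L[ℝ] V) pp k (fun _ => B (Fin.tail w))) s →
        HasSum (fun k => pp k (fun _ => w)) t → ev (w 0) (s v) = t * ev (w 0) v := by
      intro pp s t v hs ht
      have q1 := ht.mul_right (ev (w 0) v)
      have q2 := ((ev (w 0)) ∘L (ContinuousLinearMap.apply ℝ V v)).hasSum hs
      refine q2.unique ?_
      have hfun : (fun k => pp k (fun _ => w) * ev (w 0) v) = ⇑((ev (w 0)) ∘L (ContinuousLinearMap.apply ℝ V v)) ∘ (fun k => extS (A := V →L[ℝ] V) pp k (fun _ => B (Fin.tail w))) := by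
        funext k
        exact (extS_eigen pp k _ w _ heig v).symm
      rw [hfun] at q1; exact q1
    have s1 := hPb.hasSum u2
    have s2 := hPhb.hasSum u3
    rw [zero_add] at s1 s2
    have k1 := fun v => key p _ _ v (by rw [hPdef] at s1; exact s1) u5
    have k2 := key ph _ _ e (by rw [hPhdef] at s2; exact s2) u6
    have evXj : ∀ j : ℕ, ev (w 0) ((X ^ j) e) = w 0 ^ j := by
      intro j
      induction j with
      | zero => rw [pow_zero, pow_zero]; exact eve
      | succ j ih =>
        rw [pow_succ', pow_succ']
        have := evX ((X ^ j) e)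
        change ev (w 0) (X ((X ^ j) e)) = _
        exact this.trans (by rw [← ih])
    have hGv : G (Fin.tail w) (v (Fin.tail w)) = Ph.sum (B (Fin.tail w)) e := by
      have := Ring.mul_inverse_cancel _ u1
      exact congrArg (fun Z : V →L[ℝ] V => Z (Ph.sum (B (Fin.tail w)) e)) this
    have h6 := congrArg (ev (w 0)) hGv
    rw [hPhdef, k2, show ev (w 0) e = 1 from eve, mul_one] at h6
    rw [← h6]
    simp only [G]
    rw [add_apply, map_add, sum_apply, map_sum]
    congr 1
    · change ev (w 0) ((P.sum (B (Fin.tail w))) (((a d)⁻¹ • T ^ d) (v (Fin.tail w)))) = _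
      rw [hPdef, k1, mul_comm]
      rfl
    · rw [Finset.sum_range]
      refine Finset.sum_congr rfl fun j _ => ?_
      rw [ContinuousLinearMap.smulRight_apply, map_smul, evXj]
      rfl

theorem wd {n : ℕ} {f : (Fin (n + 1) → ℝ) → ℝ} (hf : AnalyticAt ℝ f 0)
    (hne : ¬ ∀ᶠ t : ℝ in 𝓝 0, f (Pi.single 0 t) = 0) :
    ∃ d : ℕ, ∀ h : (Fin (n + 1) → ℝ) → ℝ, AnalyticAt ℝ h 0 →
      ∃ (q : (Fin (n + 1) → ℝ) → ℝ) (r : Fin d → (Fin n → ℝ) → ℝ), AnalyticAt ℝ q 0 ∧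
        (∀ j, AnalyticAt ℝ (r j) 0) ∧
        ∀ᶠ w in 𝓝 0, h w = q w * f w + ∑ j, r j (Fin.tail w) * w 0 ^ (j : ℕ) := by
  obtain ⟨p, hp⟩ := hf
  obtain ⟨d, had, hak, M, r, hM, hr, hb⟩ := order_data hp hne
  refine ⟨d, fun h ⟨ph, hph⟩ => ?_⟩
  obtain ⟨V, _, _, _, S, T₀, ε, e, hS, hT₀, hTS, hεS, hεe, hTe, hdec⟩ := exists_shift_V
  have : Nontrivial V := ⟨⟨e, 0, fun h => by simp [h] at hεe⟩⟩
  set a : ℕ → ℝ := fun k => p k (fun _ => Pi.single 0 1) with ha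
  have hP := extS_radius (A := V →L[ℝ] V) p hp.radius_pos
  have hPh := extS_radius (A := V →L[ℝ] V) ph hph.radius_pos
  set P := extS (A := V →L[ℝ] V) p with hPdef
  set Ph := extS (A := V →L[ℝ] V) ph with hPhdef
  -- choose ρ
  obtain ⟨R1, hR10, hR1⟩ := ENNReal.lt_iff_exists_nnreal_btwn.1 hP
  obtain ⟨R2, hR20, hR2⟩ := ENNReal.lt_iff_exists_nnreal_btwn.1 hPh
  have hR10' : (0 : ℝ) < R1 := by exact_mod_cast hR10
  have hR20' : (0 : ℝ) < R2 := by exact_mod_cast hR20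
  obtain ⟨ρ, hρ0, hρr, hρ1, hρ2, hρ3⟩ : ∃ ρ : ℝ, 0 < ρ ∧ ρ ≤ r / 2 ∧ ρ ≤ R1 ∧ ρ ≤ R2 ∧
      2 * M * ρ / (r ^ (d + 1) * |a d|) < 1 := by
    have hc : Tendsto (fun ρ : ℝ => 2 * M * ρ / (r ^ (d + 1) * |a d|)) (𝓝[>] 0) (𝓝 0) := by
      have : Continuous (fun ρ : ℝ => 2 * M * ρ / (r ^ (d + 1) * |a d|)) := by fun_prop
      have := this.tendsto 0
      simp only [mul_zero, zero_div] at this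
      exact this.mono_left nhdsWithin_le_nhds
    have e1 := hc.eventually (gt_mem_nhds (zero_lt_one))
    have e2 : ∀ᶠ ρ : ℝ in 𝓝[>] 0, ρ ≤ min (r / 2) (min R1 R2) := by
      have : ∀ᶠ ρ : ℝ in 𝓝 0, ρ < min (r / 2) (min R1 R2) :=
        gt_mem_nhds (lt_min (by positivity) (lt_min hR10' hR20'))
      filter_upwards [nhdsWithin_le_nhds this] with ρ h using h.le
    obtain ⟨ρ, h1, h2, h3⟩ := (e1.and (e2.and self_mem_nhdsWithin)).exists
    exact ⟨ρ, h3, h2.trans (min_le_left _ _), h2.trans ((min_le_right _ _).trans (min_le_left _ _)),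
      h2.trans ((min_le_right _ _).trans (min_le_right _ _)), h1⟩
  set X : V →L[ℝ] V := ρ • S with hX
  set T : V →L[ℝ] V := ρ⁻¹ • T₀ with hT
  have h1 : ∀ v, T (X v) = v := by
    intro v; simp [hT, hX, hTS, smul_smul, hρ0.ne']
  have h2 : ∀ v, ε (X v) = 0 := by intro v; simp [hX, hεS]
  have h4 : T e = 0 := by simp [hT, hTe]
  have h5 : ∀ v, v = ε v • e + X (T v) := by
    intro v
    have : X (T v) = S (T₀ v) := by simp [hT, hX, smul_smul, hρ0.ne']
    rw [this]; exact hdec v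
  have hXn : ‖X‖ ≤ ρ := by
    rw [hX, norm_smul, Real.norm_of_nonneg hρ0.le]
    exact mul_le_of_le_one_right hρ0.le hS
  have hTn : ‖T‖ ≤ ρ⁻¹ := by
    rw [hT, norm_smul, Real.norm_of_nonneg (inv_nonneg.2 hρ0.le)]
    exact mul_le_of_le_one_right (inv_nonneg.2 hρ0.le) hT₀
  exact wd_core hp hph X T ε e h1 h2 hεe h4 h5 a ha d had hak M r hM hr hb ρ hρ0 hρr P Ph
    hPdef hPhdef hP hPh R1 R2 hR1 hR2 hρ1 hρ2 hρ3 hXn hTn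

end WR

namespace WR

open Topology Filter

/-- functions analytic at the origin -/
def An (n : ℕ) : Subalgebra ℝ ((Fin n → ℝ) → ℝ) where
  carrier := {f | AnalyticAt ℝ f 0}
  mul_mem' := fun ha hb => AnalyticAt.mul ha hb
  add_mem' := fun ha hb => AnalyticAt.add ha hb
  algebraMap_mem' := fun c => analyticAt_const (v := c)

/-- ideal of functions vanishing near the origin -/
def Zid (n : ℕ) : Ideal (An n) where
  carrier := {f | ∀ᶠ x in 𝓝 0, (f : (Fin n → ℝ) → ℝ) x = 0}
  zero_mem' := by simp
  add_mem' := by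
    intro a b ha hb
    filter_upwards [ha, hb] with x h1 h2
    simp [h1, h2]
  smul_mem' := by
    intro c a ha
    filter_upwards [ha] with x h1
    simp [h1]

/-- the ring of germs of analytic functions -/
def Rn (n : ℕ) : Type := An n ⧸ Zid n

noncomputable instance instCommRingRn (n : ℕ) : CommRing (Rn n) :=
  inferInstanceAs (CommRing (An n ⧸ Zid n))

noncomputable instance instAlgebraRn (n : ℕ) : Algebra ℝ (Rn n) :=
  inferInstanceAs (Algebra ℝ (An n ⧸ Zid n))

section basic

variable {n : ℕ}

/-- the germ of a function -/
def germ (f : (Fin n → ℝ) → ℝ) (hf : AnalyticAt ℝ f 0) : Rn n := Ideal.Quotient.mk (Zid n) ⟨f, hf⟩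

/-- a representative -/
noncomputable def rep (r : Rn n) : (Fin n → ℝ) → ℝ := (Quotient.out (s := Submodule.quotientRel (Zid n)) r : An n).1

lemma rep_an (r : Rn n) : AnalyticAt ℝ (rep r) 0 := (Quotient.out (s := Submodule.quotientRel (Zid n)) r : An n).2

lemma germ_rep (r : Rn n) : germ (rep r) (rep_an r) = r := Quotient.out_eq' r

lemma germ_eq_iff {f g : (Fin n → ℝ) → ℝ} (hf : AnalyticAt ℝ f 0) (hg : AnalyticAt ℝ g 0) :
    germ f hf = germ g hg ↔ f =ᶠ[𝓝 0] g := by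
  refine (Ideal.Quotient.eq (I := Zid n)).trans ?_
  constructor
  · intro h
    filter_upwards [h] with x hx
    exact sub_eq_zero.1 hx
  · intro h
    change ∀ᶠ x in 𝓝 0, f x - g x = 0
    filter_upwards [h] with x hx
    exact sub_eq_zero.2 hx

lemma rep_germ {f : (Fin n → ℝ) → ℝ} (hf : AnalyticAt ℝ f 0) : rep (germ f hf) =ᶠ[𝓝 0] f :=
  (germ_eq_iff (rep_an _) hf).1 (germ_rep _)

lemma rn_ext {a b : Rn n} (h : rep a =ᶠ[𝓝 0] rep b) : a = b := by
  rw [← germ_rep a, ← germ_rep b]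
  exact (germ_eq_iff _ _).2 h

lemma rep_mul (a b : Rn n) : rep (a * b) =ᶠ[𝓝 0] fun x => rep a x * rep b x := by
  have : a * b = germ (fun x => rep a x * rep b x) ((rep_an a).mul (rep_an b)) := by
    conv_lhs => rw [← germ_rep a, ← germ_rep b]
    rfl
  rw [this]; exact rep_germ _

lemma rep_add (a b : Rn n) : rep (a + b) =ᶠ[𝓝 0] fun x => rep a x + rep b x := by
  have : a + b = germ (fun x => rep a x + rep b x) ((rep_an a).add (rep_an b)) := by
    conv_lhs => rw [← germ_rep a, ← germ_rep b]
    rfl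
  rw [this]; exact rep_germ _

lemma rep_sub (a b : Rn n) : rep (a - b) =ᶠ[𝓝 0] fun x => rep a x - rep b x := by
  have : a - b = germ (fun x => rep a x - rep b x) ((rep_an a).sub (rep_an b)) := by
    conv_lhs => rw [← germ_rep a, ← germ_rep b]
    rfl
  rw [this]; exact rep_germ _

lemma rep_smul (c : ℝ) (b : Rn n) : rep (c • b) =ᶠ[𝓝 0] fun x => c * rep b x := by
  have : c • b = germ (fun x => c * rep b x) (analyticAt_const.mul (rep_an b)) := by
    conv_lhs => rw [← germ_rep b]
    rfl
  rw [this]; exact rep_germ _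

lemma rep_algebraMap (c : ℝ) : rep (algebraMap ℝ (Rn n) c) =ᶠ[𝓝 0] fun _ => c := by
  have : algebraMap ℝ (Rn n) c = germ (fun _ => c) analyticAt_const := rfl
  rw [this]; exact rep_germ _

lemma rep_one : rep (1 : Rn n) =ᶠ[𝓝 0] fun _ => 1 := by
  simpa using rep_algebraMap (n := n) 1

lemma rep_zero : rep (0 : Rn n) =ᶠ[𝓝 0] fun _ => 0 := by
  simpa using rep_algebraMap (n := n) 0

lemma rep_eq_zero_iff (a : Rn n) : a = 0 ↔ ∀ᶠ x in 𝓝 0, rep a x = 0 := by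
  constructor
  · rintro rfl; exact rep_zero
  · intro h; exact rn_ext (Filter.EventuallyEq.trans (show rep a =ᶠ[𝓝 0] fun _ => 0 from h) rep_zero.symm)

lemma rep_pow (a : Rn n) (k : ℕ) : rep (a ^ k) =ᶠ[𝓝 0] fun x => rep a x ^ k := by
  induction k with
  | zero => simpa using rep_one
  | succ k ih =>
    rw [pow_succ]
    filter_upwards [rep_mul (a ^ k) a, ih] with x h1 h2
    rw [h1, h2, pow_succ]

lemma rep_sum {ι : Type*} (s : Finset ι) (a : ι → Rn n) :
    rep (∑ i ∈ s, a i) =ᶠ[𝓝 0] fun x => ∑ i ∈ s, rep (a i) x := by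
  classical
  induction s using Finset.induction_on with
  | empty => simpa using rep_zero
  | insert i s hi ih =>
    rw [Finset.sum_insert hi]
    filter_upwards [rep_add (a i) (∑ i ∈ s, a i), ih] with x h1 h2
    rw [h1, h2, Finset.sum_insert hi]

/-- partial derivative of germs -/
noncomputable def pd (i : Fin n) (r : Rn n) : Rn n :=
  germ (fun x => fderiv ℝ (rep r) x (Pi.single i 1))
    (AnalyticAt_clm_apply (rep_an r).fderiv analyticAt_const)

lemma rep_pd (i : Fin n) (r : Rn n) :
    rep (pd i r) =ᶠ[𝓝 0] fun x => fderiv ℝ (rep r) x (Pi.single i 1) := rep_germ _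

lemma rep_pd' (i : Fin n) (r : Rn n) {f : (Fin n → ℝ) → ℝ} (h : rep r =ᶠ[𝓝 0] f) :
    rep (pd i r) =ᶠ[𝓝 0] fun x => fderiv ℝ f x (Pi.single i 1) := by
  filter_upwards [rep_pd i r, h.fderiv (𝕜 := ℝ)] with x h1 h2
  rw [h1, h2]

lemma rep_diff (r : Rn n) : ∀ᶠ x in 𝓝 0, DifferentiableAt ℝ (rep r) x :=
  (rep_an r).eventually_analyticAt.mono fun _ h => h.differentiableAt

/-- partial derivative as derivation -/
noncomputable def pD (i : Fin n) : Derivation ℝ (Rn n) (Rn n) :=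
  Derivation.mk'
    { toFun := pd i
      map_add' := by
        intro a b
        refine rn_ext ?_
        filter_upwards [rep_pd' i _ (rep_add a b), rep_add (pd i a) (pd i b), rep_pd i a,
          rep_pd i b, rep_diff a, rep_diff b] with x h1 h2 h3 h4 h5 h6
        rw [h1, h2, h3, h4, fderiv_fun_add h5 h6]; rfl
      map_smul' := by
        intro c a
        refine rn_ext ?_
        simp only [RingHom.id_apply]
        filter_upwards [rep_pd' i _ (rep_smul c a), rep_smul c (pd i a), rep_pd i a,
          rep_diff a] with x h1 h2 h3 h5
        rw [h1, h2, h3, fderiv_const_mul h5]; rfl }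
    (by
      intro a b
      refine rn_ext ?_
      change rep (pd i (a * b)) =ᶠ[𝓝 0] rep (a * pd i b + b * pd i a)
      filter_upwards [rep_pd' i _ (rep_mul a b), rep_add (a * pd i b) (b * pd i a),
        rep_mul a (pd i b), rep_mul b (pd i a), rep_pd i a, rep_pd i b, rep_diff a,
        rep_diff b] with x h1 h2 h3 h4 h5 h6 h7 h8
      rw [h1, h2, h3, h4, h5, h6, fderiv_fun_mul h7 h8]; rfl)

lemma pD_apply (i : Fin n) (r : Rn n) : pD i r = pd i r := rfl

lemma proj_an (i : Fin n) : AnalyticAt ℝ (fun x : Fin n → ℝ => x i) 0 :=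
  (ContinuousLinearMap.proj (R := ℝ) (φ := fun _ : Fin n => ℝ) i).analyticAt 0

/-- coordinate germs -/
def Xc (i : Fin n) : Rn n := germ (fun x => x i) (proj_an i)

lemma rep_Xc (i : Fin n) : rep (Xc i) =ᶠ[𝓝 0] fun x => x i := rep_germ _

lemma pD_Xc (i j : Fin n) : pD i (Xc j) = if i = j then 1 else 0 := by
  rw [pD_apply]
  have h := rep_pd' i _ (rep_Xc j)
  have h0 : ∀ x : Fin n → ℝ, fderiv ℝ (fun x : Fin n → ℝ => x j) x (Pi.single i 1) =
      if i = j then 1 else 0 := by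
    intro x
    have := (ContinuousLinearMap.proj (R := ℝ) (φ := fun _ : Fin n => ℝ) j).fderiv (x := x)
    have h' : fderiv ℝ (fun x : Fin n → ℝ => x j) x =
      (ContinuousLinearMap.proj (R := ℝ) (φ := fun _ : Fin n => ℝ) j) := this
    rw [h']
    simp [Pi.single_apply, eq_comm]
  simp only [h0] at h
  refine rn_ext (h.trans ?_)
  split_ifs
  · exact rep_one.symm
  · exact rep_zero.symm

end basic

section pullback

variable {m n : ℕ}

lemma comp_an (L : (Fin n → ℝ) →L[ℝ] (Fin m → ℝ)) {f : (Fin m → ℝ) → ℝ} (hf : AnalyticAt ℝ f 0) :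
    AnalyticAt ℝ (fun x => f (L x)) 0 := by
  refine AnalyticAt.comp (g := f) (f := L) ?_ (L.analyticAt 0)
  rwa [map_zero]

lemma comp_ev (L : (Fin n → ℝ) →L[ℝ] (Fin m → ℝ)) {p : (Fin m → ℝ) → Prop}
    (hp : ∀ᶠ x in 𝓝 0, p x) : ∀ᶠ x in 𝓝 0, p (L x) := by
  have : Tendsto L (𝓝 0) (𝓝 0) := by simpa using L.continuous.tendsto 0
  exact this.eventually hp

lemma pull_aux (L : (Fin n → ℝ) →L[ℝ] (Fin m → ℝ)) (r : Rn m) {f : (Fin m → ℝ) → ℝ}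
    (h : rep r =ᶠ[𝓝 0] f) : rep (germ _ (comp_an L (rep_an r))) =ᶠ[𝓝 0] fun x => f (L x) := by
  filter_upwards [rep_germ (comp_an L (rep_an r)), comp_ev L h] with x h1 h2
  rw [h1, h2]

/-- pullback of germs along a linear map -/
noncomputable def pull (L : (Fin n → ℝ) →L[ℝ] (Fin m → ℝ)) : Rn m →ₐ[ℝ] Rn n where
  toFun r := germ _ (comp_an L (rep_an r))
  map_one' := rn_ext ((pull_aux L _ rep_one).trans rep_one.symm)
  map_zero' := rn_ext ((pull_aux L _ rep_zero).trans rep_zero.symm)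
  map_mul' a b := by
    refine rn_ext ((pull_aux L _ (rep_mul a b)).trans ?_)
    filter_upwards [rep_mul (germ _ (comp_an L (rep_an a))) (germ _ (comp_an L (rep_an b))),
      rep_germ (comp_an L (rep_an a)), rep_germ (comp_an L (rep_an b))] with x h1 h2 h3
    rw [h1, h2, h3]
  map_add' a b := by
    refine rn_ext ((pull_aux L _ (rep_add a b)).trans ?_)
    filter_upwards [rep_add (germ _ (comp_an L (rep_an a))) (germ _ (comp_an L (rep_an b))),
      rep_germ (comp_an L (rep_an a)), rep_germ (comp_an L (rep_an b))] with x h1 h2 h3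
    rw [h1, h2, h3]
  commutes' c := rn_ext ((pull_aux L _ (rep_algebraMap c)).trans (rep_algebraMap c).symm)

lemma rep_pull' (L : (Fin n → ℝ) →L[ℝ] (Fin m → ℝ)) (r : Rn m) {f : (Fin m → ℝ) → ℝ}
    (h : rep r =ᶠ[𝓝 0] f) : rep (pull L r) =ᶠ[𝓝 0] fun x => f (L x) := pull_aux L r h

lemma rep_pull (L : (Fin n → ℝ) →L[ℝ] (Fin m → ℝ)) (r : Rn m) :
    rep (pull L r) =ᶠ[𝓝 0] fun x => rep r (L x) := pull_aux L r (EventuallyEq.refl _ _)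

lemma pull_Xc (L : (Fin n → ℝ) →L[ℝ] (Fin m → ℝ)) (j : Fin m) :
    pull L (Xc j) = ∑ i, L (Pi.single i 1) j • Xc i := by
  refine rn_ext ((rep_pull' L _ (rep_Xc j)).trans ?_)
  have h : ∀ᶠ x in 𝓝 0, ∀ i ∈ Finset.univ, rep (L (Pi.single i 1) j • Xc i) x =
      L (Pi.single i 1) j * x i := by
    rw [Filter.eventually_all_finset]
    intro i _
    filter_upwards [rep_smul (L (Pi.single i 1) j) (Xc i), rep_Xc i] with x h1 h2
    rw [h1, h2]
  filter_upwards [rep_sum Finset.univ (fun i => L (Pi.single i 1) j • Xc i), h] with x h1 h2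
  rw [h1, Finset.sum_congr rfl h2]
  have : x = ∑ i, x i • (Pi.single i 1 : Fin n → ℝ) := by
    ext k; simp [Finset.sum_apply, Pi.single_apply]
  conv_lhs => rw [this]
  rw [map_sum, Finset.sum_apply]
  refine Finset.sum_congr rfl fun i _ => ?_
  rw [map_smul, Pi.smul_apply, smul_eq_mul, mul_comm]

lemma pD_pull (L : (Fin n → ℝ) →L[ℝ] (Fin m → ℝ)) (r : Rn m) (i : Fin n) :
    pD i (pull L r) = ∑ j, L (Pi.single i 1) j • pull L (pD j r) := by
  refine rn_ext ?_
  have h : ∀ᶠ x in 𝓝 0, ∀ j ∈ Finset.univ, rep (L (Pi.single i 1) j • pull L (pD j r)) x =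
      L (Pi.single i 1) j * fderiv ℝ (rep r) (L x) (Pi.single j 1) := by
    rw [Filter.eventually_all_finset]
    intro j _
    filter_upwards [rep_smul (L (Pi.single i 1) j) (pull L (pD j r)),
      rep_pull' L _ (rep_pd j r)] with x h1 h2
    rw [h1, ← h2]; rfl
  filter_upwards [rep_sum Finset.univ (fun j => L (Pi.single i 1) j • pull L (pD j r)), h,
    rep_pd' i _ (rep_pull L r), comp_ev L (rep_diff r)] with x h1 h2 h3 h4
  rw [h1, Finset.sum_congr rfl h2, pD_apply, h3]
  have h5 : fderiv ℝ (fun x => rep r (L x)) x = (fderiv ℝ (rep r) (L x)) ∘L L := by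
    have := fderiv_comp x (g := rep r) (f := L) h4 L.differentiableAt
    rw [L.fderiv] at this
    exact this
  rw [h5, ContinuousLinearMap.comp_apply]
  have : L (Pi.single i 1) = ∑ j, L (Pi.single i 1) j • (Pi.single j 1 : Fin m → ℝ) := by
    ext k; simp [Finset.sum_apply, Pi.single_apply]
  conv_lhs => rw [this]
  rw [map_sum]
  refine Finset.sum_congr rfl fun j _ => ?_
  rw [map_smul, smul_eq_mul]

end pullback

end WR

namespace WR

open Topology Filter

lemma exists_dir {n : ℕ} {f : (Fin (n + 1) → ℝ) → ℝ} (hf : AnalyticAt ℝ f 0)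
    (hne : ¬ ∀ᶠ x in 𝓝 0, f x = 0) :
    ∃ l : Fin (n + 1) → ℝ, l ≠ 0 ∧ ¬ ∀ᶠ t : ℝ in 𝓝 0, f (t • l) = 0 := by
  obtain ⟨r, hr, hb⟩ := Metric.eventually_nhds_iff_ball.1 hf.eventually_analyticAt
  have h1 : ∃ᶠ x in 𝓝[≠] (0 : Fin (n + 1) → ℝ), f x ≠ 0 := by
    intro hcon
    simp only [not_not] at hcon
    refine hne ?_
    have h0 : f 0 = 0 := by
      have t1 : Tendsto f (𝓝[≠] 0) (𝓝 (f 0)) := hf.continuousAt.mono_left nhdsWithin_le_nhds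
      have t2 : Tendsto f (𝓝[≠] 0) (𝓝 0) :=
        tendsto_const_nhds.congr' (by filter_upwards [hcon] with x hx using hx.symm)
      exact tendsto_nhds_unique t1 t2
    rw [eventually_nhdsWithin_iff] at hcon
    filter_upwards [hcon] with x hx
    by_cases hx0 : x = 0
    · rw [hx0, h0]
    · exact hx hx0
  have h2 : ∀ᶠ x in 𝓝[≠] (0 : Fin (n + 1) → ℝ), x ≠ 0 ∧ x ∈ Metric.ball 0 r :=
    (eventually_mem_nhdsWithin.mono fun x hx => hx).and
      (nhdsWithin_le_nhds (Metric.ball_mem_nhds 0 hr))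
  obtain ⟨l, hl, hl0, hlb⟩ := (h1.and_eventually h2).exists
  refine ⟨l, hl0, fun hcon => hl ?_⟩
  let s : Set ℝ := {t | t • l ∈ Metric.ball 0 r}
  have hs : Convex ℝ s :=
    (convex_ball (0 : Fin (n + 1) → ℝ) r).is_linear_preimage (IsLinearMap.isLinearMap_smul' l)
  have han : AnalyticOnNhd ℝ (fun t : ℝ => f (t • l)) s := by
    intro t ht
    refine AnalyticAt.comp (g := f) (f := fun t : ℝ => t • l) (hb _ ht) ?_
    exact analyticAt_id.smul analyticAt_const
  have h0s : (0 : ℝ) ∈ s := by simp [s, hr]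
  have := han.eqOn_zero_of_preconnected_of_eventuallyEq_zero hs.isPreconnected h0s hcon
    (show (1 : ℝ) ∈ s by simpa [s] using hlb)
  simpa using this

/-- Weierstrass division in terms of germs, direction given by `A` -/
lemma wd_germ {n : ℕ} (A : (Fin (n + 1) → ℝ) ≃L[ℝ] (Fin (n + 1) → ℝ)) (f : Rn (n + 1))
    (π : (Fin (n + 1) → ℝ) →L[ℝ] (Fin n → ℝ)) (hπ : ∀ x, π x = Fin.tail (A.symm x))
    (z : Rn (n + 1)) (hz : rep z =ᶠ[𝓝 0] fun x => A.symm x 0)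
    (hne : ¬ ∀ᶠ t : ℝ in 𝓝 0, rep f (A (Pi.single 0 t)) = 0) :
    ∃ d : ℕ, ∀ h : Rn (n + 1), ∃ (q : Rn (n + 1)) (r : Fin d → Rn n),
      h = q * f + ∑ j, pull π (r j) * z ^ (j : ℕ) := by
  obtain ⟨d, hd⟩ := wd (comp_an (A : (Fin (n + 1) → ℝ) →L[ℝ] (Fin (n + 1) → ℝ)) (rep_an f)) hne
  refine ⟨d, fun h => ?_⟩
  obtain ⟨q, r, hq, hr, hE⟩ :=
    hd _ (comp_an (A : (Fin (n + 1) → ℝ) →L[ℝ] (Fin (n + 1) → ℝ)) (rep_an h))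
  have hq' := comp_an (A.symm : (Fin (n + 1) → ℝ) →L[ℝ] (Fin (n + 1) → ℝ)) hq
  refine ⟨germ _ hq', fun j => germ (r j) (hr j), rn_ext ?_⟩
  have hE' := comp_ev (A.symm : (Fin (n + 1) → ℝ) →L[ℝ] (Fin (n + 1) → ℝ)) hE
  have hs : ∀ᶠ x in 𝓝 0, ∀ j ∈ Finset.univ, rep (pull π (germ (r j) (hr j)) * z ^ (j : ℕ)) x =
      r j (Fin.tail (A.symm x)) * (A.symm x 0) ^ (j : ℕ) := by
    rw [Filter.eventually_all_finset]
    intro j _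
    filter_upwards [rep_mul (pull π (germ (r j) (hr j))) (z ^ (j : ℕ)), rep_pow z j,
      rep_pull' π _ (rep_germ (hr j)), hz] with x h1 h2 h3 h4
    rw [h1, h2, h3, h4, hπ]
  filter_upwards [hE', rep_add (germ _ hq' * f) (∑ j, pull π (germ (r j) (hr j)) * z ^ (j : ℕ)),
    rep_mul (germ _ hq') f, rep_germ hq', hs,
    rep_sum Finset.univ (fun j => pull π (germ (r j) (hr j)) * z ^ (j : ℕ))]
    with x h1 h2 h3 h4 h5 h6
  rw [h2, h3, h4, h6, Finset.sum_congr rfl h5]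
  simpa using h1

lemma poly_ne {d : ℕ} (a : Fin d → ℝ) :
    ¬ ∀ᶠ t : ℝ in 𝓝 0, t ^ d - ∑ j, a j * t ^ (j : ℕ) = 0 := by
  intro h
  let P : Polynomial ℝ := Polynomial.X ^ d - ∑ j : Fin d, Polynomial.C (a j) * Polynomial.X ^ (j : ℕ)
  have hP : P.Monic := by
    refine Polynomial.monic_X_pow_sub ?_
    refine (Polynomial.degree_sum_le _ _).trans_lt ?_
    rw [Finset.sup_lt_iff (by exact WithBot.bot_lt_coe d)]
    intro j _
    exact (Polynomial.degree_C_mul_X_pow_le _ _).trans_lt (by exact_mod_cast j.2)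
  have hev : ∀ t, P.eval t = t ^ d - ∑ j, a j * t ^ (j : ℕ) := by
    intro t
    simp [P, Polynomial.eval_finsetSum]
  have hfin : {t | P.IsRoot t}.Finite := P.finite_setOfPred_isRoot hP.ne_zero
  have hmem : {t | P.IsRoot t} ∈ 𝓝 (0 : ℝ) := by
    filter_upwards [h] with t ht
    change P.eval t = 0
    rw [hev, ht]
  exact (infinite_of_mem_nhds (0 : ℝ) hmem) hfin

lemma wprep {n : ℕ} (f : Rn (n + 1)) (hf : f ≠ 0) :
    ∃ (π : (Fin (n + 1) → ℝ) →L[ℝ] (Fin n → ℝ)) (z : Rn (n + 1)) (d d' : ℕ) (a : Fin d → Rn n),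
      (∃ c : Fin (n + 1) → ℝ, z = ∑ i, c i • Xc i) ∧
      z ^ d - ∑ j, pull π (a j) * z ^ (j : ℕ) ∈ Ideal.span {f} ∧
      ∀ h : Rn (n + 1), ∃ (q : Rn (n + 1)) (r : Fin d' → Rn n),
        h = q * (z ^ d - ∑ j, pull π (a j) * z ^ (j : ℕ)) + ∑ j, pull π (r j) * z ^ (j : ℕ) := by
  rw [Ne, rep_eq_zero_iff] at hf
  obtain ⟨l, hl0, hl⟩ := exists_dir (rep_an f) hf
  obtain ⟨A, hA⟩ := SeparatingDual.exists_continuousLinearEquiv_apply_eq (R := ℝ)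
    (x := (Pi.single 0 1 : Fin (n + 1) → ℝ)) (y := l) (by simp) hl0
  have hAt : ∀ t : ℝ, A (Pi.single 0 t) = t • l := by
    intro t
    have : (Pi.single 0 t : Fin (n + 1) → ℝ) = t • Pi.single 0 1 := by
      rw [← Pi.single_smul, smul_eq_mul, mul_one]
    rw [this, map_smul, hA]
  let tl : (Fin (n + 1) → ℝ) →L[ℝ] (Fin n → ℝ) :=
    ContinuousLinearMap.pi fun j => ContinuousLinearMap.proj j.succ
  let π : (Fin (n + 1) → ℝ) →L[ℝ] (Fin n → ℝ) :=
    tl ∘L (A.symm : (Fin (n + 1) → ℝ) →L[ℝ] (Fin (n + 1) → ℝ))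
  have hπ : ∀ x, π x = Fin.tail (A.symm x) := fun x => rfl
  let z : Rn (n + 1) := pull (A.symm : (Fin (n + 1) → ℝ) →L[ℝ] (Fin (n + 1) → ℝ)) (Xc 0)
  have hz : rep z =ᶠ[𝓝 0] fun x => A.symm x 0 := rep_pull' _ _ (rep_Xc 0)
  obtain ⟨d, hd⟩ := wd_germ A f π hπ z hz (by simpa only [hAt] using hl)
  obtain ⟨q, a, hqa⟩ := hd (z ^ d)
  set p := z ^ d - ∑ j, pull π (a j) * z ^ (j : ℕ) with hp
  have hpne : ¬ ∀ᶠ t : ℝ in 𝓝 0, rep p (A (Pi.single 0 t)) = 0 := by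
    intro hcon
    refine poly_ne (fun j => rep (a j) 0) ?_
    have hc : Tendsto (fun t : ℝ => A (Pi.single 0 t)) (𝓝 0) (𝓝 0) := by
      have : Continuous fun t : ℝ => A (Pi.single 0 t) :=
        A.continuous.comp (continuous_single (A := fun _ : Fin (n + 1) => ℝ) 0)
      simpa using this.tendsto 0
    have hs : ∀ᶠ x in 𝓝 0, ∀ j ∈ Finset.univ, rep (pull π (a j) * z ^ (j : ℕ)) x =
        rep (a j) (Fin.tail (A.symm x)) * (A.symm x 0) ^ (j : ℕ) := by
      rw [Filter.eventually_all_finset]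
      intro j _
      filter_upwards [rep_mul (pull π (a j)) (z ^ (j : ℕ)), rep_pow z j,
        rep_pull π (a j), hz] with x h1 h2 h3 h4
      rw [h1, h2, h3, h4, hπ]
    filter_upwards [hcon, hc.eventually hs, hc.eventually (rep_sub (z ^ d) (∑ j, pull π (a j) * z ^ (j : ℕ))),
      hc.eventually (rep_pow z d), hc.eventually hz, hc.eventually
        (rep_sum Finset.univ fun j => pull π (a j) * z ^ (j : ℕ))] with t h1 h2 h3 h4 h5 h6
    rw [hp, h3, h4, h5, h6, Finset.sum_congr rfl h2] at h1
    have ht : Fin.tail (Pi.single 0 t : Fin (n + 1) → ℝ) = 0 := by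
      ext j; simp [Fin.tail]
    simpa [ht] using h1
  obtain ⟨d', hd'⟩ := wd_germ A p π hπ z hz hpne
  refine ⟨π, z, d, d', a, ⟨_, pull_Xc _ _⟩, ?_, hd'⟩
  rw [← hp, Ideal.mem_span_singleton']
  exact ⟨q, by rw [hp]; linear_combination -hqa⟩

end WR

namespace WR

open Topology Filter

lemma rn0_unit (f : Rn 0) (hf : f ≠ 0) : IsUnit f := by
  rw [Ne, rep_eq_zero_iff] at hf
  have h0 : rep f 0 ≠ 0 := by
    intro h
    refine hf (Eventually.of_forall fun x => ?_)
    rwa [Subsingleton.elim x 0]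
  refine IsUnit.of_mul_eq_one (algebraMap ℝ _ (rep f 0)⁻¹) (rn_ext ?_)
  filter_upwards [rep_mul f (algebraMap ℝ _ (rep f 0)⁻¹), rep_one, rep_algebraMap (n := 0) (rep f 0)⁻¹]
    with x h1 h2 h3
  rw [h1, h2, h3, Subsingleton.elim x 0, mul_inv_cancel₀ h0]

lemma noeth_step {S R : Type*} [CommRing S] [CommRing R] [IsNoetherianRing S]
    (H : ∀ f : R, f ≠ 0 → ∃ (φ : S →+* R) (p : R) (z : R) (d : ℕ), p ∈ Ideal.span {f} ∧
      ∀ h, ∃ (q : R) (r : Fin d → S), h = q * p + ∑ j, φ (r j) * z ^ (j : ℕ)) :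
    IsNoetherianRing R := by
  rw [isNoetherianRing_iff_ideal_fg]
  intro I
  by_cases hI : I = ⊥
  · rw [hI]; exact Submodule.fg_bot
  obtain ⟨f, hfI, hf0⟩ := Submodule.exists_mem_ne_zero_of_ne_bot hI
  obtain ⟨φ, p, z, d, hp, hd⟩ := H f hf0
  have hpI : p ∈ I := (Ideal.span_singleton_le_iff_mem I).2 hfI hp
  letI : Algebra S R := φ.toAlgebra
  let N : Submodule S R := Submodule.span S (Set.range fun j : Fin d => z ^ (j : ℕ))
  have hN : N.FG := Submodule.fg_span (Set.finite_range _)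
  have : IsNoetherian S N := isNoetherian_of_fg_of_noetherian N hN
  let I' : Submodule S R := I.restrictScalars S
  have hI' : (I' ⊓ N).FG := by
    have h1 : (Submodule.comap N.subtype I').FG := IsNoetherian.noetherian _
    have h2 := h1.map N.subtype
    rwa [Submodule.map_comap_subtype, inf_comm] at h2
  obtain ⟨s, hs⟩ := hI'
  classical
  refine ⟨insert p s, le_antisymm ?_ ?_⟩
  · rw [Ideal.span_le, Finset.coe_insert, Set.insert_subset_iff]
    refine ⟨hpI, fun x hx => ?_⟩
    have : x ∈ I' ⊓ N := hs ▸ Submodule.subset_span hx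
    exact this.1
  · intro h hh
    obtain ⟨q, r, hqr⟩ := hd h
    have hmem : ∑ j, φ (r j) * z ^ (j : ℕ) ∈ I' ⊓ N := by
      refine ⟨?_, ?_⟩
      · change _ ∈ I
        have : ∑ j, φ (r j) * z ^ (j : ℕ) = h - q * p := by rw [hqr]; ring
        rw [this]
        exact I.sub_mem hh (I.mul_mem_left _ hpI)
      · refine Submodule.sum_mem _ fun j _ => ?_
        have : φ (r j) * z ^ (j : ℕ) = r j • z ^ (j : ℕ) := (Algebra.smul_def _ _).symm
        rw [this]
        exact Submodule.smul_mem _ _ (Submodule.subset_span ⟨j, rfl⟩)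
    rw [← hs] at hmem
    have hle : Submodule.span S (s : Set R) ≤
        (Ideal.span (insert p s : Finset R) : Ideal R).restrictScalars S := by
      rw [Submodule.span_le]
      intro x hx
      exact Ideal.subset_span (by simp [Finset.mem_coe.1 hx])
    rw [hqr]
    refine Ideal.add_mem _ (Ideal.mul_mem_left _ _ (Ideal.subset_span (by simp))) (hle hmem)

theorem rn_noeth (n : ℕ) : IsNoetherianRing (Rn n) := by
  induction n with
  | zero =>
    rw [isNoetherianRing_iff_ideal_fg]
    intro I
    by_cases hI : I = ⊥
    · rw [hI]; exact Submodule.fg_bot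
    obtain ⟨f, hfI, hf0⟩ := Submodule.exists_mem_ne_zero_of_ne_bot hI
    rw [Ideal.eq_top_of_isUnit_mem I hfI (rn0_unit f hf0)]
    exact ⟨{1}, by simp⟩
  | succ n ih =>
    refine noeth_step (S := Rn n) fun f hf => ?_
    obtain ⟨π, z, d, d', a, _, h2, h3⟩ := wprep f hf
    exact ⟨(pull π).toRingHom, _, z, d', h2, h3⟩

theorem nn_all (n : ℕ) (Q : Ideal (Rn n)) (hQ : Q ≠ ⊤) : NNProp pD Xc Q := by
  induction n with
  | zero =>
    have hQ0 : Q = ⊥ := by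
      by_contra hI
      obtain ⟨f, hfI, hf0⟩ := Submodule.exists_mem_ne_zero_of_ne_bot hI
      exact hQ (Ideal.eq_top_of_isUnit_mem Q hfI (rn0_unit f hf0))
    refine ⟨⊤, fun t _ ht => by simpa [hQ0] using ht, ?_, ?_⟩
    · intro t _
      exact ⟨0, fun i => i.elim0, fun i => i.elim0, fun i => i.elim0, fun i => i.elim0⟩
    · intro r
      exact ⟨r, Algebra.subset_adjoin (Or.inl trivial), by simp⟩
  | succ n ih =>
    by_cases hI : Q = ⊥
    · refine ⟨⊤, fun t _ ht => by simpa [hI] using ht, ?_, ?_⟩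
      · intro t _
        exact ⟨n + 1, fun l => pD l t, fun l i => if i = l then 1 else 0, fun l => trivial,
          fun i => by simp⟩
      · intro r
        exact ⟨r, Algebra.subset_adjoin (Or.inl trivial), by simp⟩
    obtain ⟨f, hfI, hf0⟩ := Submodule.exists_mem_ne_zero_of_ne_bot hI
    obtain ⟨π, z, d, d', a, ⟨cz, hz⟩, hp, hdiv⟩ := wprep f hf0
    have hpQ := (Ideal.span_singleton_le_iff_mem Q).2 hfI hp
    set p := z ^ d - ∑ j, pull π (a j) * z ^ (j : ℕ) with hpdef
    obtain ⟨T0', h1', h2', h3'⟩ := ih (Q.comap (pull π)) (Ideal.comap_ne_top _ hQ)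
    set T' := Algebra.adjoin ℝ ((T0' : Set (Rn n)) ∪ Set.range Xc) with hT'
    set T0 := T0'.map (pull π) with hT0
    set T := Algebra.adjoin ℝ ((T0 : Set (Rn (n + 1))) ∪ Set.range Xc) with hT
    have hxT : ∀ i, Xc i ∈ T := fun i => Algebra.subset_adjoin (Or.inr ⟨i, rfl⟩)
    have hpullT : ∀ t ∈ T', pull π t ∈ T := by
      intro t ht
      have hle : T' ≤ T.comap (pull π) := by
        rw [hT', Algebra.adjoin_le_iff]
        rintro x (hx | ⟨j, rfl⟩)
        · exact Algebra.subset_adjoin (Or.inl ⟨x, hx, rfl⟩)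
        · change pull π (Xc j) ∈ T
          rw [pull_Xc]
          exact sum_mem fun i _ => T.smul_mem (hxT i) _
      exact hle ht
    have hzT : z ∈ T := by
      rw [hz]
      exact sum_mem fun i _ => T.smul_mem (hxT i) _
    set J := Ideal.span ((Q : Set (Rn (n + 1))) ∩ (T : Set (Rn (n + 1)))) with hJ
    have hJQ : J ≤ Q := by
      rw [hJ, Ideal.span_le]; exact Set.inter_subset_left
    have hpullJ : ∀ u ∈ Ideal.span (((Q.comap (pull π) : Ideal (Rn n)) : Set (Rn n)) ∩ (T' : Set (Rn n))),
        pull π u ∈ J := by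
      intro u hu
      have hle : Ideal.span (((Q.comap (pull π) : Ideal (Rn n)) : Set (Rn n)) ∩ (T' : Set (Rn n))) ≤
          J.comap (pull π) := by
        rw [Ideal.span_le]
        rintro x ⟨hx1, hx2⟩
        exact Ideal.subset_span ⟨hx1, hpullT x hx2⟩
      exact hle hu
    have happ : ∀ (k : ℕ) (r : Fin k → Rn n), ∃ t ∈ T,
        ∑ j, pull π (r j) * z ^ (j : ℕ) - t ∈ J := by
      intro k r
      choose t ht htJ using h3'
      refine ⟨∑ j, pull π (t (r j)) * z ^ (j : ℕ), sum_mem fun j _ =>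
        T.mul_mem (hpullT _ (ht _)) (T.pow_mem hzT _), ?_⟩
      rw [← Finset.sum_sub_distrib]
      refine Ideal.sum_mem _ fun j _ => ?_
      rw [← sub_mul, ← map_sub]
      exact Ideal.mul_mem_right _ _ (hpullJ _ (htJ _))
    have hpJ : p ∈ J := by
      obtain ⟨t, htT, htJ⟩ := happ d a
      have h1 : z ^ d - t ∈ J := by
        refine Ideal.subset_span ⟨?_, T.sub_mem (T.pow_mem hzT _) htT⟩
        have : z ^ d - t = p + (∑ j, pull π (a j) * z ^ (j : ℕ) - t) := by rw [hpdef]; ring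
        rw [this]
        exact Q.add_mem hpQ (hJQ htJ)
      have : p = (z ^ d - t) - (∑ j, pull π (a j) * z ^ (j : ℕ) - t) := by rw [hpdef]; ring
      rw [this]
      exact J.sub_mem h1 htJ
    refine ⟨T0, ?_, ?_, ?_⟩
    · rintro _ ⟨t, ht, rfl⟩ htQ
      have := h1' t ht htQ
      rw [this]; exact map_zero (pull π)
    · rintro _ ⟨t, ht, rfl⟩
      obtain ⟨r, b, c, hc, hD⟩ := h2' t ht
      refine ⟨r, fun l => pull π (b l), fun l i => ∑ j, c l j * π (Pi.single i 1) j, ?_, ?_⟩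
      · intro l
        refine ⟨_, hc l, ?_⟩
        change pull π (∑ j, c l j • Xc j) = _
        simp only [map_sum, map_smul, pull_Xc, Finset.smul_sum, Finset.sum_smul, smul_smul]
        exact Finset.sum_comm
      · intro i
        change pD i (pull π t) = _
        rw [pD_pull]
        simp only [hD, map_sum, map_smul, Finset.smul_sum, Finset.sum_smul, smul_smul]
        rw [Finset.sum_comm]
        refine Finset.sum_congr rfl fun l _ => Finset.sum_congr rfl fun j _ => ?_
        rw [mul_comm]
    · intro h
      obtain ⟨q, r, hqr⟩ := hdiv h
      obtain ⟨t, htT, htJ⟩ := happ d' r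
      refine ⟨t, htT, ?_⟩
      have : h - t = q * p + (∑ j, pull π (r j) * z ^ (j : ℕ) - t) := by rw [hqr]; ring
      rw [this]
      exact J.add_mem (J.mul_mem_left _ hpJ) htJ

/-- the algebraic Lojasiewicz inequality for germs -/
theorem loj_germ {n : ℕ} (P : Ideal (Rn n)) (hP : P.IsPrime)
    (g δ : Rn n) (hg : g ∉ P) (hδ : δ ∉ P)
    (u : Fin n → Rn n) (k : ℕ) (F c : Fin k → Rn n) (hF : ∀ j, F j ∈ P)
    (hu : ∀ i, u i = δ * pD i g - ∑ j, c j * pD i (F j)) :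
    ∃ N : ℕ, 1 ≤ N ∧ ∃ j ∈ Ideal.span (insert (δ * g) (Set.range u)) ^ N,
      (δ * g) ^ N - g * j ∈ P := by
  have := rn_noeth n
  exact loj_alg pD Xc pD_Xc (fun Q hQ => nn_all n Q hQ.ne_top) P hP g δ hg hδ u k F c hF hu

end WR

namespace WR

section minors

variable {R : Type*} [CommRing R] [Algebra ℝ R] {n : ℕ} (D : Fin n → Derivation ℝ R R)

/-- Jacobian minor -/
noncomputable def minorJ {k : ℕ} (F : Fin k → R) (I : Fin k → Fin n) : R :=
  (Matrix.of fun a b => D (I b) (F a)).det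

lemma exists_max_minor (P : Ideal R) (hP : P.IsPrime) :
    ∃ (k : ℕ) (F : Fin k → R), (∀ j, F j ∈ P) ∧ (∃ I, minorJ D F I ∉ P) ∧
      ∀ (F' : Fin (k + 1) → R) I, (∀ j, F' j ∈ P) → minorJ D F' I ∈ P := by
  by_contra hcon
  push Not at hcon
  have h : ∀ k, ∃ F : Fin k → R, (∀ j, F j ∈ P) ∧ ∃ I, minorJ D F I ∉ P := by
    intro k
    induction k with
    | zero =>
      refine ⟨fun i => i.elim0, fun i => i.elim0, fun i => i.elim0, ?_⟩
      simp only [minorJ, Matrix.det_fin_zero]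
      exact fun h => hP.ne_top ((Ideal.eq_top_iff_one _).2 h)
    | succ k ih =>
      obtain ⟨F, hF, hI⟩ := ih
      obtain ⟨F', I, h1, h2⟩ := hcon k F hF hI
      exact ⟨F', h1, I, h2⟩
  obtain ⟨F, _, I, hI⟩ := h (n + 1)
  refine hI ?_
  obtain ⟨a, b, hab, hIab⟩ := Fintype.exists_ne_map_eq_of_card_lt I (by simp)
  rw [minorJ, Matrix.det_zero_of_column_eq hab (by intro i; simp [hIab])]
  exact P.zero_mem

theorem minor_fields (P : Ideal R) (hP : P.IsPrime) :
    ∃ (k : ℕ) (F : Fin k → R) (δ : (Fin k → Fin n) → R)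
      (vc : (Fin k → Fin n) → Fin n → Fin n → R),
      (∀ j, F j ∈ P) ∧ (∃ I, δ I ∉ P) ∧
      (∀ I i, ∀ f ∈ P, ∑ l, vc I i l * D l f ∈ P) ∧
      (∀ I i l, vc I i l ∈ Ideal.span (Set.range δ)) ∧
      (∀ I g, ∃ c : Fin k → R, ∀ i, ∑ l, vc I i l * D l g = δ I * D i g - ∑ j, c j * D i (F j)) := by
  obtain ⟨k, F, hF, hI, hmax⟩ := exists_max_minor D P hP
  let sn : (Fin k → Fin n) → Fin n → Fin (k + 1) → Fin n := fun I i => Fin.snoc I i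
  let fn : R → Fin (k + 1) → R := fun f => Fin.snoc F f
  let vc : (Fin k → Fin n) → Fin n → Fin n → R := fun I i l =>
    ∑ j, if sn I i j = l then (-1) ^ (k + (j : ℕ)) * minorJ D F (sn I i ∘ j.succAbove) else 0
  have hv : ∀ I i f, ∑ l, vc I i l * D l f = minorJ D (fn f) (sn I i) := by
    intro I i f
    rw [minorJ, Matrix.det_succ_row _ (Fin.last k)]
    simp only [vc, Finset.sum_mul]
    rw [Finset.sum_comm]
    refine Finset.sum_congr rfl fun j _ => ?_
    rw [Finset.sum_eq_single (sn I i j)]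
    · rw [if_pos rfl]
      have h1 : (Matrix.of fun a b => D (sn I i b) (fn f a)) (Fin.last k) j = D (sn I i j) f := by
        simp [fn]
      have h2 : ((Matrix.of fun a b => D (sn I i b) (fn f a)).submatrix (Fin.last k).succAbove
          j.succAbove) = Matrix.of fun a b => D ((sn I i ∘ j.succAbove) b) (F a) := by
        ext a b
        simp [fn]
      rw [h1, h2, minorJ, Fin.val_last]
      ring
    · intro l _ hl
      rw [if_neg (Ne.symm hl), zero_mul]
    · simp
  refine ⟨k, F, minorJ D F, vc, hF, hI, ?_, ?_, ?_⟩
  · intro I i f hf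
    rw [hv]
    refine hmax _ _ fun j => ?_
    refine Fin.lastCases ?_ (fun j => ?_) j
    · simpa [fn] using hf
    · simpa [fn] using hF j
  · intro I i l
    refine Ideal.sum_mem _ fun j _ => ?_
    split_ifs
    · exact Ideal.mul_mem_left _ _ (Ideal.subset_span ⟨_, rfl⟩)
    · exact Ideal.zero_mem _
  · intro I g
    refine ⟨fun a => -((-1) ^ ((a : ℕ) + k) * (Matrix.of fun a' b => D (I b)
      (fn g (a.castSucc.succAbove a'))).det), fun i => ?_⟩
    rw [hv, minorJ, Matrix.det_succ_column _ (Fin.last k), Fin.sum_univ_castSucc]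
    have h1 : ((Matrix.of fun a b => D (sn I i b) (fn g a)).submatrix (Fin.last k).succAbove
        (Fin.last k).succAbove) = Matrix.of fun a b => D (I b) (F a) := by
      ext a b
      simp [fn, sn]
    have h2 : ∀ a : Fin k, ((Matrix.of fun a b => D (sn I i b) (fn g a)).submatrix a.castSucc.succAbove
        (Fin.last k).succAbove) = Matrix.of fun a' b => D (I b) (fn g (a.castSucc.succAbove a')) := by
      intro a
      ext a' b
      simp [sn]
    simp only [h2]
    rw [h1, add_comm, sub_eq_add_neg, ← Finset.sum_neg_distrib]
    congr 1
    · simp [fn, sn, minorJ, ← two_mul, mul_comm]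
    · refine Finset.sum_congr rfl fun a _ => ?_
      simp only [Matrix.of_apply, fn, sn, Fin.snoc_last, Fin.snoc_castSucc, Fin.val_last,
        Fin.val_castSucc]
      ring

end minors

end WR

namespace WR

open Topology Filter

variable {n : ℕ}

/-- generators of an ideal of germs -/
noncomputable def gens (I : Ideal (Rn n)) : Finset (Rn n) :=
  ((isNoetherianRing_iff_ideal_fg (Rn n)).1 (rn_noeth n) I).choose

lemma span_gens (I : Ideal (Rn n)) : Ideal.span (gens I : Set (Rn n)) = I :=
  ((isNoetherianRing_iff_ideal_fg (Rn n)).1 (rn_noeth n) I).choose_spec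

/-- zero locus of an ideal -/
def VV (I : Ideal (Rn n)) : Set (Fin n → ℝ) := {x | ∀ f ∈ gens I, rep f x = 0}

lemma span_vanish (S : Finset (Rn n)) (h : Rn n) (hh : h ∈ Ideal.span (S : Set (Rn n))) :
    ∀ᶠ x in 𝓝 0, (∀ f ∈ S, rep f x = 0) → rep h x = 0 := by
  refine Submodule.span_induction (p := fun h _ => ∀ᶠ x in 𝓝 0, (∀ f ∈ S, rep f x = 0) → rep h x = 0)
    ?_ ?_ ?_ ?_ hh
  · intro f hf
    exact Eventually.of_forall fun x hx => hx f hf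
  · filter_upwards [rep_zero (n := n)] with x hx _ using hx
  · intro a b _ _ ha hb
    filter_upwards [ha, hb, rep_add a b] with x h1 h2 h3 hx
    rw [h3, h1 hx, h2 hx, add_zero]
  · intro c a _ ha
    filter_upwards [ha, rep_mul c a] with x h1 h2 hx
    rw [smul_eq_mul, h2, h1 hx, mul_zero]

lemma VV_vanish (I : Ideal (Rn n)) {h : Rn n} (hh : h ∈ I) :
    ∀ᶠ x in 𝓝 0, x ∈ VV I → rep h x = 0 :=
  span_vanish (gens I) h (by rwa [span_gens])

lemma VV_of_span (I : Ideal (Rn n)) (S : Finset (Rn n)) (h : I ≤ Ideal.span (S : Set (Rn n))) :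
    ∀ᶠ x in 𝓝 0, (∀ f ∈ S, rep f x = 0) → x ∈ VV I := by
  have : ∀ᶠ x in 𝓝 0, ∀ f ∈ gens I, (∀ f ∈ S, rep f x = 0) → rep f x = 0 := by
    rw [Filter.eventually_all_finset]
    intro f hf
    refine span_vanish S f (h ?_)
    have := Ideal.subset_span (s := (gens I : Set (Rn n))) hf
    rwa [span_gens] at this
  filter_upwards [this] with x hx hS f hf using hx f hf hS

/-- adding generators -/
lemma VV_sup (I : Ideal (Rn n)) (S : Finset (Rn n)) :
    ∀ᶠ x in 𝓝 0, x ∈ VV I → (∀ f ∈ S, rep f x = 0) → x ∈ VV (I ⊔ Ideal.span (S : Set (Rn n))) := by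
  classical
  have := VV_of_span (I ⊔ Ideal.span (S : Set (Rn n))) (gens I ∪ S) (by
    rw [Finset.coe_union, Ideal.span_union, span_gens])
  filter_upwards [this] with x hx h1 h2
  refine hx fun f hf => ?_
  rcases Finset.mem_union.1 hf with h | h
  · exact h1 f h
  · exact h2 f h

lemma VV_anti {I J : Ideal (Rn n)} (h : I ≤ J) : ∀ᶠ x in 𝓝 0, x ∈ VV J → x ∈ VV I :=
  VV_of_span I (gens J) (by rwa [span_gens])

lemma rep_bdd (a : Rn n) : ∃ C : ℝ, 0 ≤ C ∧ ∀ᶠ x in 𝓝 0, |rep a x| ≤ C := by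
  refine ⟨|rep a 0| + 1, by positivity, ?_⟩
  have : Tendsto (fun x => |rep a x|) (𝓝 0) (𝓝 |rep a 0|) := (rep_an a).continuousAt.abs
  filter_upwards [this.eventually (gt_mem_nhds (lt_add_one _))] with x hx using hx.le

/-- ideal of germs bounded by a multiple of a power of `B` -/
def bndI (B : (Fin n → ℝ) → ℝ) (_hB : ∀ x, 0 ≤ B x) (N : ℕ) : Ideal (Rn n) where
  carrier := {j | ∃ C : ℝ, 0 ≤ C ∧ ∀ᶠ x in 𝓝 0, |rep j x| ≤ C * B x ^ N}
  zero_mem' := ⟨0, le_rfl, by filter_upwards [rep_zero (n := n)] with x hx; rw [hx]; simp⟩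
  add_mem' := by
    rintro a b ⟨C1, h1, h1'⟩ ⟨C2, h2, h2'⟩
    refine ⟨C1 + C2, by positivity, ?_⟩
    filter_upwards [h1', h2', rep_add a b] with x e1 e2 e3
    rw [e3, add_mul]
    exact (abs_add_le _ _).trans (add_le_add e1 e2)
  smul_mem' := by
    rintro c a ⟨C1, h1, h1'⟩
    obtain ⟨C2, h2, h2'⟩ := rep_bdd c
    refine ⟨C2 * C1, by positivity, ?_⟩
    filter_upwards [h1', h2', rep_mul c a] with x e1 e2 e3
    rw [smul_eq_mul, e3, abs_mul, mul_assoc]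
    exact mul_le_mul e2 e1 (abs_nonneg _) h2

lemma bnd_pow (S : Set (Rn n)) (B : (Fin n → ℝ) → ℝ) (hB : ∀ x, 0 ≤ B x)
    (hS : ∀ s ∈ S, ∀ᶠ x in 𝓝 0, |rep s x| ≤ B x) (N : ℕ) :
    Ideal.span S ^ N ≤ bndI B hB N := by
  induction N with
  | zero =>
    intro j _
    obtain ⟨C, h, h'⟩ := rep_bdd j
    exact ⟨C, h, by simpa using h'⟩
  | succ N ih =>
    have hle1 : Ideal.span S ≤ bndI B hB 1 := by
      rw [Ideal.span_le]
      intro s hs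
      exact ⟨1, zero_le_one, by simpa using hS s hs⟩
    rw [pow_succ, Ideal.mul_le]
    intro a ha b hb
    obtain ⟨C1, h1, h1'⟩ := ih ha
    obtain ⟨C2, h2, h2'⟩ := hle1 hb
    refine ⟨C1 * C2, by positivity, ?_⟩
    filter_upwards [h1', h2', rep_mul a b] with x e1 e2 e3
    have := hB x
    rw [e3, abs_mul]
    calc _ ≤ (C1 * B x ^ N) * (C2 * B x ^ 1) := mul_le_mul e1 e2 (abs_nonneg _) (by positivity)
      _ = _ := by ring

/-- real number step of the inequality -/
lemma loj_real (N : ℕ) (hN : 1 ≤ N) (C a g U : ℝ) (hC : 0 ≤ C) (hU : 0 ≤ U)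
    (hsmall : C * |g| * 2 ^ N < 1) (h : (a * |g|) ^ N ≤ |g| * (C * (a * |g| + U) ^ N)) (ha : 0 ≤ a) :
    a * |g| ≤ (C * 2 ^ N + 1) * |g| ^ (1 / (N : ℝ)) * U := by
  have hg := abs_nonneg g
  set G := |g|
  have hN0 : N ≠ 0 := by omega
  by_cases hcase : a * G ≤ U
  · have h1 : (a * G) ^ N ≤ (C * 2 ^ N) * G * U ^ N := by
      calc _ ≤ G * (C * (a * G + U) ^ N) := h
        _ ≤ G * (C * (2 * U) ^ N) := by gcongr; linarith
        _ = _ := by rw [mul_pow]; ring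
    have h2 : ((C * 2 ^ N + 1) * G ^ (1 / (N : ℝ)) * U) ^ N = (C * 2 ^ N + 1) ^ N * G * U ^ N := by
      rw [mul_pow, mul_pow]
      congr 2
      rw [one_div, Real.rpow_inv_natCast_pow hg hN0]
    refine le_of_pow_le_pow_left₀ hN0 (by positivity) ?_
    rw [h2]
    refine h1.trans ?_
    have h3 : C * 2 ^ N ≤ (C * 2 ^ N + 1) ^ N := by
      have : C * 2 ^ N + 1 ≤ (C * 2 ^ N + 1) ^ N := le_self_pow₀ (by
        have : 0 ≤ C * 2 ^ N := by positivity
        linarith) hN0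
      linarith
    gcongr
  · push Not at hcase
    have hpos : 0 < a * G := lt_of_le_of_lt hU hcase
    exfalso
    have h1 : (a * G) ^ N ≤ (C * G * 2 ^ N) * (a * G) ^ N := by
      calc _ ≤ G * (C * (a * G + U) ^ N) := h
        _ ≤ G * (C * (2 * (a * G)) ^ N) := by gcongr; linarith
        _ = _ := by rw [mul_pow]; ring
    have h2 : 0 < (a * G) ^ N := by positivity
    nlinarith

lemma loj_one (P : Ideal (Rn n)) (hP : P.IsPrime) (g δ : Rn n) (hg : g ∉ P) (hg0 : rep g 0 = 0)
    (u : Fin n → Rn n) (k : ℕ) (F c : Fin k → Rn n) (hF : ∀ j, F j ∈ P)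
    (hu : ∀ i, u i = δ * pD i g - ∑ j, c j * pD i (F j)) :
    ∃ N : ℕ, 1 ≤ N ∧ ∃ C : ℝ, 0 < C ∧ ∀ᶠ x in 𝓝 0, x ∈ VV P →
      |rep δ x| * |rep g x| ≤ C * |rep g x| ^ (1 / (N : ℝ)) * ∑ i, |rep (u i) x| := by
  by_cases hδ : δ ∈ P
  · refine ⟨1, le_rfl, 1, one_pos, ?_⟩
    filter_upwards [VV_vanish P hδ] with x hx hxP
    rw [hx hxP]
    simp only [abs_zero, zero_mul]
    positivity
  obtain ⟨N, hN, j, hj, hmem⟩ := loj_germ P hP g δ hg hδ u k F c hF hu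
  let B : (Fin n → ℝ) → ℝ := fun x => |rep δ x| * |rep g x| + ∑ i, |rep (u i) x|
  have hB : ∀ x, 0 ≤ B x := fun x => by positivity
  obtain ⟨C, hC, hCb⟩ := bnd_pow (insert (δ * g) (Set.range u)) B hB (by
    rintro s (rfl | ⟨i, rfl⟩)
    · filter_upwards [rep_mul δ g] with x hx
      rw [hx, abs_mul]
      have : 0 ≤ ∑ i, |rep (u i) x| := by positivity
      simp only [B]; linarith
    · refine Eventually.of_forall fun x => ?_
      have h1 : |rep (u i) x| ≤ ∑ i, |rep (u i) x| :=
        Finset.single_le_sum (f := fun i => |rep (u i) x|) (fun _ _ => abs_nonneg _)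
          (Finset.mem_univ i)
      have h2 : 0 ≤ |rep δ x| * |rep g x| := by positivity
      simp only [B]; linarith) N hj
  refine ⟨N, hN, C * 2 ^ N + 1, by positivity, ?_⟩
  have hsm : ∀ᶠ x in 𝓝 0, C * |rep g x| * 2 ^ N < 1 := by
    have : Tendsto (fun x => C * |rep g x| * 2 ^ N) (𝓝 0) (𝓝 (C * |rep g 0| * 2 ^ N)) :=
      (tendsto_const_nhds.mul (rep_an g).continuousAt.abs).mul tendsto_const_nhds
    rw [hg0, abs_zero, mul_zero, zero_mul] at this
    exact this.eventually (gt_mem_nhds one_pos)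
  filter_upwards [VV_vanish P hmem, hCb, hsm, rep_sub ((δ * g) ^ N) (g * j), rep_pow (δ * g) N,
    rep_mul δ g, rep_mul g j] with x h1 h2 h3 h4 h5 h6 h7 hxP
  refine loj_real N hN C _ (rep g x) _ hC (by positivity) h3 ?_ (abs_nonneg _)
  have h8 := h1 hxP
  rw [h4, h5, h6, h7, sub_eq_zero] at h8
  rw [← abs_mul, ← abs_pow, h8, abs_mul]
  exact mul_le_mul_of_nonneg_left (by rw [abs_mul]; exact h2) (abs_nonneg _)

/-- algebraic data for the flow -/
theorem flow_data (P : Ideal (Rn n)) (hP : P.IsPrime) (g : Rn n) (hg : g ∉ P) (hg0 : rep g 0 = 0) :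
    ∃ (a b : ℕ) (δ : Fin a → Rn n) (u : Fin b → Rn n) (vc : Fin b → Fin n → Rn n) (α C : ℝ),
      (∃ i, δ i ∉ P) ∧ (∀ j, ∀ f ∈ P, ∑ l, vc j l * pD l f ∈ P) ∧
      (∀ j, u j = ∑ l, vc j l * pD l g) ∧ (∀ j l, vc j l ∈ Ideal.span (Set.range δ)) ∧
      0 < α ∧ 0 < C ∧ ∀ᶠ x in 𝓝 0, x ∈ VV P → ∀ i,
        |rep (δ i) x| * |rep g x| ≤ C * |rep g x| ^ α * ∑ j, |rep (u j) x| := by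
  obtain ⟨k, F, δ, vc, hF, hδ, hv, hvδ, hc⟩ := minor_fields (pD (n := n)) P hP
  choose c hc using fun I => hc I g
  have key := fun I => loj_one P hP g (δ I) hg hg0 (fun i => ∑ l, vc I i l * pD l g) k F (c I) hF
    (hc I)
  choose N hN C hC hb using key
  let e1 := Fintype.equivFin (Fin k → Fin n)
  let e2 := Fintype.equivFin ((Fin k → Fin n) × Fin n)
  let Nt : ℕ := ∑ I, N I
  let Ct : ℝ := ∑ I, C I
  obtain ⟨I0, hI0⟩ := hδ
  have hNle : ∀ I, N I ≤ Nt := fun I =>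
    Finset.single_le_sum (f := N) (fun _ _ => Nat.zero_le _) (Finset.mem_univ I)
  have hCle : ∀ I, C I ≤ Ct := fun I =>
    Finset.single_le_sum (f := C) (fun I _ => (hC I).le) (Finset.mem_univ I)
  have hNt : 1 ≤ Nt := (hN I0).trans (hNle I0)
  refine ⟨_, _, fun i => δ (e1.symm i), fun j => ∑ l, vc (e2.symm j).1 (e2.symm j).2 l * pD l g,
    fun j => vc (e2.symm j).1 (e2.symm j).2, 1 / (Nt : ℝ), Ct, ⟨e1 I0, by simpa using hI0⟩,
    fun j => hv _ _, fun j => rfl, ?_, by positivity, (hC I0).trans_le (hCle I0), ?_⟩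
  · intro j l
    have : Set.range (fun i => δ (e1.symm i)) = Set.range δ := e1.symm.surjective.range_comp δ
    rw [this]; exact hvδ _ _ _
  · have hsm : ∀ᶠ x in 𝓝 0, |rep g x| ≤ 1 := by
      have : Tendsto (fun x => |rep g x|) (𝓝 0) (𝓝 (|rep g 0|)) := (rep_an g).continuousAt.abs
      rw [hg0, abs_zero] at this
      filter_upwards [this.eventually (gt_mem_nhds one_pos)] with x hx using hx.le
    have hall : ∀ᶠ x in 𝓝 0, ∀ I, x ∈ VV P → |rep (δ I) x| * |rep g x| ≤
        C I * |rep g x| ^ (1 / (N I : ℝ)) * ∑ i, |rep (∑ l, vc I i l * pD l g) x| :=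
      Filter.eventually_all.2 hb
    filter_upwards [hall, hsm] with x h1 h2 hxP i
    refine (h1 (e1.symm i) hxP).trans ?_
    set I := e1.symm i
    have h3 : |rep g x| ^ (1 / (N I : ℝ)) ≤ |rep g x| ^ (1 / (Nt : ℝ)) := by
      rcases (abs_nonneg (rep g x)).eq_or_lt with h0 | h0
      · rw [← h0, Real.zero_rpow, Real.zero_rpow]
        · positivity
        · have := hN I; positivity
      · refine Real.rpow_le_rpow_of_exponent_ge h0 h2 ?_
        have := hN I
        exact one_div_le_one_div_of_le (by positivity) (by exact_mod_cast hNle I)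
    have h4 : ∑ i, |rep (∑ l, vc I i l * pD l g) x| ≤
        ∑ j, |rep (∑ l, vc (e2.symm j).1 (e2.symm j).2 l * pD l g) x| := by
      rw [Equiv.sum_comp e2.symm (fun q => |rep (∑ l, vc q.1 q.2 l * pD l g) x|),
        Fintype.sum_prod_type]
      exact Finset.single_le_sum (f := fun I => ∑ i, |rep (∑ l, vc I i l * pD l g) x|)
        (fun _ _ => by positivity) (Finset.mem_univ I)
    have h5 := (hC I).le
    have h6 := hCle I
    have h7 : 0 ≤ Ct := h5.trans h6
    have h8 := Real.rpow_nonneg (abs_nonneg (rep g x)) (1 / (Nt : ℝ))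
    have h9 := Real.rpow_nonneg (abs_nonneg (rep g x)) (1 / (N I : ℝ))
    refine mul_le_mul (mul_le_mul h6 h3 h9 h7) h4 ?_ (mul_nonneg h7 h8)
    positivity

end WR

namespace WR

open Topology Filter Set

section join

variable {E : Type*} [NormedAddCommGroup E]

/-- `x` and `y` can be joined inside `Z` by a path of length at most `ℓ` -/
def JoinLen (Z : Set E) (x y : E) (ℓ : ℝ) : Prop :=
  ∃ γ : ℝ → E, ContinuousOn γ (Icc 0 1) ∧ γ 0 = x ∧ γ 1 = y ∧ (∀ t ∈ Icc (0 : ℝ) 1, γ t ∈ Z) ∧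
    eVariationOn γ (Icc 0 1) ≤ ENNReal.ofReal ℓ

lemma JoinLen.refl {Z : Set E} {x : E} (hx : x ∈ Z) (ℓ : ℝ) : JoinLen Z x x ℓ := by
  refine ⟨fun _ => x, continuousOn_const, rfl, rfl, fun _ _ => hx, ?_⟩
  rw [eVariationOn.constant_on]
  · exact bot_le
  · rintro a ⟨_, _, rfl⟩ b ⟨_, _, rfl⟩; rfl

lemma JoinLen.mono {Z Z' : Set E} {x y : E} {ℓ ℓ' : ℝ} (h : JoinLen Z x y ℓ) (hZ : Z ⊆ Z')
    (hl : ℓ ≤ ℓ') : JoinLen Z' x y ℓ' := by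
  obtain ⟨γ, h1, h2, h3, h4, h5⟩ := h
  exact ⟨γ, h1, h2, h3, fun t ht => hZ (h4 t ht), h5.trans (ENNReal.ofReal_le_ofReal hl)⟩

lemma JoinLen.symm {Z : Set E} {x y : E} {ℓ : ℝ} (h : JoinLen Z x y ℓ) : JoinLen Z y x ℓ := by
  obtain ⟨γ, h1, h2, h3, h4, h5⟩ := h
  have hm : ∀ t ∈ Icc (0 : ℝ) 1, 1 - t ∈ Icc (0 : ℝ) 1 := fun t ht => ⟨by linarith [ht.2], by linarith [ht.1]⟩
  refine ⟨γ ∘ fun t => 1 - t, h1.comp (by fun_prop) hm, by simp [h3], by simp [h2],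
    fun t ht => h4 _ (hm t ht), ?_⟩
  refine (eVariationOn.comp_le_of_antitoneOn γ (fun t => 1 - t) ?_ hm).trans h5
  intro a _ b _ hab
  simp only; linarith

lemma JoinLen.dist_le {Z : Set E} {x y : E} {ℓ : ℝ} (h : JoinLen Z x y ℓ) (hl : 0 ≤ ℓ) :
    ∃ γ : ℝ → E, ContinuousOn γ (Icc 0 1) ∧ γ 0 = x ∧ γ 1 = y ∧ (∀ t ∈ Icc (0 : ℝ) 1, γ t ∈ Z) ∧
    eVariationOn γ (Icc 0 1) ≤ ENNReal.ofReal ℓ ∧ ∀ t ∈ Icc (0 : ℝ) 1, dist (γ t) x ≤ ℓ := by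
  obtain ⟨γ, h1, h2, h3, h4, h5⟩ := h
  refine ⟨γ, h1, h2, h3, h4, h5, fun t ht => ?_⟩
  have := (eVariationOn.edist_le γ ht (left_mem_Icc.2 zero_le_one)).trans h5
  rw [h2, edist_dist] at this
  exact (ENNReal.ofReal_le_ofReal_iff hl).1 this

/-- short paths remain in neighborhoods -/
lemma JoinLen.restrict {Z Z' : Set E} {x y : E} {ℓ : ℝ} (h : JoinLen Z x y ℓ) (hl : 0 ≤ ℓ)
    (hZ : ∀ z ∈ Z, dist z x ≤ ℓ → z ∈ Z') : JoinLen Z' x y ℓ := by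
  obtain ⟨γ, h1, h2, h3, h4, h5, h6⟩ := h.dist_le hl
  exact ⟨γ, h1, h2, h3, fun t ht => hZ _ (h4 t ht) (h6 t ht), h5⟩

lemma JoinLen.mem {Z : Set E} {x y : E} {ℓ : ℝ} (h : JoinLen Z x y ℓ) : y ∈ Z := by
  obtain ⟨γ, h1, h2, h3, h4, h5⟩ := h
  exact h3 ▸ h4 1 (right_mem_Icc.2 zero_le_one)

lemma JoinLen.dist_end {Z : Set E} {x y : E} {ℓ : ℝ} (h : JoinLen Z x y ℓ) (hl : 0 ≤ ℓ) :
    dist y x ≤ ℓ := by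
  obtain ⟨γ, h1, h2, h3, h4, h5, h6⟩ := h.dist_le hl
  exact h3 ▸ h6 1 (right_mem_Icc.2 zero_le_one)

lemma JoinLen.trans {Z : Set E} {x y z : E} {ℓ ℓ' : ℝ} (h : JoinLen Z x y ℓ) (h' : JoinLen Z y z ℓ')
    (hl : 0 ≤ ℓ) (hl' : 0 ≤ ℓ') : JoinLen Z x z (ℓ + ℓ') := by
  obtain ⟨γ, h1, h2, h3, h4, h5⟩ := h
  obtain ⟨η, k1, k2, k3, k4, k5⟩ := h'
  have hm1 : ∀ t ∈ Icc (0 : ℝ) (1/2), 2 * t ∈ Icc (0 : ℝ) 1 :=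
    fun t ht => ⟨by linarith [ht.1], by linarith [ht.2]⟩
  have hm2 : ∀ t ∈ Icc (1/2 : ℝ) 1, 2 * t - 1 ∈ Icc (0 : ℝ) 1 :=
    fun t ht => ⟨by linarith [ht.1], by linarith [ht.2]⟩
  let σ : ℝ → E := fun t => if t ≤ 1/2 then γ (2 * t) else η (2 * t - 1)
  have e1 : EqOn σ (γ ∘ fun t => 2 * t) (Icc 0 (1/2)) := fun t ht => by
    have := ht.2
    simp [σ, show t ≤ 2⁻¹ by linarith]
  have e2 : EqOn σ (η ∘ fun t => 2 * t - 1) (Icc (1/2) 1) := fun t ht => by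
    by_cases hh : t ≤ 1/2
    · have : t = 1/2 := le_antisymm hh ht.1
      subst this
      simp only [σ, Function.comp, le_refl, if_true]
      norm_num [h3, k2]
    · simp only [σ, Function.comp, if_neg hh]
  have hu : Icc (0 : ℝ) 1 = Icc 0 (1/2) ∪ Icc (1/2) 1 :=
    (Icc_union_Icc_eq_Icc (by norm_num) (by norm_num)).symm
  refine ⟨σ, ?_, ?_, ?_, ?_, ?_⟩
  · rw [hu]
    refine ContinuousOn.union_of_isClosed ?_ ?_ isClosed_Icc isClosed_Icc
    · exact (h1.comp (by fun_prop) hm1).congr e1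
    · exact (k1.comp (by fun_prop) hm2).congr e2
  · rw [e1 ⟨le_rfl, by norm_num⟩]; simp [h2]
  · rw [e2 ⟨by norm_num, le_rfl⟩]; norm_num [k3]
  · intro t ht
    rw [hu] at ht
    rcases ht with ht | ht
    · rw [e1 ht]; exact h4 _ (hm1 t ht)
    · rw [e2 ht]; exact k4 _ (hm2 t ht)
  · have := eVariationOn.Icc_add_Icc σ (s := univ) (a := 0) (b := 1/2) (c := 1) (by norm_num)
      (by norm_num) (mem_univ _)
    simp only [univ_inter] at this
    rw [← this, ENNReal.ofReal_add hl hl', eVariationOn.eq_of_eqOn e1, eVariationOn.eq_of_eqOn e2]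
    refine add_le_add (le_trans ?_ h5) (le_trans ?_ k5)
    · exact eVariationOn.comp_le_of_monotoneOn γ _ (fun a _ b _ hab => by linarith) hm1
    · exact eVariationOn.comp_le_of_monotoneOn η _ (fun a _ b _ hab => by linarith) hm2

/-- image under Lipschitz maps -/
lemma JoinLen.image {F : Type*} [NormedAddCommGroup F] {Z : Set E} {Z' : Set F} {x y : E} {ℓ : ℝ}
    (h : JoinLen Z x y ℓ) {φ : E → F} {K : NNReal} (hφ : LipschitzWith K φ)
    (hZ : ∀ z ∈ Z, φ z ∈ Z') : JoinLen Z' (φ x) (φ y) (K * ℓ) := by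
  obtain ⟨γ, h1, h2, h3, h4, h5⟩ := h
  refine ⟨φ ∘ γ, hφ.continuous.comp_continuousOn h1, by simp [h2], by simp [h3],
    fun t ht => hZ _ (h4 t ht), ?_⟩
  refine (hφ.lipschitzOnWith (s := univ).comp_eVariationOn_le (mapsTo_univ _ _)).trans ?_
  rw [ENNReal.ofReal_mul (by positivity), ENNReal.ofReal_coe_nnreal]
  gcongr

lemma evar_le_of_dist (σ : ℝ → E) (φ : ℝ → ℝ) (hφ : AntitoneOn φ (Icc 0 1))
    (h : ∀ s ∈ Icc (0 : ℝ) 1, ∀ t ∈ Icc (0 : ℝ) 1, s ≤ t → dist (σ s) (σ t) ≤ φ s - φ t) :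
    eVariationOn σ (Icc 0 1) ≤ ENNReal.ofReal (φ 0 - φ 1) := by
  refine iSup_le ?_
  rintro ⟨m, ⟨u, hu, hus⟩⟩
  calc ∑ i ∈ Finset.range m, edist (σ (u (i + 1))) (σ (u i))
      ≤ ∑ i ∈ Finset.range m, ENNReal.ofReal (φ (u i) - φ (u (i + 1))) := by
        refine Finset.sum_le_sum fun i _ => ?_
        rw [edist_comm, edist_dist]
        exact ENNReal.ofReal_le_ofReal (h _ (hus _) _ (hus _) (hu (Nat.le_succ i)))
    _ = ENNReal.ofReal (∑ i ∈ Finset.range m, (φ (u i) - φ (u (i + 1)))) := by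
        rw [ENNReal.ofReal_sum_of_nonneg]
        intro i _
        exact sub_nonneg.2 (hφ (hus _) (hus _) (hu (Nat.le_succ i)))
    _ ≤ _ := by
        refine ENNReal.ofReal_le_ofReal ?_
        rw [Finset.sum_range_sub']
        have a1 := hφ (left_mem_Icc.2 zero_le_one) (hus 0) (hus 0).1
        have a2 := hφ (hus m) (right_mem_Icc.2 zero_le_one) (hus m).2
        linarith

lemma join_limit [CompleteSpace E] (γ : ℝ → E) (hγ : Continuous γ) (ψ : ℝ → ℝ) (hψ : ∀ t, 0 ≤ ψ t)
    (h : ∀ s t, 0 ≤ s → s ≤ t → dist (γ s) (γ t) ≤ ψ s - ψ t) (Z : Set E) (hZ : IsClosed Z)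
    (hm : ∀ t, 0 ≤ t → γ t ∈ Z) :
    ∃ w, Tendsto γ atTop (𝓝 w) ∧ JoinLen Z (γ 0) w (ψ 0) := by
  have hanti : ∀ s t, 0 ≤ s → s ≤ t → ψ t ≤ ψ s := fun s t hs hst => by
    have := dist_nonneg.trans (h s t hs hst); linarith
  -- limit of ψ
  have hψlim : ∃ l, Tendsto ψ atTop (𝓝 l) := by
    have : Antitone fun t => ψ (max t 0) := fun s t hst =>
      hanti _ _ (le_max_right _ _) (max_le_max_right _ hst)
    refine ⟨_, (tendsto_atTop_ciInf this ⟨0, ?_⟩).congr' ?_⟩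
    · rintro _ ⟨t, rfl⟩; exact hψ _
    · filter_upwards [eventually_ge_atTop 0] with t ht
      rw [max_eq_left ht]
  obtain ⟨l, hl⟩ := hψlim
  have hcau : Cauchy (map γ atTop) := by
    rw [Metric.cauchy_iff]
    refine ⟨inferInstance, fun ε hε => ?_⟩
    have := Metric.cauchy_iff.1 hl.cauchy_map
    obtain ⟨t, ht, htε⟩ := this.2 ε hε
    obtain ⟨T, hT⟩ := mem_atTop_sets.1 (mem_map.1 ht)
    refine ⟨γ '' Ici (max T 0), image_mem_map (Ici_mem_atTop _), ?_⟩
    have key : ∀ a b, max T 0 ≤ a → a ≤ b → dist (γ a) (γ b) < ε := fun a b ha hab => by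
      have hTa := (le_max_left T 0).trans ha
      have := htε _ (hT a hTa) _ (hT b (hTa.trans hab))
      rw [Real.dist_eq] at this
      exact (h a b ((le_max_right _ _).trans ha) hab).trans_lt ((le_abs_self _).trans_lt this)
    rintro _ ⟨a, ha, rfl⟩ _ ⟨b, hb, rfl⟩
    rcases le_total a b with hab | hab
    · exact key a b ha hab
    · rw [dist_comm]; exact key b a hb hab
  obtain ⟨w, hw⟩ := CompleteSpace.complete hcau
  have hw : Tendsto γ atTop (𝓝 w) := hw
  refine ⟨w, hw, ?_⟩
  have hdw : ∀ s, 0 ≤ s → dist (γ s) w ≤ ψ s := fun s hs => by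
    refine le_of_tendsto (tendsto_const_nhds.dist hw) ?_
    filter_upwards [eventually_ge_atTop s] with t ht
    linarith [h s t hs ht, hψ t]
  have hwZ : w ∈ Z := hZ.mem_of_tendsto hw (by
    filter_upwards [eventually_ge_atTop 0] with t ht using hm t ht)
  let τ : ℝ → ℝ := fun t => t / (1 - t)
  have hτ0 : ∀ t, 0 ≤ t → t < 1 → 0 ≤ τ t := fun t h0 h1 => div_nonneg h0 (by linarith)
  have hτm : ∀ s t, 0 ≤ s → s ≤ t → t < 1 → τ s ≤ τ t := fun s t h0 hst h1 =>
    div_le_div₀ (h0.trans hst) hst (by linarith) (by linarith)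
  have hτt : Tendsto τ (𝓝[<] 1) atTop := by
    have h1 : Tendsto (fun t : ℝ => 1 - t) (𝓝[<] 1) (𝓝[>] 0) := by
      refine tendsto_nhdsWithin_iff.2 ⟨?_, ?_⟩
      · refine Tendsto.mono_left ?_ nhdsWithin_le_nhds
        have : ContinuousAt (fun t : ℝ => 1 - t) 1 := by fun_prop
        simpa [ContinuousAt] using this
      · filter_upwards [self_mem_nhdsWithin] with t ht
        simpa using ht
    have h2 : Tendsto (fun t : ℝ => t) (𝓝[<] 1) (𝓝 1) := nhdsWithin_le_nhds
    exact h2.pos_mul_atTop one_pos (tendsto_inv_nhdsGT_zero.comp h1)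
  let σ : ℝ → E := fun t => if t < 1 then γ (τ t) else w
  let φ : ℝ → ℝ := fun t => if t < 1 then ψ (τ t) else 0
  have hd : ∀ s ∈ Icc (0 : ℝ) 1, ∀ t ∈ Icc (0 : ℝ) 1, s ≤ t → dist (σ s) (σ t) ≤ φ s - φ t := by
    intro s hs t ht hst
    by_cases h1 : t < 1
    · have hs1 := hst.trans_lt h1
      simp only [σ, φ, if_pos h1, if_pos hs1]
      exact h _ _ (hτ0 s hs.1 hs1) (hτm s t hs.1 hst h1)
    · by_cases h2 : s < 1
      · simp only [σ, φ, if_neg h1, if_pos h2, sub_zero]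
        exact hdw _ (hτ0 s hs.1 h2)
      · simp [σ, φ, if_neg h1, if_neg h2]
  have hφ : AntitoneOn φ (Icc 0 1) := fun s hs t ht hst => by
    have := dist_nonneg.trans (hd s hs t ht hst); linarith
  refine ⟨σ, ?_, by simp [σ, τ], by simp [σ], ?_, ?_⟩
  · intro t ht
    rcases ht.2.lt_or_eq with h1 | rfl
    · have : ContinuousAt (fun t => γ (τ t)) t :=
        hγ.continuousAt.comp (f := τ) (continuousAt_id.div (by fun_prop) (by simp; linarith))
      refine (this.congr ?_).continuousWithinAt
      filter_upwards [gt_mem_nhds h1] with s hs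
      simp [σ, hs]
    · have hσ1 : σ 1 = w := by simp [σ]
      have hIio : ContinuousWithinAt σ (Iio 1) 1 := by
        rw [ContinuousWithinAt, hσ1]
        refine (hw.comp hτt).congr' ?_
        filter_upwards [self_mem_nhdsWithin] with s hs
        have hs : s < 1 := hs
        simp [σ, hs]
      exact (continuousWithinAt_Iio_iff_Iic.1 hIio).mono fun s hs => hs.2
  · intro t ht
    by_cases h1 : t < 1
    · simp only [σ, if_pos h1]; exact hm _ (hτ0 t ht.1 h1)
    · simp only [σ, if_neg h1]; exact hwZ
  · have := evar_le_of_dist σ φ hφ hd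
    simpa [φ, τ] using this

end join

section flow

variable {E : Type*} [NormedAddCommGroup E] [NormedSpace ℝ E] [CompleteSpace E]

lemma global_flow (V : E → E) (K L : NNReal) (hK : LipschitzWith K V) (hL : ∀ x, ‖V x‖ ≤ L) (x : E) :
    ∃ γ : ℝ → E, γ 0 = x ∧ ∀ t, HasDerivAt γ (V (γ t)) t := by
  have hloc : ∀ T : ℝ, ∃ γ : ℝ → E, γ 0 = x ∧ ∀ t ∈ Ioo (-T) T, HasDerivAt γ (V (γ t)) t := by
    intro T
    by_cases hT : 0 ≤ T
    · have hpl : IsPicardLindelof (fun _ => V) (tmin := -T) (tmax := T) ⟨0, by simp [hT]⟩ x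
          (L * ⟨T, hT⟩) 0 L K :=
        IsPicardLindelof.of_time_independent (fun y _ => hL y) hK.lipschitzOnWith (by simp; exact le_rfl)
      obtain ⟨γ, h1, h2⟩ := hpl.exists_eq_forall_mem_Icc_hasDerivWithinAt₀
      refine ⟨γ, h1, fun t ht => (h2 t (Ioo_subset_Icc_self ht)).hasDerivAt (Icc_mem_nhds ht.1 ht.2)⟩
    · exact ⟨fun _ => x, rfl, fun t ht => absurd (ht.1.trans ht.2) (by linarith)⟩
  choose γ h0 hd using hloc
  have huniq : ∀ T T' t, t ∈ Ioo (-T) T → T ≤ T' → γ T t = γ T' t := by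
    intro T T' t ht hTT
    have hT : 0 < T := by linarith [ht.1, ht.2]
    refine ODE_solution_unique_of_mem_Ioo (v := fun _ => V) (s := fun _ => univ) (K := K)
      (a := -T) (b := T) (t₀ := 0) (fun _ _ => hK.lipschitzOnWith) ⟨by linarith, hT⟩
      (fun s hs => ⟨hd T s hs, trivial⟩) (fun s hs => ⟨hd T' s ⟨by linarith [hs.1], by linarith [hs.2]⟩, trivial⟩)
      (by rw [h0, h0]) ht
  have hin : ∀ t : ℝ, t ∈ Ioo (-(|t| + 1)) (|t| + 1) := fun t => by
    have h1 := neg_abs_le t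
    have h2 := le_abs_self t
    exact ⟨by linarith, by linarith⟩
  have hmain : ∀ T t, t ∈ Ioo (-T) T → γ (|t| + 1) t = γ T t := by
    intro T t ht
    rcases le_total (|t| + 1) T with h | h
    · exact huniq _ _ t (hin t) h
    · exact (huniq _ _ t ht h).symm
  refine ⟨fun t => γ (|t| + 1) t, h0 _, fun t => ?_⟩
  have := hd (|t| + 1) t (hin t)
  refine this.congr_of_eventuallyEq ?_
  filter_upwards [Ioo_mem_nhds (hin t).1 (hin t).2] with s hs
  exact hmain _ s hs

theorem flow_lemma {ι : Type*} [Fintype ι] (V : E → E) (K L : NNReal) (hK : LipschitzWith K V)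
    (hL : ∀ x, ‖V x‖ ≤ L) (ρ : ℝ) (hV0 : ∀ x, x ∉ Metric.closedBall (0 : E) ρ → V x = 0)
    (f : ι → E → ℝ) (hf : ∀ a, ∀ x ∈ Metric.closedBall (0 : E) ρ, DifferentiableAt ℝ (f a) x)
    (M : ℝ) (hfM : ∀ a, ∀ x ∈ Metric.closedBall (0 : E) ρ, |fderiv ℝ (f a) x (V x)| ≤ M * ∑ b, |f b x|)
    (g : E → ℝ) (hg : ∀ x ∈ Metric.closedBall (0 : E) ρ, DifferentiableAt ℝ g x)
    (S : E → ℝ) (hS : ContinuousOn S (Metric.closedBall (0 : E) ρ)) (hS0 : ∀ x, 0 ≤ S x)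
    (hgS : ∀ x ∈ Metric.closedBall (0 : E) ρ, fderiv ℝ g x (V x) = - S x * g x)
    (C α : ℝ) (hC : 0 < C) (hα : 0 < α)
    (hVS : ∀ x ∈ Metric.closedBall (0 : E) ρ, (∀ a, f a x = 0) → ‖V x‖ ≤ C * |g x| ^ α * S x)
    (w : E) (hw : w ∈ Metric.closedBall (0 : E) ρ) (hfw : ∀ a, f a w = 0) :
    ∃ w1, JoinLen {x | x ∈ Metric.closedBall (0 : E) ρ ∧ ∀ a, f a x = 0} w w1 (C / α * |g w| ^ α) ∧
      V w1 = 0 ∧ |g w1| ≤ |g w| := by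
  obtain ⟨γ, h0, hd⟩ := global_flow V K L hK hL w
  have hγc : Continuous γ := continuous_iff_continuousAt.2 fun t => (hd t).continuousAt
  have hγB : ∀ t, γ t ∈ Metric.closedBall (0 : E) ρ := by
    intro t
    by_contra hcon
    have hVt := hV0 _ hcon
    have : γ = fun _ => γ t :=
      ODE_solution_unique_univ (v := fun _ => V) (s := fun _ => univ) (K := K) (t₀ := t)
        (fun _ => hK.lipschitzOnWith) (fun s => ⟨hd s, trivial⟩)
        (fun s => ⟨by simpa [hVt] using hasDerivAt_const s (γ t), trivial⟩) rfl
    have h1 : γ 0 = γ t := congrFun this 0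
    exact hcon (h1 ▸ h0 ▸ hw)
  -- the functions `f` vanish along the curve
  have hfd : ∀ a t, HasDerivAt (fun t => f a (γ t)) (fderiv ℝ (f a) (γ t) (V (γ t))) t := fun a t =>
    (hf a _ (hγB t)).hasFDerivAt.comp_hasDerivAt t (hd t)
  have hf0 : ∀ t, 0 ≤ t → ∀ a, f a (γ t) = 0 := by
    intro t ht
    let F : ℝ → ι → ℝ := fun t a => f a (γ t)
    have hFd : ∀ t, HasDerivAt F (fun a => fderiv ℝ (f a) (γ t) (V (γ t))) t := fun t =>
      hasDerivAt_pi.2 fun a => hfd a t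
    have := eq_zero_of_abs_deriv_le_mul_abs_self_of_eq_zero_right (f := F)
      (f' := fun t a => fderiv ℝ (f a) (γ t) (V (γ t))) (K := |M| * Fintype.card ι) (a := 0) (b := t)
      (fun s _ => (hFd s).continuousAt.continuousWithinAt) (fun s _ => (hFd s).hasDerivWithinAt)
      (by ext a; simp [F, h0, hfw]) (fun s _ => by
        refine (pi_norm_le_iff_of_nonneg (by positivity)).2 fun a => ?_
        rw [Real.norm_eq_abs]
        refine (hfM a _ (hγB s)).trans ?_
        have h1 : ∑ b, |f b (γ s)| ≤ Fintype.card ι * ‖F s‖ := by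
          refine (Finset.sum_le_card_nsmul _ _ ‖F s‖ fun b _ => ?_).trans ?_
          · exact norm_le_pi_norm (F s) b
          · simp
        have h2 : 0 ≤ ∑ b, |f b (γ s)| := by positivity
        calc M * ∑ b, |f b (γ s)| ≤ |M| * ∑ b, |f b (γ s)| := by gcongr; exact le_abs_self M
          _ ≤ |M| * (Fintype.card ι * ‖F s‖) := by gcongr
          _ = _ := by ring) t ⟨ht, le_rfl⟩
    intro a
    exact congrFun this a
  have hSc : Continuous fun t => S (γ t) := hS.comp_continuous hγc hγB
  let A : ℝ → ℝ := fun t => ∫ s in (0 : ℝ)..t, S (γ s)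
  have hAd : ∀ t, HasDerivAt A (S (γ t)) t := fun t => hSc.integral_hasStrictDerivAt 0 t |>.hasDerivAt
  have hA0 : A 0 = 0 := by simp [A]
  have hgd : ∀ t, HasDerivAt (fun t => g (γ t)) (- S (γ t) * g (γ t)) t := fun t => by
    rw [← hgS _ (hγB t)]
    exact (hg _ (hγB t)).hasFDerivAt.comp_hasDerivAt t (hd t)
  have hgA : ∀ t, g (γ t) = g w * Real.exp (- A t) := by
    have hz : ∀ t, HasDerivAt (fun t => g (γ t) * Real.exp (A t)) 0 t := fun t => by
      refine ((hgd t).mul (hAd t).exp).congr_deriv ?_; ring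
    intro t
    have h1 := is_const_of_deriv_eq_zero (fun t => (hz t).differentiableAt) (fun t => (hz t).deriv) t 0
    simp only [h0, hA0, Real.exp_zero, mul_one] at h1
    rw [← h1, mul_assoc, ← Real.exp_add]; simp
  have hAnn : ∀ t, 0 ≤ t → 0 ≤ A t := fun t ht =>
    intervalIntegral.integral_nonneg ht fun s _ => hS0 _
  let ψ : ℝ → ℝ := fun t => C / α * |g w| ^ α * Real.exp (- (α * A t))
  have hψ0 : ∀ t, 0 ≤ ψ t := fun t => by positivity
  have hψd : ∀ t, HasDerivAt ψ (- (C * |g (γ t)| ^ α * S (γ t))) t := fun t => by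
    have h1 := (((hAd t).const_mul α).neg.exp).const_mul (C / α * |g w| ^ α)
    refine HasDerivAt.congr_deriv h1 ?_
    rw [hgA t, abs_mul, Real.abs_exp, Real.mul_rpow (abs_nonneg _) (Real.exp_pos _).le,
      ← Real.exp_mul, show - A t * α = - (α * A t) by ring]
    simp only [Pi.neg_apply]
    field_simp
  have hdist : ∀ s t, 0 ≤ s → s ≤ t → dist (γ s) (γ t) ≤ ψ s - ψ t := by
    intro s t hs hst
    have := image_norm_le_of_norm_deriv_right_le_deriv_boundary' (f := fun x => γ x - γ s)
      (f' := fun x => V (γ x)) (a := s) (b := t) (B := fun x => ψ s - ψ x)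
      (B' := fun x => C * |g (γ x)| ^ α * S (γ x))
      (by fun_prop) (fun x _ => ((hd x).sub_const _).hasDerivWithinAt) (by simp)
      (fun x _ => (continuousAt_const.sub (hψd x).continuousAt).continuousWithinAt)
      (fun x _ => by simpa using ((hψd x).const_sub (ψ s)).hasDerivWithinAt)
      (fun x hx => hVS _ (hγB x) (hf0 x (hs.trans hx.1))) (x := t) ⟨hst, le_rfl⟩
    rw [dist_comm, dist_eq_norm]
    exact this
  obtain ⟨w1, hlim, hj⟩ := join_limit γ hγc ψ hψ0 hdist
    (closure {x | x ∈ Metric.closedBall (0 : E) ρ ∧ ∀ a, f a x = 0}) isClosed_closure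
    (fun t ht => subset_closure ⟨hγB t, hf0 t ht⟩)
  have hcl : closure {x | x ∈ Metric.closedBall (0 : E) ρ ∧ ∀ a, f a x = 0} ⊆
      {x | x ∈ Metric.closedBall (0 : E) ρ ∧ ∀ a, f a x = 0} := by
    intro x hx
    have hxB : x ∈ Metric.closedBall (0 : E) ρ :=
      closure_minimal (fun y hy => hy.1) Metric.isClosed_closedBall hx
    refine ⟨hxB, fun a => ?_⟩
    have h1 := mem_closure_image (hf a x hxB).continuousAt hx
    have h2 : f a '' {x | x ∈ Metric.closedBall (0 : E) ρ ∧ ∀ a, f a x = 0} ⊆ {0} := by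
      rintro _ ⟨y, hy, rfl⟩; exact hy.2 a
    have h3 := closure_mono h2 h1
    simpa using h3
  refine ⟨w1, ?_, ?_, ?_⟩
  · rw [h0] at hj
    refine hj.mono hcl ?_
    simp [ψ, hA0]
  · by_contra hne
    have hpos : 0 < ‖V w1‖ := norm_pos_iff.2 hne
    have hVl : Tendsto (fun t => V (γ t)) atTop (𝓝 (V w1)) := (hK.continuous.tendsto w1).comp hlim
    have e1 : ∀ᶠ t in atTop, dist (V (γ t)) (V w1) < ‖V w1‖ / 2 :=
      hVl.eventually (Metric.ball_mem_nhds _ (by positivity))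
    have e2 : ∀ᶠ t in atTop, dist (γ t) w1 < ‖V w1‖ / 4 :=
      hlim.eventually (Metric.ball_mem_nhds _ (by positivity))
    obtain ⟨T, hT⟩ := eventually_atTop.1 (e1.and e2)
    have := norm_image_sub_le_of_norm_deriv_le_segment' (f := fun x => γ x - x • V w1)
      (f' := fun x => V (γ x) - (1 : ℝ) • V w1) (a := T) (b := T + 1) (C := ‖V w1‖ / 2)
      (fun x _ => ((hd x).sub ((hasDerivAt_id x).smul_const (V w1))).hasDerivWithinAt)
      (fun x hx => by rw [one_smul, ← dist_eq_norm]; exact (hT x hx.1).1.le) (T + 1)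
      ⟨by linarith, le_rfl⟩
    have h4 := (hT T le_rfl).2
    have h5 := (hT (T + 1) (by linarith)).2
    have h6 : V w1 = (γ (T + 1) - w1) - (γ T - w1) -
        (γ (T + 1) - (T + 1) • V w1 - (γ T - T • V w1)) := by
      rw [add_smul, one_smul]; abel
    have h7 : ‖V w1‖ ≤ ‖γ (T + 1) - w1‖ + ‖γ T - w1‖ +
        ‖γ (T + 1) - (T + 1) • V w1 - (γ T - T • V w1)‖ := by
      conv_lhs => rw [h6]
      exact (norm_sub_le _ _).trans (add_le_add_left (norm_sub_le _ _) _)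
    rw [dist_eq_norm] at h4 h5
    simp only [add_sub_cancel_left, mul_one] at this
    linarith
  · have hw1B : w1 ∈ Metric.closedBall (0 : E) ρ := (hcl hj.mem).1
    refine le_of_tendsto ((hg w1 hw1B).continuousAt.tendsto.comp hlim).abs ?_
    filter_upwards [eventually_ge_atTop 0] with t ht
    simp only [Function.comp]
    rw [hgA t, abs_mul, Real.abs_exp]
    have : Real.exp (- A t) ≤ 1 := Real.exp_le_one_iff.2 (by linarith [hAnn t ht])
    exact mul_le_of_le_one_right (abs_nonneg _) this

end flow

end WR

namespace WR

open Topology Filter Set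

/-- cutting off a vector field -/
lemma cutoff {E : Type*} [NormedAddCommGroup E] [NormedSpace ℝ E] [FiniteDimensional ℝ E]
    (W : E → E) (R : ℝ) (hR : 0 < R) (hW : ∀ x ∈ Metric.ball (0 : E) R, ContDiffAt ℝ 1 W x) :
    ∃ χ : E → ℝ, (∀ x, 0 ≤ χ x) ∧ Continuous χ ∧ (∀ x ∈ Metric.closedBall (0 : E) (R / 4), χ x = 1) ∧
      (∀ x, x ∉ Metric.closedBall (0 : E) (R / 2) → χ x = 0) ∧
      ∃ K L : NNReal, LipschitzWith K (fun x => χ x • W x) ∧ ∀ x, ‖χ x • W x‖ ≤ L := by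
  let χ : ContDiffBump (0 : E) := ⟨R / 4, R / 2, by positivity, by linarith⟩
  have h0 : ∀ x, x ∉ Metric.closedBall (0 : E) (R / 2) → χ x = 0 := fun x hx => by
    refine χ.zero_of_le_dist ?_
    rw [Metric.mem_closedBall, not_le] at hx
    exact hx.le
  have hcd : ContDiff ℝ 1 (fun x => χ x • W x) := by
    rw [contDiff_iff_contDiffAt]
    intro x
    by_cases hx : x ∈ Metric.closedBall (0 : E) (R / 2)
    · exact χ.contDiff.contDiffAt.smul (hW x (Metric.closedBall_subset_ball (by linarith) hx))
    · have : (fun x => χ x • W x) =ᶠ[𝓝 x] fun _ => 0 := by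
        filter_upwards [Metric.isClosed_closedBall.isOpen_compl.mem_nhds hx] with y hy
        rw [h0 y hy, zero_smul]
      exact contDiffAt_const.congr_of_eventuallyEq this
  have hcs : HasCompactSupport (fun x => χ x • W x) :=
    HasCompactSupport.intro (isCompact_closedBall (0 : E) (R / 2)) fun x hx => by
      simp only [h0 x hx, zero_smul]
  obtain ⟨K, hK⟩ := hcd.lipschitzWith_of_hasCompactSupport hcs one_ne_zero
  obtain ⟨L, hL⟩ := hcs.exists_bound_of_continuous hcd.continuous
  refine ⟨χ, fun x => χ.nonneg, χ.continuous, fun x hx => χ.one_of_mem_closedBall hx, h0, K,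
    ⟨max L 0, le_max_right _ _⟩, hK, fun x => (hL x).trans (le_max_left _ _)⟩

variable {n : ℕ}

/-- the statement proved by Noetherian induction -/
def Cl2 (I J : Ideal (Rn n)) (g : Rn n) : Prop :=
  ∃ C α : ℝ, 0 < C ∧ 0 < α ∧ ∀ᶠ w in 𝓝 0, w ∈ VV I → ∃ w', rep g w' = 0 ∧
    JoinLen (VV J) w w' (C * |rep g w| ^ α)

lemma small_ev (g : Rn n) (hg0 : rep g 0 = 0) (C α ε : ℝ) (hα : 0 < α) (hε : 0 < ε) :
    ∀ᶠ w in 𝓝 (0 : Fin n → ℝ), C * |rep g w| ^ α < ε := by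
  have h1 : Tendsto (fun x => |rep g x|) (𝓝 0) (𝓝 (|rep g 0|)) := (rep_an g).continuousAt.abs
  have h2 := (h1.rpow_const (p := α) (Or.inr hα.le)).const_mul C
  rw [hg0, abs_zero, Real.zero_rpow hα.ne', mul_zero] at h2
  exact h2.eventually (gt_mem_nhds hε)

lemma Cl2.trans_anti {I J : Ideal (Rn n)} {g : Rn n} (hg0 : rep g 0 = 0) (hIJ : I ≤ J)
    (h : Cl2 J J g) : Cl2 J I g := by
  obtain ⟨C, α, hC, hα, h⟩ := h
  refine ⟨C, α, hC, hα, ?_⟩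
  obtain ⟨r, hr, hrb⟩ := Metric.eventually_nhds_iff_ball.1 (VV_anti hIJ)
  filter_upwards [h, small_ev g hg0 C α (r / 2) hα (by positivity),
    Metric.ball_mem_nhds (0 : Fin n → ℝ) (half_pos hr)] with w h1 h2 h3 hw
  obtain ⟨w', hw', hj⟩ := h1 hw
  refine ⟨w', hw', hj.restrict (by positivity) fun z hz hd => hrb z ?_ hz⟩
  rw [Metric.mem_ball] at h3 ⊢
  linarith [dist_triangle z w 0]

lemma pow_cmp (C C' α α' x : ℝ) (hx0 : 0 ≤ x) (hx1 : x ≤ 1) (hC : C ≤ C') (hC0 : 0 ≤ C')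
    (hα : α' ≤ α) (hα0 : 0 ≤ α') : C * x ^ α ≤ C' * x ^ α' :=
  mul_le_mul hC (Real.rpow_le_rpow_of_exponent_ge' hx0 hx1 hα0 hα) (by positivity) hC0

lemma le_one_ev (g : Rn n) (hg0 : rep g 0 = 0) : ∀ᶠ w in 𝓝 (0 : Fin n → ℝ), |rep g w| ≤ 1 := by
  filter_upwards [small_ev g hg0 1 1 1 one_pos one_pos] with w hw
  simpa using hw.le

lemma Cl2_union {I J1 J2 K : Ideal (Rn n)} {g : Rn n} (hg0 : rep g 0 = 0) (h1 : Cl2 J1 K g)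
    (h2 : Cl2 J2 K g) (hc : ∀ᶠ x in 𝓝 0, x ∈ VV I → x ∈ VV J1 ∨ x ∈ VV J2) : Cl2 I K g := by
  obtain ⟨C1, α1, hC1, hα1, h1⟩ := h1
  obtain ⟨C2, α2, hC2, hα2, h2⟩ := h2
  refine ⟨max C1 C2, min α1 α2, by positivity, by positivity, ?_⟩
  filter_upwards [h1, h2, hc, le_one_ev g hg0] with w k1 k2 k3 k4 hw
  rcases k3 hw with h | h
  · obtain ⟨w', a, b⟩ := k1 h
    exact ⟨w', a, b.mono le_rfl (pow_cmp _ _ _ _ _ (abs_nonneg _) k4 (le_max_left _ _)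
      (by positivity) (min_le_left _ _) (by positivity))⟩
  · obtain ⟨w', a, b⟩ := k2 h
    exact ⟨w', a, b.mono le_rfl (pow_cmp _ _ _ _ _ (abs_nonneg _) k4 (le_max_right _ _)
      (by positivity) (min_le_right _ _) (by positivity))⟩

lemma fderiv_eq_sum (f : (Fin n → ℝ) → ℝ) (x v : Fin n → ℝ) :
    fderiv ℝ f x v = ∑ l, v l * fderiv ℝ f x (Pi.single l 1) := by
  conv_lhs => rw [pi_eq_sum_univ' v]
  rw [map_sum]
  refine Finset.sum_congr rfl fun l _ => ?_
  rw [map_smul, smul_eq_mul]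

/-- the flow step -/
lemma prime_flow (P : Ideal (Rn n)) (hP : P.IsPrime) (g : Rn n) (hg : g ∉ P) (hg0 : rep g 0 = 0) :
    ∃ (D : Finset (Rn n)) (C α : ℝ), (∃ d ∈ D, d ∉ P) ∧ 0 < C ∧ 0 < α ∧
      ∀ᶠ w in 𝓝 (0 : Fin n → ℝ), w ∈ VV P → ∃ w1, JoinLen (VV P) w w1 (C * |rep g w| ^ α) ∧
        |rep g w1| ≤ |rep g w| ∧ (rep g w1 = 0 ∨ w1 ∈ VV (P ⊔ Ideal.span (D : Set (Rn n)))) := by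
  classical
  obtain ⟨a, b, δ, u, vc, α, C, ⟨i0, hi0⟩, hvP, hu, hvδ, hα, hC, hmain⟩ := flow_data P hP g hg hg0
  let W : Fin n → Rn n := fun l => ∑ j, u j * vc j l
  have hWg : ∑ l, W l * pD l g = ∑ j, u j * u j := by
    simp only [W, Finset.sum_mul]
    rw [Finset.sum_comm]
    refine Finset.sum_congr rfl fun j _ => ?_
    conv_rhs => enter [2]; rw [hu j]
    rw [Finset.mul_sum]
    refine Finset.sum_congr rfl fun l _ => ?_
    ring
  have hWP : ∀ f ∈ P, ∑ l, W l * pD l f ∈ P := by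
    intro f hf
    have : ∑ l, W l * pD l f = ∑ j, u j * ∑ l, vc j l * pD l f := by
      simp only [W, Finset.sum_mul, Finset.mul_sum]
      rw [Finset.sum_comm]
      refine Finset.sum_congr rfl fun j _ => Finset.sum_congr rfl fun l _ => by ring
    rw [this]
    exact P.sum_mem fun j _ => P.mul_mem_left _ (hvP j f hf)
  let Wf : (Fin n → ℝ) → (Fin n → ℝ) := fun x l => rep (W l) x
  -- bound for W
  have hWb : ∃ C1 : ℝ, 0 ≤ C1 ∧ ∀ᶠ x in 𝓝 (0 : Fin n → ℝ),
      ‖Wf x‖ ≤ C1 * (∑ i, |rep (δ i) x|) * ∑ j, |rep (u j) x| := by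
    have h1 : ∀ j l, ∃ C1 : ℝ, 0 ≤ C1 ∧ ∀ᶠ x in 𝓝 0, |rep (vc j l) x| ≤ C1 * (∑ i, |rep (δ i) x|) := by
      intro j l
      obtain ⟨c, hc, hc'⟩ := bnd_pow (range δ) (fun x => ∑ i, |rep (δ i) x|) (fun x => by positivity)
        (by
          rintro _ ⟨i, rfl⟩
          exact Eventually.of_forall fun x => Finset.single_le_sum (f := fun i => |rep (δ i) x|)
            (fun _ _ => abs_nonneg _) (Finset.mem_univ i)) 1 (by rw [pow_one]; exact hvδ j l)
      exact ⟨c, hc, by simpa using hc'⟩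
    choose c hc hc' using h1
    refine ⟨∑ j, ∑ l, c j l, Finset.sum_nonneg fun j _ => Finset.sum_nonneg fun l _ => hc j l, ?_⟩
    have e1 : ∀ᶠ x in 𝓝 (0 : Fin n → ℝ), ∀ j, ∀ l, |rep (vc j l) x| ≤ c j l * (∑ i, |rep (δ i) x|) :=
      eventually_all.2 fun j => eventually_all.2 fun l => hc' j l
    have e2 : ∀ᶠ x in 𝓝 (0 : Fin n → ℝ), ∀ l, rep (W l) x = ∑ j, rep (u j * vc j l) x :=
      eventually_all.2 fun l => rep_sum _ _
    have e3 : ∀ᶠ x in 𝓝 (0 : Fin n → ℝ), ∀ j, ∀ l, rep (u j * vc j l) x = rep (u j) x * rep (vc j l) x :=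
      eventually_all.2 fun j => eventually_all.2 fun l => rep_mul _ _
    filter_upwards [e1, e2, e3] with x h1 h2 h3
    have hcc : 0 ≤ ∑ j, ∑ l, c j l := Finset.sum_nonneg fun j _ => Finset.sum_nonneg fun l _ => hc j l
    refine (pi_norm_le_iff_of_nonneg (by positivity)).2 fun l => ?_
    rw [Real.norm_eq_abs]
    simp only [Wf]
    rw [h2 l, Finset.mul_sum]
    refine (Finset.abs_sum_le_sum_abs _ _).trans (Finset.sum_le_sum fun j _ => ?_)
    rw [h3, abs_mul, mul_comm]
    refine mul_le_mul_of_nonneg_right ((h1 j l).trans ?_) (abs_nonneg _)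
    refine mul_le_mul_of_nonneg_right ?_ (by positivity)
    calc c j l ≤ ∑ l, c j l := Finset.single_le_sum (f := fun l => c j l) (fun l _ => hc j l) (Finset.mem_univ l)
      _ ≤ _ := Finset.single_le_sum (f := fun j => ∑ l, c j l)
        (fun j _ => Finset.sum_nonneg fun l _ => hc j l) (Finset.mem_univ j)
  obtain ⟨C1, hC1, hWb⟩ := hWb
  -- bound for derivatives of elements of P
  have hPb : ∃ M : ℝ, 0 ≤ M ∧ ∀ᶠ x in 𝓝 (0 : Fin n → ℝ), ∀ f : gens P,
      |rep (g * ∑ l, W l * pD l f.1) x| ≤ M * ∑ b : gens P, |rep b.1 x| := by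
    have h1 : ∀ f : gens P, ∃ C1 : ℝ, 0 ≤ C1 ∧ ∀ᶠ x in 𝓝 0,
        |rep (g * ∑ l, W l * pD l f.1) x| ≤ C1 * ∑ b : gens P, |rep b.1 x| := by
      intro f
      have hmem : g * ∑ l, W l * pD l f.1 ∈ P := by
        refine P.mul_mem_left _ (hWP f.1 ?_)
        have := Ideal.subset_span (s := (gens P : Set (Rn n))) f.2
        rwa [span_gens] at this
      obtain ⟨c, hc, hc'⟩ := bnd_pow (gens P : Set (Rn n)) (fun x => ∑ b : gens P, |rep b.1 x|)
        (fun x => by positivity)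
        (by
          intro s hs
          exact Eventually.of_forall fun x => Finset.single_le_sum
            (f := fun b : gens P => |rep b.1 x|) (fun _ _ => abs_nonneg _) (Finset.mem_univ ⟨s, hs⟩)) 1
        (show g * ∑ l, W l * pD l f.1 ∈ _ by rw [pow_one, span_gens]; exact hmem)
      exact ⟨c, hc, by simpa using hc'⟩
    choose c hc hc' using h1
    refine ⟨∑ f, c f, Finset.sum_nonneg fun f _ => hc f, ?_⟩
    filter_upwards [eventually_all.2 hc'] with x hx f
    refine (hx f).trans (mul_le_mul_of_nonneg_right ?_ (by positivity))
    exact Finset.single_le_sum (f := c) (fun f _ => hc f) (Finset.mem_univ f)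
  obtain ⟨M, hM, hPb⟩ := hPb
  have hder : ∀ f : Rn n, ∀ᶠ x in 𝓝 (0 : Fin n → ℝ),
      rep (∑ l, W l * pD l f) x = fderiv ℝ (rep f) x (Wf x) := by
    intro f
    have e3 : ∀ᶠ x in 𝓝 (0 : Fin n → ℝ), ∀ l, rep (W l * pD l f) x = rep (W l) x * rep (pD l f) x :=
      eventually_all.2 fun l => rep_mul _ _
    have e4 : ∀ᶠ x in 𝓝 (0 : Fin n → ℝ), ∀ l, rep (pD l f) x = fderiv ℝ (rep f) x (Pi.single l 1) :=
      eventually_all.2 fun l => rep_pd l f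
    filter_upwards [rep_sum Finset.univ (fun l => W l * pD l f), e3, e4] with x h1 h3 h4
    rw [h1, fderiv_eq_sum]
    exact Finset.sum_congr rfl fun l _ => by rw [h3, h4]
  have hS2 : ∀ᶠ x in 𝓝 (0 : Fin n → ℝ), fderiv ℝ (rep g) x (Wf x) = ∑ j, rep (u j) x ^ 2 := by
    have e3 : ∀ᶠ x in 𝓝 (0 : Fin n → ℝ), ∀ j, rep (u j * u j) x = rep (u j) x * rep (u j) x :=
      eventually_all.2 fun l => rep_mul _ _
    filter_upwards [hder g, rep_sum Finset.univ (fun j => u j * u j), e3] with x h1 h2 h3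
    rw [← h1, hWg, h2]
    exact Finset.sum_congr rfl fun j _ => by rw [h3, sq]
  have hdP : ∀ᶠ x in 𝓝 (0 : Fin n → ℝ), ∀ f : gens P,
      |rep g x * fderiv ℝ (rep f.1) x (Wf x)| ≤ M * ∑ b : gens P, |rep b.1 x| := by
    have e1 : ∀ᶠ x in 𝓝 (0 : Fin n → ℝ), ∀ f : gens P, rep (∑ l, W l * pD l f.1) x =
      fderiv ℝ (rep f.1) x (Wf x) := eventually_all.2 fun f => hder f.1
    have e2 : ∀ᶠ x in 𝓝 (0 : Fin n → ℝ), ∀ f : gens P, rep (g * ∑ l, W l * pD l f.1) x =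
      rep g x * rep (∑ l, W l * pD l f.1) x := eventually_all.2 fun f => rep_mul _ _
    filter_upwards [hPb, e1, e2] with x h1 h2 h3 f
    rw [← h2, ← h3]; exact h1 f
  have hfdiff : ∀ᶠ x in 𝓝 (0 : Fin n → ℝ), ∀ f : gens P, DifferentiableAt ℝ (rep f.1) x :=
    eventually_all.2 fun f => rep_diff f.1
  have hucont : ∀ᶠ x in 𝓝 (0 : Fin n → ℝ), ∀ j, ContinuousAt (rep (u j)) x :=
    eventually_all.2 fun j => (rep_diff (u j)).mono fun x hx => hx.continuousAt
  let V0 : (Fin n → ℝ) → (Fin n → ℝ) := fun x => (- rep g x) • Wf x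
  have hV0s : ∀ᶠ x in 𝓝 (0 : Fin n → ℝ), ContDiffAt ℝ 1 V0 x := by
    have e1 : ∀ᶠ x in 𝓝 (0 : Fin n → ℝ), ∀ l, ContDiffAt ℝ 1 (rep (W l)) x :=
      eventually_all.2 fun l => (rep_an (W l)).eventually_analyticAt.mono fun x hx => hx.contDiffAt
    filter_upwards [e1, (rep_an g).eventually_analyticAt] with x h1 h2
    exact h2.contDiffAt.neg.smul (contDiffAt_pi.2 h1)
  obtain ⟨R, hR, hRb⟩ := Metric.eventually_nhds_iff_ball.1
    (((hmain.and hWb).and (hS2.and hdP)).and ((hfdiff.and (rep_diff g)).and (hucont.and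
      (hV0s.and (VV_sup P (Finset.univ.image δ))))))
  obtain ⟨χ, hχ0, hχc, hχ1, hχ2, K, L, hK, hL⟩ := cutoff V0 R hR fun x hx => (hRb x hx).2.2.2.1
  have hsub : ∀ x ∈ Metric.closedBall (0 : Fin n → ℝ) (R / 2), x ∈ Metric.ball (0 : Fin n → ℝ) R :=
    fun x hx => Metric.closedBall_subset_ball (by linarith) hx
  let χm : ℝ := 1
  obtain ⟨m, hm⟩ := (isCompact_closedBall (0 : Fin n → ℝ) (R / 2)).exists_bound_of_continuousOn
    hχc.continuousOn
  have hm0 : 0 ≤ |m| := abs_nonneg m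
  set C3 : ℝ := C1 * (a * C) * b + 1 with hC3
  have hflow : ∀ w ∈ Metric.closedBall (0 : Fin n → ℝ) (R / 2), (∀ f : gens P, rep f.1 w = 0) →
      ∃ w1, JoinLen {x | x ∈ Metric.closedBall (0 : Fin n → ℝ) (R / 2) ∧ ∀ f : gens P, rep f.1 x = 0}
        w w1 (C3 / α * |rep g w| ^ α) ∧ χ w1 • V0 w1 = 0 ∧ |rep g w1| ≤ |rep g w| := by
    intro w hw hfw
    refine flow_lemma (fun x => χ x • V0 x) K L hK hL (R / 2) (fun x hx => by simp only [hχ2 x hx, zero_smul])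
      (fun f : gens P => rep f.1) (fun f x hx => (hRb x (hsub x hx)).2.1.1 f) (|m| * M) ?_
      (rep g) (fun x hx => (hRb x (hsub x hx)).2.1.2) (fun x => χ x * ∑ j, rep (u j) x ^ 2) ?_ ?_ ?_ C3 α
      (by positivity) hα ?_ w hw hfw
    · intro f x hx
      have h1 := (hRb x (hsub x hx)).1.2.2 f
      have h2 := (hm x hx).trans (le_abs_self m)
      simp only [V0]
      rw [map_smul, map_smul, smul_eq_mul, smul_eq_mul, neg_mul, mul_neg, abs_neg, abs_mul, mul_assoc]
      exact mul_le_mul h2 h1 (abs_nonneg _) hm0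
    · refine hχc.continuousOn.mul (continuousOn_finsetSum _ fun j _ => ContinuousOn.pow ?_ 2)
      intro x hx
      exact ((hRb x (hsub x hx)).2.2.1 j).continuousWithinAt
    · intro x
      exact mul_nonneg (hχ0 x) (by positivity)
    · intro x hx
      have h1 := (hRb x (hsub x hx)).1.2.1
      simp only [V0]
      rw [map_smul, map_smul, h1, smul_eq_mul, smul_eq_mul]; ring
    · intro x hx hfx
      have h1 := (hRb x (hsub x hx)).1.1.1 (fun f hf => hfx ⟨f, hf⟩)
      have h2 := (hRb x (hsub x hx)).1.1.2
      simp only [V0]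
      rw [norm_smul, norm_smul, norm_neg, Real.norm_eq_abs, Real.norm_eq_abs, abs_of_nonneg (hχ0 x)]
      set U := ∑ j, |rep (u j) x| with hU
      set Δ := ∑ i, |rep (δ i) x| with hΔ
      have hU0 : 0 ≤ U := by positivity
      have hG := abs_nonneg (rep g x)
      have hGα := Real.rpow_nonneg hG α
      have h3 : Δ * |rep g x| ≤ a * (C * |rep g x| ^ α * U) := by
        rw [hΔ, Finset.sum_mul]
        refine (Finset.sum_le_card_nsmul _ _ _ fun i _ => h1 i).trans ?_
        simp
      have h4 : U ^ 2 ≤ b * ∑ j, rep (u j) x ^ 2 := by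
        have := sq_sum_le_card_mul_sum_sq (s := Finset.univ) (f := fun j => |rep (u j) x|)
        simpa using this
      have hS : 0 ≤ ∑ j, rep (u j) x ^ 2 := by positivity
      have h5 : |rep g x| * ‖Wf x‖ ≤ C3 * |rep g x| ^ α * ∑ j, rep (u j) x ^ 2 := by
        calc |rep g x| * ‖Wf x‖ ≤ |rep g x| * (C1 * Δ * U) := by gcongr
          _ = C1 * (Δ * |rep g x|) * U := by ring
          _ ≤ C1 * (a * (C * |rep g x| ^ α * U)) * U := by gcongr
          _ = C1 * (a * C) * |rep g x| ^ α * U ^ 2 := by ring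
          _ ≤ C1 * (a * C) * |rep g x| ^ α * (b * ∑ j, rep (u j) x ^ 2) := by gcongr
          _ = (C1 * (a * C) * b) * (|rep g x| ^ α * ∑ j, rep (u j) x ^ 2) := by ring
          _ ≤ C3 * (|rep g x| ^ α * ∑ j, rep (u j) x ^ 2) := by
            refine mul_le_mul_of_nonneg_right ?_ (by positivity)
            rw [hC3]; linarith
          _ = _ := by ring
      calc χ x * (|rep g x| * ‖Wf x‖) ≤ χ x * (C3 * |rep g x| ^ α * ∑ j, rep (u j) x ^ 2) :=
            mul_le_mul_of_nonneg_left h5 (hχ0 x)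
        _ = _ := by ring
  have hC3p : 0 < C3 := by positivity
  refine ⟨Finset.univ.image δ, C3 / α, α, ⟨δ i0, by simp, hi0⟩, by positivity, hα, ?_⟩
  filter_upwards [small_ev g hg0 (C3 / α) α (R / 8) hα (by positivity),
    Metric.ball_mem_nhds (0 : Fin n → ℝ) (show 0 < R / 8 by positivity)] with w h1 h2 hw
  rw [Metric.mem_ball] at h2
  obtain ⟨w1, hj, hV, hgle⟩ := hflow w (by rw [Metric.mem_closedBall]; linarith) fun f => hw f.1 f.2
  have hd := hj.dist_end (by positivity)
  have hw1 : dist w1 0 ≤ R / 4 := by linarith [dist_triangle w1 w 0]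
  have hw1P : w1 ∈ VV P := fun f hf => hj.mem.2 ⟨f, hf⟩
  refine ⟨w1, hj.mono (fun x hx f hf => hx.2 ⟨f, hf⟩) le_rfl, hgle, ?_⟩
  by_cases hz : rep g w1 = 0
  · exact Or.inl hz
  right
  have hball : w1 ∈ Metric.ball (0 : Fin n → ℝ) R := by rw [Metric.mem_ball]; linarith
  obtain ⟨⟨⟨k1, k2⟩, ⟨k3, k4⟩⟩, ⟨⟨k5, k6⟩, ⟨k7, k8, k9⟩⟩⟩ := hRb w1 hball
  rw [hχ1 w1 hw1, one_smul] at hV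
  simp only [V0] at hV
  have hW0 : Wf w1 = 0 := (smul_eq_zero.1 hV).resolve_left (neg_ne_zero.2 hz)
  rw [hW0, map_zero] at k3
  have hu0 : ∀ j, rep (u j) w1 = 0 := fun j => by
    have := (Finset.sum_eq_zero_iff_of_nonneg (fun j _ => sq_nonneg (rep (u j) w1))).1 k3.symm j
      (Finset.mem_univ j)
    exact pow_eq_zero_iff (two_ne_zero) |>.1 this
  refine k9 hw1P ?_
  intro d hdm
  obtain ⟨i, _, rfl⟩ := Finset.mem_image.1 hdm
  have := k1 hw1P i
  simp only [hu0, abs_zero, Finset.sum_const_zero, mul_zero] at this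
  have h0 : |rep (δ i) w1| * |rep g w1| = 0 := le_antisymm this (by positivity)
  rcases mul_eq_zero.1 h0 with h | h
  · exact abs_eq_zero.1 h
  · exact absurd (abs_eq_zero.1 h) hz

theorem claim (g : Rn n) (hg0 : rep g 0 = 0) (I : Ideal (Rn n)) : Cl2 I I g := by
  have : IsNoetherianRing (Rn n) := rn_noeth n
  induction I using WellFoundedGT.induction with
  | ind I ih =>
  by_cases htop : I = ⊤
  · refine ⟨1, 1, one_pos, one_pos, ?_⟩
    filter_upwards [VV_vanish I (h := 1) (by rw [htop]; trivial), rep_one (n := n)] with x h1 h2 hx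
    rw [h1 hx] at h2
    norm_num at h2
  by_cases hP : I.IsPrime
  · by_cases hg : g ∈ I
    · refine ⟨1, 1, one_pos, one_pos, ?_⟩
      filter_upwards [VV_vanish I hg] with x h1 hx
      exact ⟨x, h1 hx, JoinLen.refl hx _⟩
    obtain ⟨D, C, α, ⟨d, hdD, hdP⟩, hC, hα, hfl⟩ := prime_flow I hP g hg hg0
    have hlt : I < I ⊔ Ideal.span (D : Set (Rn n)) := by
      refine lt_of_le_of_ne le_sup_left fun h => hdP ?_
      rw [h]
      exact Ideal.mem_sup_right (Ideal.subset_span hdD)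
    obtain ⟨C', α', hC', hα', h'⟩ := (ih _ hlt).trans_anti hg0 hlt.le
    obtain ⟨r, hr, hrb⟩ := Metric.eventually_nhds_iff_ball.1 h'
    refine ⟨C + C', min α α', by positivity, by positivity, ?_⟩
    filter_upwards [hfl, small_ev g hg0 C α (r / 2) hα (by positivity), le_one_ev g hg0,
      Metric.ball_mem_nhds (0 : Fin n → ℝ) (half_pos hr)] with w h1 h2 h3 h4 hw
    obtain ⟨w1, hj, hle, hor⟩ := h1 hw
    have hcmp := pow_cmp C C α (min α α') _ (abs_nonneg (rep g w)) h3 le_rfl hC.le (min_le_left _ _)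
      (by positivity)
    have hmp : 0 ≤ |rep g w| ^ min α α' := by positivity
    rcases hor with h | h
    · refine ⟨w1, h, hj.mono le_rfl (hcmp.trans ?_)⟩
      rw [add_mul]
      have : 0 ≤ C' * |rep g w| ^ min α α' := by positivity
      linarith
    · have hd := hj.dist_end (by positivity)
      rw [Metric.mem_ball] at h4
      obtain ⟨w', hz, hj'⟩ := hrb w1 (by rw [Metric.mem_ball]; linarith [dist_triangle w1 w 0]) h
      refine ⟨w', hz, (hj.trans hj' (by positivity) (by positivity)).mono le_rfl ?_⟩
      rw [add_mul]
      refine add_le_add hcmp ?_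
      calc C' * |rep g w1| ^ α' ≤ C' * |rep g w| ^ α' := by gcongr
        _ ≤ _ := pow_cmp _ _ _ _ _ (abs_nonneg _) h3 le_rfl hC'.le (min_le_right _ _) (by positivity)
  · rw [Ideal.not_isPrime_iff] at hP
    obtain ⟨a, ha, b, hb, hab⟩ := hP.resolve_left htop
    have hlt : ∀ c, c ∉ I → I < I ⊔ Ideal.span ((({c} : Finset (Rn n))) : Set (Rn n)) := by
      intro c hc
      refine lt_of_le_of_ne le_sup_left fun h => hc ?_
      rw [h]
      exact Ideal.mem_sup_right (Ideal.subset_span (by simp))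
    refine Cl2_union hg0 ((ih _ (hlt a ha)).trans_anti hg0 (hlt a ha).le)
      ((ih _ (hlt b hb)).trans_anti hg0 (hlt b hb).le) ?_
    filter_upwards [VV_vanish I hab, rep_mul a b, VV_sup I {a}, VV_sup I {b}] with x h1 h2 h3 h4 hx
    have h5 := h1 hx
    rw [h2] at h5
    rcases mul_eq_zero.1 h5 with h | h
    · left; exact h3 hx (by simpa using h)
    · right; exact h4 hx (by simpa using h)

end WR

namespace WR

open Topology Filter Set

/-- common zeros of finitely many analytic functions as `VV` of an ideal of germs -/
lemma exists_ideal {m : ℕ} {ι : Type*} [Fintype ι] (F : ι → (Fin m → ℝ) → ℝ)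
    (hF : ∀ i, AnalyticAt ℝ (F i) 0) :
    ∃ I : Ideal (Rn m), ∀ᶠ w in 𝓝 (0 : Fin m → ℝ), w ∈ VV I ↔ ∀ i, F i w = 0 := by
  classical
  let S : Finset (Rn m) := Finset.univ.image fun i => germ (F i) (hF i)
  refine ⟨Ideal.span (S : Set (Rn m)), ?_⟩
  have h1 : ∀ᶠ w in 𝓝 (0 : Fin m → ℝ), ∀ i, rep (germ (F i) (hF i)) w = F i w :=
    Filter.eventually_all.2 fun i => rep_germ (hF i)
  have h2 : ∀ᶠ w in 𝓝 (0 : Fin m → ℝ), ∀ i, w ∈ VV (Ideal.span (S : Set (Rn m))) →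
      rep (germ (F i) (hF i)) w = 0 :=
    Filter.eventually_all.2 fun i => VV_vanish _ (Ideal.subset_span (by
      simp only [S, Finset.coe_image, Finset.coe_univ]
      exact ⟨i, trivial, rfl⟩))
  filter_upwards [h1, h2, VV_of_span (Ideal.span (S : Set (Rn m))) S le_rfl] with w a1 a2 a3
  constructor
  · intro hw i
    rw [← a1 i]
    exact a2 i hw
  · intro hw
    refine a3 fun f hf => ?_
    obtain ⟨i, _, rfl⟩ := Finset.mem_image.1 hf
    rw [a1 i]
    exact hw i

/-- local version of the regularity statement -/
lemma local_reg {n : ℕ} (X : Set (EuclideanSpace ℝ (Fin n))) (hX : IsAnalyticSubset X)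
    (p : EuclideanSpace ℝ (Fin n)) :
    ∃ C α : ℝ, 0 < C ∧ 0 < α ∧
      ∀ᶠ q in 𝓝 ((p, p) : EuclideanSpace ℝ (Fin n) × EuclideanSpace ℝ (Fin n)),
        q.1 ∈ X → q.2 ∈ X → JoinLen X q.1 q.2 (C * ‖q.1 - q.2‖ ^ α) := by
  obtain ⟨U, hU, hpU, k, f, hf, hXU⟩ := hX p
  let E := EuclideanSpace ℝ (Fin n)
  let m := Module.finrank ℝ (E × E)
  let e : (Fin m → ℝ) ≃L[ℝ] E × E := ContinuousLinearEquiv.ofFinrankEq (by simp [m])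
  let A : (Fin m → ℝ) →L[ℝ] E := (ContinuousLinearMap.fst ℝ E E).comp e.toContinuousLinearMap
  let B : (Fin m → ℝ) →L[ℝ] E := (ContinuousLinearMap.snd ℝ E E).comp e.toContinuousLinearMap
  have hAB : ∀ w, e w = (A w, B w) := fun w => rfl
  have han : ∀ (L : (Fin m → ℝ) →L[ℝ] E) (i : Fin k), AnalyticAt ℝ (fun w => f i (p + L w)) 0 := by
    intro L i
    have h1 : AnalyticAt ℝ (fun w => p + L w) 0 := analyticAt_const.add (L.analyticAt 0)
    have h2 : AnalyticAt ℝ (f i) (p + L 0) := by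
      rw [map_zero, add_zero]
      exact (hU.analyticOn_iff_analyticOnNhd.1 (hf i)) p hpU
    exact AnalyticAt.fun_comp (g := f i) h2 h1
  let F : Fin k ⊕ Fin k → (Fin m → ℝ) → ℝ :=
    Sum.elim (fun i w => f i (p + A w)) (fun i w => f i (p + B w))
  have hF : ∀ i, AnalyticAt ℝ (F i) 0 := by
    rintro (i | i)
    · exact han A i
    · exact han B i
  let G : (Fin m → ℝ) → ℝ := fun w => ‖(A - B) w‖ ^ 2
  have hG : AnalyticAt ℝ G 0 := by
    have : ContDiff ℝ ⊤ G := (contDiff_norm_sq ℝ).comp (A - B).contDiff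
    exact this.contDiffAt.analyticAt
  have hrG := rep_germ hG
  have hg0 : rep (germ G hG) 0 = 0 := by
    rw [hrG.eq_of_nhds]
    simp [G]
  obtain ⟨I, hI⟩ := exists_ideal F hF
  obtain ⟨C, α, hC, hα, hcl⟩ := claim (germ G hG) hg0 I
  have hcont : ∀ L : (Fin m → ℝ) →L[ℝ] E, ∀ᶠ w in 𝓝 (0 : Fin m → ℝ), p + L w ∈ U := by
    intro L
    have : ContinuousAt (fun w => p + L w) 0 := by fun_prop
    exact this.eventually_mem (hU.mem_nhds (by simpa using hpU))
  have key : ∀ᶠ w in 𝓝 (0 : Fin m → ℝ), (w ∈ VV I ↔ (p + A w ∈ X ∧ p + B w ∈ X)) ∧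
      rep (germ G hG) w = G w := by
    filter_upwards [hI, hcont A, hcont B, hrG] with w h1 h2 h3 h4
    refine ⟨h1.trans ?_, h4⟩
    have hx : ∀ z ∈ U, (z ∈ X ↔ ∀ i, f i z = 0) := by
      intro z hz
      have := Set.ext_iff.1 hXU z
      simp only [Set.mem_inter_iff, Set.mem_ofPred_eq, hz, and_true, true_and] at this
      exact this
    rw [hx _ h2, hx _ h3]
    constructor
    · intro h
      exact ⟨fun i => h (Sum.inl i), fun i => h (Sum.inr i)⟩
    · rintro ⟨ha, hb⟩ (i | i)
      · exact ha i
      · exact hb i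
  obtain ⟨r, hr, hkey⟩ := Metric.eventually_nhds_iff.1 key
  let KA : NNReal := ‖A‖₊
  let KB : NNReal := ‖B‖₊
  have hLA : LipschitzWith KA (fun w => p + A w) := by
    refine LipschitzWith.of_dist_le_mul fun a b => ?_
    rw [dist_add_left]
    exact A.lipschitz.dist_le_mul a b
  have hLB : LipschitzWith KB (fun w => p + B w) := by
    refine LipschitzWith.of_dist_le_mul fun a b => ?_
    rw [dist_add_left]
    exact B.lipschitz.dist_le_mul a b
  refine ⟨(KA + KB + 1) * C, 2 * α, by positivity, by positivity, ?_⟩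
  have hw : ∀ᶠ w in 𝓝 (0 : Fin m → ℝ), p + A w ∈ X → p + B w ∈ X →
      JoinLen X (p + A w) (p + B w) ((KA + KB + 1) * C * ‖(A - B) w‖ ^ (2 * α)) := by
    filter_upwards [hcl, small_ev _ hg0 C α (r / 2) hα (by positivity),
      Metric.ball_mem_nhds (0 : Fin m → ℝ) (half_pos hr)] with w h1 h2 h3 hxA hxB
    rw [Metric.mem_ball] at h3
    obtain ⟨hk1, hk2⟩ := hkey (y := w) (by linarith)
    obtain ⟨w', hw', hj⟩ := h1 (hk1.2 ⟨hxA, hxB⟩)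
    have hl0 : 0 ≤ C * |rep (germ G hG) w| ^ α := by positivity
    have hj' : JoinLen {z | p + A z ∈ X ∧ p + B z ∈ X} w w' (C * |rep (germ G hG) w| ^ α) := by
      refine hj.restrict hl0 fun z hz hd => ?_
      have := dist_triangle z w 0
      exact (hkey (y := z) (by linarith)).1.1 hz
    have hd := hj.dist_end hl0
    have htri := dist_triangle w' w 0
    have hG' : G w' = 0 := by
      rw [← (hkey (y := w') (by linarith)).2, hw']
    have heq : p + A w' = p + B w' := by
      have h5 : (A - B) w' = 0 := by
        have h6 : ‖(A - B) w'‖ ^ 2 = 0 := hG'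
        exact norm_eq_zero.1 (pow_eq_zero_iff two_ne_zero |>.1 h6)
      rw [_root_.sub_apply, sub_eq_zero] at h5
      rw [h5]
    have hjA := hj'.image hLA (Z' := X) fun z hz => hz.1
    have hjB := hj'.image hLB (Z' := X) fun z hz => hz.2
    rw [heq] at hjA
    refine (hjA.trans hjB.symm (by positivity) (by positivity)).mono le_rfl ?_
    have h6 : |rep (germ G hG) w| ^ α = ‖(A - B) w‖ ^ (2 * α) := by
      rw [hk2, abs_of_nonneg (by positivity), Real.rpow_mul (norm_nonneg _)]
      norm_num [G]
    rw [h6]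
    have h7 : 0 ≤ C * ‖(A - B) w‖ ^ (2 * α) := by positivity
    nlinarith
  have htend : Tendsto (fun q : E × E => e.symm (q.1 - p, q.2 - p)) (𝓝 (p, p)) (𝓝 0) := by
    have : ContinuousAt (fun q : E × E => e.symm (q.1 - p, q.2 - p)) (p, p) := by fun_prop
    have h2 := this.tendsto
    have h3 : e.symm (p - p, p - p) = 0 := by
      rw [sub_self]
      exact e.symm.map_zero
    exact h3 ▸ h2
  filter_upwards [htend.eventually hw] with q hq h1 h2
  have hA : A (e.symm (q.1 - p, q.2 - p)) = q.1 - p := by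
    have := hAB (e.symm (q.1 - p, q.2 - p))
    rw [e.apply_symm_apply] at this
    exact (congrArg Prod.fst this).symm
  have hB : B (e.symm (q.1 - p, q.2 - p)) = q.2 - p := by
    have := hAB (e.symm (q.1 - p, q.2 - p))
    rw [e.apply_symm_apply] at this
    exact (congrArg Prod.snd this).symm
  rw [Set.mem_ofPred_eq, _root_.sub_apply, hA, hB] at hq
  simp only [add_sub_cancel, sub_sub_sub_cancel_right] at hq
  exact hq h1 h2

/-- comparison of powers on a bounded interval -/
lemma pow_change {D t α β : ℝ} (hD : 1 ≤ D) (ht : 0 ≤ t) (htD : t ≤ D) (hβ : 0 < β) (hβα : β ≤ α) :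
    t ^ α ≤ D ^ α * t ^ β := by
  rcases ht.eq_or_lt with rfl | ht
  · rw [Real.zero_rpow (by linarith), Real.zero_rpow hβ.ne', mul_zero]
  have h1 : t ^ α = t ^ (α - β) * t ^ β := by
    rw [← Real.rpow_add ht]
    congr 1
    ring
  rw [h1]
  refine mul_le_mul_of_nonneg_right ?_ (by positivity)
  calc t ^ (α - β) ≤ D ^ (α - β) := Real.rpow_le_rpow ht.le htD (by linarith)
    _ ≤ D ^ α := Real.rpow_le_rpow_of_exponent_le hD (by linarith)

/-- any two points can be joined by a rectifiable path -/
lemma global_join {n : ℕ} (X : Set (EuclideanSpace ℝ (Fin n))) (hX : IsAnalyticSubset X)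
    (hconn : IsPreconnected X) {x y : EuclideanSpace ℝ (Fin n)} (hx : x ∈ X) (hy : y ∈ X) :
    ∃ ℓ : ℝ, 0 ≤ ℓ ∧ JoinLen X x y ℓ := by
  refine hconn.induction₂ (fun x y => ∃ ℓ : ℝ, 0 ≤ ℓ ∧ JoinLen X x y ℓ) ?_ ?_ ?_ hx hy
  · intro p hp
    obtain ⟨C, α, hC, hα, h⟩ := local_reg X hX p
    rw [nhds_prod_eq] at h
    have h2 : ∀ᶠ y in 𝓝 p, p ∈ X → y ∈ X → JoinLen X p y (C * ‖p - y‖ ^ α) := by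
      have ht : Tendsto (fun y => (p, y)) (𝓝 p) (𝓝 p ×ˢ 𝓝 p) :=
        Tendsto.prodMk tendsto_const_nhds tendsto_id
      exact ht.eventually h
    filter_upwards [nhdsWithin_le_nhds h2, self_mem_nhdsWithin] with y hy hyX
    exact ⟨_, by positivity, hy hp hyX⟩
  · rintro x y z _ _ _ ⟨a, ha, h⟩ ⟨b, hb, h'⟩
    exact ⟨a + b, by positivity, h.trans h' ha hb⟩
  · rintro x y _ _ ⟨a, ha, h⟩
    exact ⟨a, ha, h.symm⟩

/-- near points are joined by paths of bounded length -/
lemma local_bdd {n : ℕ} (X : Set (EuclideanSpace ℝ (Fin n))) (hX : IsAnalyticSubset X)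
    {p : EuclideanSpace ℝ (Fin n)} (hp : p ∈ X) :
    ∃ M : ℝ, 0 ≤ M ∧ ∀ᶠ y in 𝓝 p, y ∈ X → JoinLen X p y M := by
  obtain ⟨C, α, hC, hα, h⟩ := local_reg X hX p
  rw [nhds_prod_eq] at h
  have ht : Tendsto (fun y => (p, y)) (𝓝 p) (𝓝 p ×ˢ 𝓝 p) :=
    Tendsto.prodMk tendsto_const_nhds tendsto_id
  refine ⟨C, hC.le, ?_⟩
  filter_upwards [ht.eventually h, Metric.ball_mem_nhds p one_pos] with y hy hb hyX
  refine (hy hp hyX).mono le_rfl ?_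
  have h1 : ‖p - y‖ ≤ 1 := by
    rw [Metric.mem_ball, dist_comm, dist_eq_norm] at hb
    exact hb.le
  have h2 := Real.rpow_le_one (norm_nonneg _) h1 hα.le
  show C * ‖p - y‖ ^ α ≤ C
  nlinarith

/-- uniform version -/
lemma global_reg {n : ℕ} (X : Set (EuclideanSpace ℝ (Fin n))) (hX : IsAnalyticSubset X)
    (hcomp : IsCompact X) (hconn : IsPreconnected X) (D : ℝ) (hD1 : 1 ≤ D)
    (hD : ∀ x ∈ X, ∀ y ∈ X, ‖x - y‖ ≤ D) :
    ∃ C α : ℝ, 0 < C ∧ 0 < α ∧ ∀ q ∈ X ×ˢ X, q.1 ∈ X → q.2 ∈ X →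
      JoinLen X q.1 q.2 (C * ‖q.1 - q.2‖ ^ α) := by
  have hD0 : 0 < D := by linarith
  refine (hcomp.prod hcomp).induction_on
    (p := fun s => ∃ C α : ℝ, 0 < C ∧ 0 < α ∧ ∀ q ∈ s, q.1 ∈ X → q.2 ∈ X →
      JoinLen X q.1 q.2 (C * ‖q.1 - q.2‖ ^ α)) ?_ ?_ ?_ ?_
  · exact ⟨1, 1, one_pos, one_pos, fun q hq => hq.elim⟩
  · rintro s t hst ⟨C, α, hC, hα, h⟩
    exact ⟨C, α, hC, hα, fun q hq => h q (hst hq)⟩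
  · rintro s t ⟨C, α, hC, hα, h⟩ ⟨C', α', hC', hα', h'⟩
    refine ⟨C * D ^ α + C' * D ^ α', min α α', by positivity, lt_min hα hα', ?_⟩
    have hp1 : 0 < D ^ α := by positivity
    have hp2 : 0 < D ^ α' := by positivity
    rintro q (hq | hq) h1 h2
    · refine (h q hq h1 h2).mono le_rfl ?_
      have h3 := pow_change hD1 (norm_nonneg _) (hD _ h1 _ h2) (lt_min hα hα') (min_le_left α α')
      have h4 : 0 ≤ ‖q.1 - q.2‖ ^ min α α' := by positivity
      calc C * ‖q.1 - q.2‖ ^ α ≤ C * (D ^ α * ‖q.1 - q.2‖ ^ min α α') := by gcongr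
        _ ≤ (C * D ^ α + C' * D ^ α') * ‖q.1 - q.2‖ ^ min α α' := by
            have : 0 ≤ C' * D ^ α' * ‖q.1 - q.2‖ ^ min α α' := by positivity
            linarith
    · refine (h' q hq h1 h2).mono le_rfl ?_
      have h3 := pow_change hD1 (norm_nonneg _) (hD _ h1 _ h2) (lt_min hα hα') (min_le_right α α')
      have h4 : 0 ≤ ‖q.1 - q.2‖ ^ min α α' := by positivity
      calc C' * ‖q.1 - q.2‖ ^ α' ≤ C' * (D ^ α' * ‖q.1 - q.2‖ ^ min α α') := by gcongr
        _ ≤ (C * D ^ α + C' * D ^ α') * ‖q.1 - q.2‖ ^ min α α' := by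
            have : 0 ≤ C * D ^ α * ‖q.1 - q.2‖ ^ min α α' := by positivity
            linarith
  · rintro ⟨p, q⟩ ⟨hp, hq⟩
    simp only at hp hq
    by_cases hpq : p = q
    · subst hpq
      obtain ⟨C, α, hC, hα, h⟩ := local_reg X hX p
      exact ⟨_, nhdsWithin_le_nhds h, C, α, hC, hα, fun q hq => hq⟩
    · obtain ⟨M1, hM1, h1⟩ := local_bdd X hX hp
      obtain ⟨M2, hM2, h2⟩ := local_bdd X hX hq
      obtain ⟨ℓ, hl, hj⟩ := global_join X hX hconn hp hq
      have hd : 0 < ‖p - q‖ := norm_pos_iff.2 (sub_ne_zero.2 hpq)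
      have hc : ∀ᶠ z in 𝓝 (p, q), ‖p - q‖ / 2 < ‖z.1 - z.2‖ := by
        have : ContinuousAt (fun z : EuclideanSpace ℝ (Fin n) × EuclideanSpace ℝ (Fin n) =>
          ‖z.1 - z.2‖) (p, q) := by fun_prop
        exact this.eventually_const_lt (by simp only; linarith)
      have hfst : Tendsto Prod.fst (𝓝 (p, q)) (𝓝 p) := continuous_fst.tendsto (p, q)
      have hsnd : Tendsto Prod.snd (𝓝 (p, q)) (𝓝 q) := continuous_snd.tendsto (p, q)
      have hall : ∀ᶠ z in 𝓝 (p, q), z.1 ∈ X → z.2 ∈ X →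
          JoinLen X z.1 z.2 ((M1 + ℓ + M2 + 1) / (‖p - q‖ / 2) * ‖z.1 - z.2‖ ^ (1 : ℝ)) := by
        filter_upwards [hfst.eventually h1, hsnd.eventually h2, hc] with z a1 a2 a3 b1 b2
        refine (((a1 b1).symm.trans hj hM1 hl).trans (a2 b2) (by positivity) hM2).mono le_rfl ?_
        rw [Real.rpow_one, div_mul_eq_mul_div, le_div_iff₀ (by positivity)]
        nlinarith
      exact ⟨_, nhdsWithin_le_nhds hall, _, 1, by positivity, one_pos, fun q hq => hq⟩

end WR

/-- **Whitney regularity of real analytic sets.**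
Let `X` be a compact connected analytic subset of `ℝⁿ`. Then there exist a positive
integer `ν` and a constant `C > 0` such that any two points `x, y ∈ X` can be joined
by a continuous path in `X` whose length (total variation) is at most
`C · ‖x − y‖^(1/ν)`. -/
theorem whitney_regularity
    (n : ℕ) (X : Set (EuclideanSpace ℝ (Fin n)))
    (hX : IsAnalyticSubset X) (hcomp : IsCompact X) (hconn : IsConnected X) :
    ∃ (ν : ℕ) (C : ℝ), 0 < ν ∧ 0 < C ∧
      ∀ x ∈ X, ∀ y ∈ X,
        ∃ γ : ℝ → EuclideanSpace ℝ (Fin n),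
          ContinuousOn γ (Set.Icc 0 1) ∧
          γ 0 = x ∧ γ 1 = y ∧
          γ '' Set.Icc 0 1 ⊆ X ∧
          eVariationOn γ (Set.Icc 0 1) ≤
            ENNReal.ofReal (C * ‖x - y‖ ^ (1 / (ν : ℝ))) := by
  obtain ⟨D0, hD0⟩ := Metric.isBounded_iff.1 hcomp.isBounded
  have hD1 : (1 : ℝ) ≤ max D0 1 := le_max_right _ _
  have hD : ∀ x ∈ X, ∀ y ∈ X, ‖x - y‖ ≤ max D0 1 := by
    intro x hx y hy
    rw [← dist_eq_norm]
    exact (hD0 hx hy).trans (le_max_left _ _)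
  obtain ⟨C, α, hC, hα, h⟩ := WR.global_reg X hX hcomp hconn.isPreconnected _ hD1 hD
  obtain ⟨k, hk⟩ := exists_nat_one_div_lt hα
  have hDp : (0 : ℝ) < max D0 1 := by linarith
  refine ⟨k + 1, C * (max D0 1) ^ α, Nat.succ_pos _, by positivity, ?_⟩
  intro x hx y hy
  have hj := h (x, y) ⟨hx, hy⟩ hx hy
  have hle : C * ‖x - y‖ ^ α ≤ C * (max D0 1) ^ α * ‖x - y‖ ^ (1 / ((k + 1 : ℕ) : ℝ)) := by
    rw [mul_assoc]
    refine mul_le_mul_of_nonneg_left ?_ hC.le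
    refine WR.pow_change hD1 (norm_nonneg _) (hD x hx y hy) (by positivity) ?_
    push_cast
    exact hk.le
  obtain ⟨γ, h1, h2, h3, h4, h5⟩ := hj.mono le_rfl hle
  refine ⟨γ, h1, h2, h3, ?_, h5⟩
  rintro _ ⟨t, ht, rfl⟩
  exact h4 t ht
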